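/- arXiv:1304.3922 — 3 statements merged into one kernel-verified Lean document; each statement's English description precedes it below -/
import Mathlib

section
/- Let z be a real algebraic irrational number. Then the series ∑_{n=1}^∞ sec(πnz)/n^2 converges absolutely. -/
set_option linter.unusedSimpArgs false

namespace SecRoth
open MvPolynomial

abbrev MP := MvPolynomial ℕ ℝ

/-- sum of absolute values of the coefficients -/
noncomputable def L1 (P : MP) : ℝ := ∑ e ∈ P.support, |coeff e P|

lemma L1_eq {P : MP} {s : Finset (ℕ →₀ ℕ)} (h : P.support ⊆ s) :
    L1 P = ∑ e ∈ s, |coeff e P| := by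
  unfold L1
  apply Finset.sum_subset h
  intro e _ he
  simpa using he

lemma L1_nonneg (P : MP) : 0 ≤ L1 P := Finset.sum_nonneg fun _ _ => abs_nonneg _

lemma L1_zero : L1 0 = 0 := by simp [L1]

lemma coeff_le_L1 (P : MP) (e : ℕ →₀ ℕ) : |coeff e P| ≤ L1 P := by
  by_cases he : e ∈ P.support
  · exact Finset.single_le_sum (f := fun e => |coeff e P|) (fun _ _ => abs_nonneg _) he
  · rw [notMem_support_iff.mp he]; simpa using L1_nonneg P

lemma L1_add_le (P Q : MP) : L1 (P + Q) ≤ L1 P + L1 Q := by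
  classical
  rw [L1_eq (support_add (p := P) (q := Q)), L1_eq (P := P) Finset.subset_union_left,
    L1_eq (P := Q) Finset.subset_union_right, ← Finset.sum_add_distrib]
  apply Finset.sum_le_sum
  intro e _
  rw [coeff_add]; exact abs_add_le _ _

lemma L1_sum_le {ι : Type*} (s : Finset ι) (f : ι → MP) :
    L1 (∑ i ∈ s, f i) ≤ ∑ i ∈ s, L1 (f i) := by
  classical
  induction s using Finset.induction_on with
  | empty => simp [L1_zero]
  | insert a s ha ih =>
    rw [Finset.sum_insert ha, Finset.sum_insert ha]
    exact (L1_add_le _ _).trans (by linarith)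

lemma L1_monomial (e : ℕ →₀ ℕ) (c : ℝ) : L1 (monomial e c) = |c| := by
  classical
  rw [L1_eq (s := {e}) support_monomial_subset]; simp

lemma L1_mul_le (P Q : MP) : L1 (P * Q) ≤ L1 P * L1 Q := by
  classical
  conv_lhs => rw [P.as_sum, Q.as_sum, Finset.sum_mul_sum]
  refine (L1_sum_le _ _).trans ?_
  unfold L1
  rw [Finset.sum_mul_sum]
  apply Finset.sum_le_sum
  intro i _
  refine (L1_sum_le _ _).trans ?_
  apply Finset.sum_le_sum
  intro j _
  rw [monomial_mul, L1_monomial, abs_mul]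

lemma L1_prod_le {ι : Type*} (s : Finset ι) (f : ι → MP) :
    L1 (∏ i ∈ s, f i) ≤ ∏ i ∈ s, L1 (f i) := by
  classical
  induction s using Finset.induction_on with
  | empty =>
    rw [Finset.prod_empty, Finset.prod_empty, show (1 : MP) = monomial 0 1 from rfl, L1_monomial]
    simp
  | insert a s ha ih =>
    rw [Finset.prod_insert ha, Finset.prod_insert ha]
    exact (L1_mul_le _ _).trans (mul_le_mul_of_nonneg_left ih (L1_nonneg _))

lemma L1_C_mul (c : ℝ) (P : MP) : L1 (C c * P) ≤ |c| * L1 P := by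
  refine (L1_mul_le _ _).trans ?_
  rw [← monomial_zero', L1_monomial]

lemma L1_det_le {ι : Type*} [Fintype ι] [DecidableEq ι] (M : Matrix ι ι MP) (B : ℝ)
    (hM : ∀ i j, L1 (M i j) ≤ B) :
    L1 M.det ≤ (Fintype.card ι).factorial * B ^ Fintype.card ι := by
  rw [Matrix.det_apply]
  refine (L1_sum_le _ _).trans ?_
  have : ∀ σ ∈ (Finset.univ : Finset (Equiv.Perm ι)),
      L1 (Equiv.Perm.sign σ • ∏ i, M (σ i) i) ≤ B ^ Fintype.card ι := by
    intro σ _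
    have h1 : L1 (Equiv.Perm.sign σ • ∏ i, M (σ i) i) ≤ L1 (∏ i, M (σ i) i) := by
      rcases Int.units_eq_one_or (Equiv.Perm.sign σ) with h | h
      · rw [h]; simp
      · rw [h]
        have : ((-1 : ℤˣ) • ∏ i, M (σ i) i) = C (-1) * ∏ i, M (σ i) i := by
          simp [Units.smul_def]
        rw [this]
        refine (L1_C_mul _ _).trans ?_
        simp
    refine h1.trans ((L1_prod_le _ _).trans ?_)
    refine (Finset.prod_le_prod (fun _ _ => L1_nonneg _) (fun i _ => hM (σ i) i)).trans ?_
    simp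
  refine (Finset.sum_le_sum this).trans ?_
  simp [Fintype.card_perm]

/-- multi-index binomial coefficient -/
def bin (e I : ℕ →₀ ℕ) : ℕ := I.prod fun h i => (e h).choose i

lemma bin_eq (e I : ℕ →₀ ℕ) {s : Finset ℕ} (h : I.support ⊆ s) :
    bin e I = ∏ i ∈ s, (e i).choose (I i) := by
  unfold bin
  rw [Finsupp.prod_of_support_subset _ h]
  simp

noncomputable def Tay : MP →ₐ[ℝ] MvPolynomial ℕ MP := aeval fun h => C (X h) + X h

/-- Hasse derivative -/
noncomputable def D (I : ℕ →₀ ℕ) (P : MP) : MP := coeff I (Tay P)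

lemma bin_pascal (f I : ℕ →₀ ℕ) (h : ℕ) (hI : I h ≠ 0) (g : ℕ →₀ ℕ)
    (hg : g + Finsupp.single h 1 = f) :
    bin f I = bin g I + bin g (I - Finsupp.single h 1) := by
  classical
  have hh : h ∈ I.support := by simpa using hI
  rw [bin_eq f I (s := I.support) subset_rfl, bin_eq g I (s := I.support) subset_rfl,
    bin_eq g (I - Finsupp.single h 1) (s := I.support)]
  · rw [← Finset.mul_prod_erase _ _ hh, ← Finset.mul_prod_erase _ _ hh,
      ← Finset.mul_prod_erase _ _ hh]
    have e1 : ∏ i ∈ I.support.erase h, (f i).choose (I i)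
        = ∏ i ∈ I.support.erase h, (g i).choose (I i) := by
      apply Finset.prod_congr rfl
      intro i hi
      have : i ≠ h := (Finset.mem_erase.mp hi).1
      rw [← hg]; simp [Finsupp.single_apply, this.symm]
    have e2 : ∏ i ∈ I.support.erase h, (g i).choose ((I - Finsupp.single h 1 : ℕ →₀ ℕ) i)
        = ∏ i ∈ I.support.erase h, (g i).choose (I i) := by
      apply Finset.prod_congr rfl
      intro i hi
      have : i ≠ h := (Finset.mem_erase.mp hi).1
      simp [Finsupp.single_apply, this.symm]
    rw [e1, e2, ← add_mul]
    congr 1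
    rw [← hg]
    obtain ⟨k, hk⟩ := Nat.exists_eq_succ_of_ne_zero hI
    simp [hk, Nat.choose_succ_succ]
    rw [add_comm]
  · intro i hi
    simp only [Finsupp.mem_support_iff, Finsupp.coe_tsub, Pi.sub_apply] at hi ⊢
    omega

lemma bin_congr_off (f g I : ℕ →₀ ℕ) (hfg : ∀ i, I i ≠ 0 → f i = g i) : bin f I = bin g I := by
  rw [bin_eq f I subset_rfl, bin_eq g I subset_rfl]
  apply Finset.prod_congr rfl
  intro i hi
  rw [hfg i (by simpa using hi)]

lemma bin_self (I : ℕ →₀ ℕ) : bin I I = 1 := by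
  rw [bin_eq I I subset_rfl]; simp

lemma D_add (I : ℕ →₀ ℕ) (P Q : MP) : D I (P + Q) = D I P + D I Q := by simp [D]

lemma D_zero (I : ℕ →₀ ℕ) : D I 0 = 0 := by simp [D]

lemma D_sum {ι : Type*} (I : ℕ →₀ ℕ) (s : Finset ι) (f : ι → MP) :
    D I (∑ i ∈ s, f i) = ∑ i ∈ s, D I (f i) := by simp [D, coeff_sum]

lemma D_smul (I : ℕ →₀ ℕ) (c : ℝ) (P : MP) : D I (c • P) = c • D I P := by
  simp [D, map_smul, coeff_smul]

lemma coeff_D (I : ℕ →₀ ℕ) (P : MP) : ∀ f, coeff f (D I P) = bin (f + I) I * coeff (f + I) P := by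
  classical
  induction P using MvPolynomial.induction_on generalizing I with
  | C a =>
    intro f
    have : Tay (C a) = C (C a) := by
      simp [Tay, MvPolynomial.algebraMap_eq, IsScalarTower.algebraMap_apply ℝ MP (MvPolynomial ℕ MP)]
    unfold D
    rw [this]
    by_cases hI : I = 0
    · subst hI
      simp [bin]
    · have : ¬ (0 = f + I) := by
        intro h; apply hI
        ext i
        have := DFunLike.congr_fun h i
        simp at this
        simp; omega
      have h3 : ¬ (0 = I) := fun h => hI h.symm
      simp [coeff_C, this, h3]
  | add P Q hP hQ => intro f; rw [D_add, coeff_add, coeff_add, hP, hQ]; ring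
  | mul_X P h ih =>
    intro f
    have hT : Tay (P * X h) = C (X h) * Tay P + Tay P * X h := by
      simp [Tay]; ring
    have h1 : D I (P * X h) = D I P * X h
        + if h ∈ I.support then D (I - Finsupp.single h 1) P else 0 := by
      unfold D
      rw [hT, coeff_add, coeff_C_mul, coeff_mul_X', mul_comm (X h)]
    rw [h1, coeff_add, coeff_mul_X', coeff_mul_X']
    simp only [Finsupp.mem_support_iff]
    by_cases hf : f h = 0
    · by_cases hI : I h = 0
      · simp [hf, hI]
      · simp only [hf, ne_eq, not_true_eq_false, if_false, hI, not_false_eq_true, if_true, zero_add,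
          Finsupp.add_apply]
        rw [ih]
        have e1 : f + (I - Finsupp.single h 1) = f + I - Finsupp.single h 1 := by
          ext i; by_cases hi : i = h
          · subst hi; simp; omega
          · simp [Finsupp.single_apply, Ne.symm hi]
        rw [e1]
        congr 2
        have := bin_pascal (f + I) I h hI (f + I - Finsupp.single h 1) (by
          ext i; by_cases hi : i = h
          · subst hi; simp; omega
          · simp [Finsupp.single_apply, Ne.symm hi])
        rw [this]
        have h0 : bin (f + I - Finsupp.single h 1) I = 0 := by
          rw [bin_eq _ _ subset_rfl]
          apply Finset.prod_eq_zero (i := h) (by simpa using hI)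
          apply Nat.choose_eq_zero_of_lt
          simp [hf]; omega
        rw [h0, zero_add]
    · by_cases hI : I h = 0
      · simp only [hf, ne_eq, not_true_eq_false, if_false, hI, not_false_eq_true, if_true, add_zero,
          Finsupp.add_apply, coeff_zero]
        rw [ih]
        have e1 : (f - Finsupp.single h 1) + I = f + I - Finsupp.single h 1 := by
          ext i; by_cases hi : i = h
          · subst hi; simp; omega
          · simp [Finsupp.single_apply, Ne.symm hi]
        rw [e1]
        congr 2
        apply bin_congr_off
        intro i hi
        have : i ≠ h := by rintro rfl; exact hi hI
        simp [Finsupp.single_apply, this.symm]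
      · have hfI : f h + I h ≠ 0 := by omega
        simp only [hf, ne_eq, if_false, hI, not_false_eq_true, if_true, 
          Finsupp.add_apply, hfI]
        rw [ih, ih]
        have e1 : (f - Finsupp.single h 1) + I = f + I - Finsupp.single h 1 := by
          ext i; by_cases hi : i = h
          · subst hi; simp; omega
          · simp [Finsupp.single_apply, Ne.symm hi]
        have e2 : f + (I - Finsupp.single h 1) = f + I - Finsupp.single h 1 := by
          ext i; by_cases hi : i = h
          · subst hi; simp; omega
          · simp [Finsupp.single_apply, Ne.symm hi]
        rw [e1, e2]
        have := bin_pascal (f + I) I h hI (f + I - Finsupp.single h 1) (by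
          ext i; by_cases hi : i = h
          · subst hi; simp; omega
          · simp [Finsupp.single_apply, Ne.symm hi])
        rw [this]; push_cast; ring

/-- translation -/
noncomputable def tr (β : ℕ → ℝ) : MP →ₐ[ℝ] MP := aeval fun h => X h + C (β h)

lemma D_tr (β : ℕ → ℝ) (I : ℕ →₀ ℕ) (P : MP) : D I (tr β P) = tr β (D I P) := by
  have : Tay.comp (tr β) = (mapAlgHom (tr β)).comp Tay := by
    apply MvPolynomial.algHom_ext
    intro h
    simp [Tay, tr, MvPolynomial.algebraMap_eq, IsScalarTower.algebraMap_apply ℝ MP (MvPolynomial ℕ MP)]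
    ring
  have h2 := DFunLike.congr_fun this P
  simp only [AlgHom.comp_apply, mapAlgHom_apply] at h2
  unfold D
  rw [h2, coeff_map]
  rfl

lemma coeff_tr_D (β : ℕ → ℝ) (I : ℕ →₀ ℕ) (P : MP) (f : ℕ →₀ ℕ) :
    coeff f (tr β (D I P)) = bin (f + I) I * coeff (f + I) (tr β P) := by
  rw [← D_tr, coeff_D]

lemma coeff_tr (β : ℕ → ℝ) (P : MP) (e : ℕ →₀ ℕ) :
    coeff e (tr β P) = eval β (D e P) := by
  have h := coeff_tr_D β e P 0
  rw [zero_add, bin_self, Nat.cast_one, one_mul] at h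
  rw [← h]
  have : (constantCoeff : MP →+* ℝ).comp (tr β : MP →+* MP) = eval β := by
    apply MvPolynomial.ringHom_ext
    · intro r; simp [tr]
    · intro i; simp [tr]
  rw [← this]; rfl

end SecRoth

set_option linter.unusedSimpArgs false
namespace SecRoth
open MvPolynomial

lemma bin_mul (e I : ℕ →₀ ℕ) (h : ℕ) :
    (e h : ℝ) * bin e I = (I h + 1) * bin e (I + Finsupp.single h 1) + I h * bin e I := by
  classical
  set s := insert h I.support with hs
  have hh : h ∈ s := Finset.mem_insert_self _ _
  have h1 : I.support ⊆ s := Finset.subset_insert _ _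
  have h2 : (I + Finsupp.single h 1).support ⊆ s := by
    intro i hi
    simp only [hs, Finset.mem_insert, Finsupp.mem_support_iff, Finsupp.add_apply] at hi ⊢
    by_cases hi' : i = h
    · exact Or.inl hi'
    · right; simpa [Finsupp.single_apply, Ne.symm hi'] using hi
  rw [bin_eq e I h1, bin_eq e _ h2, ← Finset.mul_prod_erase _ _ hh, ← Finset.mul_prod_erase _ _ hh]
  have e1 : ∏ i ∈ s.erase h, (e i).choose ((I + Finsupp.single h 1 : ℕ →₀ ℕ) i)
        = ∏ i ∈ s.erase h, (e i).choose (I i) := by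
      apply Finset.prod_congr rfl
      intro i hi
      have : i ≠ h := (Finset.mem_erase.mp hi).1
      simp [Finsupp.single_apply, this.symm]
  rw [e1]
  have e2 : (e h : ℝ) * (e h).choose (I h)
      = (I h + 1) * (e h).choose (I h + 1) + I h * (e h).choose (I h) := by
    rcases le_or_gt (I h) (e h) with hle | hlt
    · have := Nat.choose_succ_right_eq (e h) (I h)
      have h3 : ((e h).choose (I h + 1) : ℝ) * (I h + 1) = (e h).choose (I h) * (e h - I h) := by
        rw [← Nat.cast_sub hle]; exact_mod_cast this
      linarith
    · rw [Nat.choose_eq_zero_of_lt hlt, Nat.choose_eq_zero_of_lt (by omega)]; simp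
  push_cast
  rw [Pi.add_apply, Finsupp.single_eq_same]
  linear_combination (∏ i ∈ s.erase h, ((e i).choose (I i) : ℝ)) * e2

section binspan
variable {ι : Type*}

def Tset (e : ι → ℕ →₀ ℕ) (s : ℕ) : Set (ι → ℝ) :=
  {v | ∃ I : ℕ →₀ ℕ, I.degree ≤ s ∧ v = fun j => (bin (e j) I : ℝ)}

lemma Tspan_mul (e : ι → ℕ →₀ ℕ) (s : ℕ) (h : ℕ) (c : ℝ) (v : ι → ℝ)
    (hv : v ∈ Submodule.span ℝ (Tset e s)) :
    (fun j => ((e j h : ℝ) - c) * v j) ∈ Submodule.span ℝ (Tset e (s + 1)) := by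
  induction hv using Submodule.span_induction with
  | mem v hv =>
    obtain ⟨I, hI, rfl⟩ := hv
    have : (fun j => ((e j h : ℝ) - c) * (bin (e j) I : ℝ))
        = ((I h + 1 : ℝ)) • (fun j => (bin (e j) (I + Finsupp.single h 1) : ℝ))
          + ((I h : ℝ) - c) • (fun j => (bin (e j) I : ℝ)) := by
      funext j
      have := bin_mul (e j) I h
      simp only [Pi.add_apply, Pi.smul_apply, smul_eq_mul]
      linarith
    rw [this]
    refine Submodule.add_mem _ (Submodule.smul_mem _ _ (Submodule.subset_span ⟨_, ?_, rfl⟩))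
      (Submodule.smul_mem _ _ (Submodule.subset_span ⟨_, ?_, rfl⟩))
    · rw [map_add, Finsupp.degree_single]; omega
    · omega
  | zero =>
    have : (fun j => ((e j h : ℝ) - c) * (0 : ι → ℝ) j) = 0 := by funext j; simp
    rw [this]; exact Submodule.zero_mem _
  | add v w _ _ hv hw =>
    have : (fun j => ((e j h : ℝ) - c) * (v + w) j) = (fun j => ((e j h : ℝ) - c) * v j)
      + fun j => ((e j h : ℝ) - c) * w j := by funext j; simp; ring
    rw [this]; exact Submodule.add_mem _ hv hw
  | smul a v _ hv =>
    have : (fun j => ((e j h : ℝ) - c) * (a • v) j) = a • (fun j => ((e j h : ℝ) - c) * v j) := by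
      funext j; simp; ring
    rw [this]; exact Submodule.smul_mem _ _ hv

lemma Tspan_sep [DecidableEq ι] (e : ι → ℕ →₀ ℕ) (he : Function.Injective e) (j0 : ι) (s : Finset ι)
    (hs : j0 ∉ s) :
    ∃ v ∈ Submodule.span ℝ (Tset e s.card), v j0 ≠ 0 ∧ ∀ j ∈ s, v j = 0 := by
  induction s using Finset.induction_on with
  | empty =>
    refine ⟨fun _ => 1, Submodule.subset_span ⟨0, by simp, ?_⟩, by simp, by simp⟩
    funext j; simp [bin]
  | insert a s ha ih =>
    obtain ⟨v, hv, h0, hz⟩ := ih (fun h => hs (Finset.mem_insert_of_mem h))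
    have hne : e j0 ≠ e a := fun h => hs (by rw [he h]; exact Finset.mem_insert_self _ _)
    obtain ⟨h, hh⟩ := DFunLike.ne_iff.mp hne
    rw [Finset.card_insert_of_notMem ha]
    refine ⟨_, Tspan_mul e s.card h (e a h) v hv, ?_, ?_⟩
    · refine mul_ne_zero ?_ h0
      rw [sub_ne_zero]; exact_mod_cast hh
    · intro j hj
      rcases Finset.mem_insert.mp hj with rfl | hj
      · simp
      · simp [hz j hj]

lemma exists_bin_det [Fintype ι] [DecidableEq ι] (e : ι → ℕ →₀ ℕ) (he : Function.Injective e) :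
    ∃ I : ι → ℕ →₀ ℕ, (∀ i, (I i).degree ≤ Fintype.card ι - 1) ∧
      (Matrix.of fun i j => (bin (e j) (I i) : ℝ)).det ≠ 0 := by
  have hspan : Submodule.span ℝ (Tset e (Fintype.card ι - 1)) = ⊤ := by
    rw [eq_top_iff, ← (Pi.basisFun ℝ ι).span_eq, Submodule.span_le]
    rintro _ ⟨j0, rfl⟩
    obtain ⟨v, hv, h0, hz⟩ := Tspan_sep e he j0 (Finset.univ.erase j0) (by simp)
    rw [Finset.card_erase_of_mem (Finset.mem_univ _), Finset.card_univ] at hv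
    have : (Pi.basisFun ℝ ι) j0 = (v j0)⁻¹ • v := by
      funext j
      rw [Pi.basisFun_apply]
      by_cases hj : j = j0
      · subst hj; simp [h0]
      · simp [hj, hz j (by simp [hj])]
    rw [this]
    exact Submodule.smul_mem _ _ hv
  obtain ⟨b, hb, hbs, hli⟩ := exists_linearIndependent ℝ (Tset e (Fintype.card ι - 1))
  rw [hspan] at hbs
  let bas : Module.Basis b ℝ (ι → ℝ) := Module.Basis.mk hli (by simp [hbs])
  let eq : ι ≃ b := (Pi.basisFun ℝ ι).indexEquiv bas
  have hb' : ∀ v ∈ b, ∃ I : ℕ →₀ ℕ, I.degree ≤ Fintype.card ι - 1 ∧ v = fun j => (bin (e j) I : ℝ) :=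
    fun v hv => hb hv
  choose! I hI hI' using hb'
  refine ⟨fun i => I (eq i), fun i => hI _ (eq i).2, ?_⟩
  have hli2 : LinearIndependent ℝ (fun i : ι => ((eq i : b) : ι → ℝ)) := hli.comp eq eq.injective
  have : (Matrix.of fun i j => (bin (e j) (I (eq i)) : ℝ)) = Matrix.of fun i => ((eq i : b) : ι → ℝ) := by
    ext i j
    exact (congrFun (hI' _ (eq i).2) j).symm
  rw [this]
  have h3 := (Matrix.linearIndependent_rows_iff_isUnit (A := Matrix.of fun i => ((eq i : b) : ι → ℝ))).mp hli2
  exact ((Matrix.isUnit_iff_isUnit_det _).mp h3).ne_zero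
end binspan

def LexLe (Q : MP) (e : ℕ →₀ ℕ) : Prop := ∀ a, coeff a Q ≠ 0 → toLex a ≤ toLex e

lemma LexLe.mul {P Q : MP} {e f : ℕ →₀ ℕ} (hP : LexLe P e) (hQ : LexLe Q f) :
    LexLe (P * Q) (e + f) ∧ coeff (e + f) (P * Q) = coeff e P * coeff f Q := by
  classical
  constructor
  · intro a ha
    rw [coeff_mul] at ha
    obtain ⟨⟨x, y⟩, hx, hxy⟩ := Finset.exists_ne_zero_of_sum_ne_zero ha
    rw [Finset.HasAntidiagonal.mem_antidiagonal] at hx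
    rw [← hx]
    exact add_le_add (hP x (left_ne_zero_of_mul hxy)) (hQ y (right_ne_zero_of_mul hxy))
  · rw [coeff_mul, Finset.sum_eq_single (e, f)]
    · rintro ⟨x, y⟩ hx hne
      rw [Finset.HasAntidiagonal.mem_antidiagonal] at hx
      simp only at hx
      by_contra hxy
      have h1 := hP x (left_ne_zero_of_mul hxy)
      have h2 := hQ y (right_ne_zero_of_mul hxy)
      have h3 : toLex x + toLex y = toLex e + toLex f := by
        rw [← toLex_add, ← toLex_add, hx]
      have h4 : toLex x = toLex e := by
        refine le_antisymm h1 ?_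
        by_contra hlt
        exact absurd h3 (ne_of_lt (add_lt_add_of_lt_of_le (not_le.mp hlt) h2))
      have h5 : x = e := by simpa using h4
      subst h5
      apply hne
      simpa using hx
    · simp

lemma LexLe.prod {ι : Type*} (s : Finset ι) (P : ι → MP) (e : ι → ℕ →₀ ℕ)
    (h : ∀ i ∈ s, LexLe (P i) (e i)) :
    LexLe (∏ i ∈ s, P i) (∑ i ∈ s, e i) ∧
      coeff (∑ i ∈ s, e i) (∏ i ∈ s, P i) = ∏ i ∈ s, coeff (e i) (P i) := by
  classical
  induction s using Finset.induction_on with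
  | empty =>
    refine ⟨?_, by simp⟩
    intro a ha
    simp only [Finset.prod_empty, coeff_one] at ha
    simp only [ne_eq, ite_eq_right_iff, one_ne_zero, imp_false, not_not] at ha
    simp [← ha]
  | insert a s ha ih =>
    obtain ⟨h1, h2⟩ := ih fun i hi => h i (Finset.mem_insert_of_mem hi)
    rw [Finset.prod_insert ha, Finset.sum_insert ha, Finset.prod_insert ha, ← h2]
    exact (h a (Finset.mem_insert_self _ _)).mul h1

lemma coeff_euler (I a : ℕ →₀ ℕ) (f : MP) :
    coeff a (monomial I 1 * D I f) = bin a I * coeff a f := by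
  classical
  rw [coeff_monomial_mul']
  split_ifs with h
  · rw [coeff_D, tsub_add_cancel_of_le h, one_mul]
  · have : bin a I = 0 := by
      obtain ⟨i, hi⟩ : ∃ i, a i < I i := by
        by_contra! hc; exact h hc
      rw [bin_eq _ _ subset_rfl]
      apply Finset.prod_eq_zero (i := i) (by simp; omega)
      exact Nat.choose_eq_zero_of_lt hi
    simp [this]

lemma exists_leading {ι : Type*} [Fintype ι] (φ : ι → MP) (hφ : LinearIndependent ℝ φ) :
    ∃ (e : ι → ℕ →₀ ℕ) (f : ι → MP), Function.Injective e ∧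
      (∀ i, f i ∈ Submodule.span ℝ (Set.range φ)) ∧ (∀ i, coeff (e i) (f i) ≠ 0) ∧
      ∀ i, LexLe (f i) (e i) := by
  classical
  set S := Submodule.span ℝ (Set.range φ) with hS
  set U : Finset (ℕ →₀ ℕ) := Finset.univ.biUnion fun j => (φ j).support with hU
  have hUS : ∀ f ∈ S, ∀ a, coeff a f ≠ 0 → a ∈ U := by
    intro f hf
    induction hf using Submodule.span_induction with
    | mem v hv =>
      obtain ⟨j, rfl⟩ := hv
      intro a ha
      simp only [hU, Finset.mem_biUnion, Finset.mem_univ, true_and]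
      exact ⟨j, mem_support_iff.mpr ha⟩
    | zero => intro a ha; simp at ha
    | add v w _ _ hv hw =>
      intro a ha
      by_contra hc
      apply ha
      rw [coeff_add, not_not.mp (mt (hv a) hc), not_not.mp (mt (hw a) hc), add_zero]
    | smul c v _ hv =>
      intro a ha
      apply hv
      rw [coeff_smul] at ha
      exact right_ne_zero_of_mul ha
  set L := U.filter fun e => ∃ f ∈ S, coeff e f ≠ 0 ∧ LexLe f e with hL
  have hfin : Module.finrank ℝ S = Fintype.card ι := finrank_span_eq_card hφ
  have hcard : Fintype.card ι ≤ L.card := by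
    let ev : S →ₗ[ℝ] (L → ℝ) :=
      { toFun := fun f e => coeff e.1 f.1
        map_add' := by intro x y; funext e; simp
        map_smul' := by intro c y; funext e; simp }
    have hinj : Function.Injective ev := by
      rw [← LinearMap.ker_eq_bot, LinearMap.ker_eq_bot']
      rintro ⟨f, hf⟩ h0
      by_contra hne
      have hf0 : f ≠ 0 := by
        intro h; apply hne; ext1; exact h
      have hne2 : (f.support.image toLex).Nonempty :=
        Finset.Nonempty.image (by simpa [Finset.nonempty_iff_ne_empty] using hf0) _
      set a := (f.support.image toLex).max' hne2 with ha
      have hmem := Finset.max'_mem _ hne2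
      rw [Finset.mem_image] at hmem
      obtain ⟨b, hb, hba⟩ := hmem
      have hbL : b ∈ L := by
        rw [hL, Finset.mem_filter]
        refine ⟨hUS f hf b (mem_support_iff.mp hb), f, hf, mem_support_iff.mp hb, ?_⟩
        intro c hc
        rw [hba]
        apply Finset.le_max'
        exact Finset.mem_image_of_mem _ (mem_support_iff.mpr hc)
      have := congrFun h0 ⟨b, hbL⟩
      exact mem_support_iff.mp hb this
    have := LinearMap.finrank_le_finrank_of_injective hinj
    rw [hfin] at this
    simpa using this
  obtain ⟨emb⟩ : Nonempty (ι ↪ L) := Function.Embedding.nonempty_of_card_le (by simpa using hcard)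
  have hex : ∀ i, ∃ f ∈ S, coeff (emb i).1 f ≠ 0 ∧ LexLe f (emb i).1 := by
    intro i
    exact (Finset.mem_filter.mp (emb i).2).2
  choose f hf1 hf2 hf3 using hex
  exact ⟨fun i => (emb i).1, f, fun i j h => emb.injective (Subtype.ext h), hf1, hf2, hf3⟩

/-- Generalized Wronskian. -/
lemma exists_wronskian {ι : Type*} [Fintype ι] [DecidableEq ι] (φ : ι → MP)
    (hφ : LinearIndependent ℝ φ) :
    ∃ I : ι → ℕ →₀ ℕ, (∀ i, (I i).degree ≤ Fintype.card ι - 1) ∧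
      (Matrix.of fun i j => D (I i) (φ j)).det ≠ 0 := by
  obtain ⟨e, f, he, hfS, hlc, hle⟩ := exists_leading φ hφ
  obtain ⟨I, hI, hdet⟩ := exists_bin_det e he
  refine ⟨I, hI, fun h0 => ?_⟩
  have hc : ∀ j, ∃ c : ι → ℝ, ∑ i, c i • φ i = f j := fun j =>
    (Submodule.mem_span_range_iff_exists_fun ℝ).mp (hfS j)
  choose c hc using hc
  have h1 : (Matrix.of fun i j => D (I i) (f j))
      = (Matrix.of fun i j => D (I i) (φ j)) * (Matrix.of fun i j => C (c j i)) := by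
    ext1 i j
    rw [Matrix.mul_apply]
    simp only [Matrix.of_apply]
    rw [← hc j, D_sum]
    apply Finset.sum_congr rfl
    intro k _
    rw [D_smul, smul_eq_C_mul, mul_comm]
  have h2 : (Matrix.of fun i j => D (I i) (f j)).det = 0 := by
    rw [h1, Matrix.det_mul, h0, zero_mul]
  have h3 : (Matrix.of fun i j => (monomial (I i) (1 : ℝ)) * D (I i) (f j)).det = 0 := by
    have := Matrix.det_mul_column (fun i => (monomial (I i) (1 : ℝ))) (Matrix.of fun i j => D (I i) (f j))
    rw [h2, mul_zero] at this
    exact this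
  have h4 : coeff (∑ j, e j) (Matrix.of fun i j => (monomial (I i) (1 : ℝ)) * D (I i) (f j)).det
      = (Matrix.of fun i j => coeff (e j) (f j) * (bin (e j) (I i) : ℝ)).det := by
    rw [Matrix.det_apply, Matrix.det_apply, coeff_sum]
    apply Finset.sum_congr rfl
    intro σ _
    have h5 := (LexLe.prod Finset.univ (fun i => (monomial (I (σ i)) (1 : ℝ)) * D (I (σ i)) (f i)) e
      (by
        intro i _ a ha
        apply hle i
        rw [coeff_euler] at ha
        exact right_ne_zero_of_mul ha)).2
    simp only [Units.smul_def, Matrix.of_apply, coeff_smul]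
    rw [h5]
    congr 1
    apply Finset.prod_congr rfl
    intro i _
    rw [coeff_euler, mul_comm]
  rw [h3, coeff_zero] at h4
  have h6 := Matrix.det_mul_row (fun j => coeff (e j) (f j)) (Matrix.of fun i j => (bin (e j) (I i) : ℝ))
  have h7 : (∏ j, coeff (e j) (f j)) * (Matrix.of fun i j => (bin (e j) (I i) : ℝ)).det = 0 := by
    rw [← h6]; exact h4.symm
  rcases mul_eq_zero.mp h7 with h | h
  · obtain ⟨j, _, hj⟩ := Finset.prod_eq_zero_iff.mp h
    exact hlc j hj
  · exact hdet h

end SecRoth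

set_option linter.unusedSimpArgs false
namespace SecRoth
open MvPolynomial

/-- polynomials with integer coefficients -/
noncomputable def ZP : Subring MP := (map (σ := ℕ) (Int.castRingHom ℝ)).range

lemma mem_ZP_iff (P : MP) : P ∈ ZP ↔ ∀ e, ∃ z : ℤ, coeff e P = z := by
  classical
  constructor
  · rintro ⟨Q, rfl⟩ e
    exact ⟨coeff e Q, by rw [coeff_map]; simp⟩
  · intro h
    choose z hz using h
    refine ⟨∑ e ∈ P.support, monomial e (z e), ?_⟩
    rw [map_sum]
    conv_rhs => rw [P.as_sum]
    apply Finset.sum_congr rfl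
    intro e _
    rw [map_monomial, hz]; simp

lemma det_mem_ZP {ι : Type*} [Fintype ι] [DecidableEq ι] (M : Matrix ι ι MP)
    (hM : ∀ i j, M i j ∈ ZP) : M.det ∈ ZP := by
  rw [Matrix.det_apply]
  refine Subring.sum_mem _ fun σ _ => ?_
  rw [Units.smul_def]
  exact Subring.zsmul_mem _ (Subring.prod_mem _ fun i _ => hM _ _) _

lemma D_mem_ZP {P : MP} (hP : P ∈ ZP) (I : ℕ →₀ ℕ) : D I P ∈ ZP := by
  rw [mem_ZP_iff] at hP ⊢
  intro e
  obtain ⟨z, hz⟩ := hP (e + I)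
  exact ⟨bin (e + I) I * z, by rw [coeff_D, hz]; push_cast; rfl⟩

lemma coeff_mul_ne {P Q : MP} {e : ℕ →₀ ℕ} (h : coeff e (P * Q) ≠ 0) :
    ∃ a b, a + b = e ∧ coeff a P ≠ 0 ∧ coeff b Q ≠ 0 := by
  classical
  rw [coeff_mul] at h
  obtain ⟨⟨x, y⟩, hx, hxy⟩ := Finset.exists_ne_zero_of_sum_ne_zero h
  rw [Finset.HasAntidiagonal.mem_antidiagonal] at hx
  exact ⟨x, y, hx, left_ne_zero_of_mul hxy, right_ne_zero_of_mul hxy⟩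

lemma coeff_prod_ne {ι : Type*} (s : Finset ι) (P : ι → MP) {e : ℕ →₀ ℕ}
    (h : coeff e (∏ i ∈ s, P i) ≠ 0) :
    ∃ a : ι → ℕ →₀ ℕ, ∑ i ∈ s, a i = e ∧ ∀ i ∈ s, coeff (a i) (P i) ≠ 0 := by
  classical
  induction s using Finset.induction_on generalizing e with
  | empty =>
    simp only [Finset.prod_empty, coeff_one] at h
    simp only [ne_eq, ite_eq_right_iff, one_ne_zero, imp_false, not_not] at h
    exact ⟨fun _ => 0, by simp [h], by simp⟩
  | insert i s hi ih =>
    rw [Finset.prod_insert hi] at h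
    obtain ⟨a, b, rfl, ha, hb⟩ := coeff_mul_ne h
    obtain ⟨c, hc, hc'⟩ := ih hb
    refine ⟨Function.update c i a, ?_, ?_⟩
    · rw [Finset.sum_insert hi, Function.update_self, ← hc]
      congr 1
      apply Finset.sum_congr rfl
      intro j hj
      rw [Function.update_of_ne]
      rintro rfl; exact hi hj
    · intro j hj
      by_cases hji : j = i
      · subst hji; simpa using ha
      · rw [Function.update_of_ne hji]
        exact hc' j (Finset.mem_of_mem_insert_of_ne hj hji)

lemma coeff_det_ne {ι : Type*} [Fintype ι] [DecidableEq ι] (M : Matrix ι ι MP) {e : ℕ →₀ ℕ}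
    (h : coeff e M.det ≠ 0) :
    ∃ (σ : Equiv.Perm ι) (a : ι → ℕ →₀ ℕ), ∑ i, a i = e ∧ ∀ i, coeff (a i) (M (σ i) i) ≠ 0 := by
  rw [Matrix.det_apply, coeff_sum] at h
  obtain ⟨σ, _, hσ⟩ := Finset.exists_ne_zero_of_sum_ne_zero h
  rw [Units.smul_def, coeff_smul] at hσ
  have : coeff e (∏ i, M (σ i) i) ≠ 0 := by
    intro h0; apply hσ; rw [h0, smul_zero]
  obtain ⟨a, ha, ha'⟩ := coeff_prod_ne _ _ this
  exact ⟨σ, a, ha, fun i => ha' i (Finset.mem_univ _)⟩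

lemma coeff_D_ne {P : MP} {I f : ℕ →₀ ℕ} (h : coeff f (D I P) ≠ 0) : coeff (f + I) P ≠ 0 := by
  rw [coeff_D] at h; exact right_ne_zero_of_mul h

lemma coeff_tr_ne {P : MP} {β : ℕ → ℝ} {e : ℕ →₀ ℕ} (h : coeff e (tr β P) ≠ 0) :
    ∃ f, coeff (f + e) P ≠ 0 := by
  rw [coeff_tr] at h
  by_contra! hc
  apply h
  have : D e P = 0 := by
    ext f
    rw [coeff_D, hc, mul_zero, coeff_zero]
  rw [this, map_zero]

def Free (v : ℕ) (P : MP) : Prop := ∀ e, coeff e P ≠ 0 → e v = 0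
def Only (v : ℕ) (P : MP) : Prop := ∀ e, coeff e P ≠ 0 → ∀ h, h ≠ v → e h = 0

lemma Free.tr {v : ℕ} {P : MP} (h : Free v P) (β : ℕ → ℝ) : Free v (tr β P) := by
  intro e he
  obtain ⟨f, hf⟩ := coeff_tr_ne he
  have := h _ hf
  simp at this; omega

lemma Only.tr {v : ℕ} {P : MP} (h : Only v P) (β : ℕ → ℝ) : Only v (tr β P) := by
  intro e he w hw
  obtain ⟨f, hf⟩ := coeff_tr_ne he
  have := h _ hf w hw
  simp at this; omega

lemma Free.D {v : ℕ} {P : MP} (h : Free v P) (I : ℕ →₀ ℕ) : Free v (D I P) := by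
  intro e he
  have := h _ (coeff_D_ne he)
  simp at this; omega

lemma Only.D {v : ℕ} {P : MP} (h : Only v P) (I : ℕ →₀ ℕ) : Only v (D I P) := by
  intro e he w hw
  have := h _ (coeff_D_ne he) w hw
  simp at this; omega

lemma Free.det {ι : Type*} [Fintype ι] [DecidableEq ι] {v : ℕ} {M : Matrix ι ι MP}
    (h : ∀ i j, Free v (M i j)) : Free v M.det := by
  intro e he
  obtain ⟨σ, a, rfl, ha⟩ := coeff_det_ne M he
  rw [Finsupp.finsetSum_apply]
  exact Finset.sum_eq_zero fun i _ => h _ _ _ (ha i)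

lemma Only.det {ι : Type*} [Fintype ι] [DecidableEq ι] {v : ℕ} {M : Matrix ι ι MP}
    (h : ∀ i j, Only v (M i j)) : Only v M.det := by
  intro e he w hw
  obtain ⟨σ, a, rfl, ha⟩ := coeff_det_ne M he
  rw [Finsupp.finsetSum_apply]
  exact Finset.sum_eq_zero fun i _ => h _ _ _ (ha i) w hw

lemma coeff_sep {v : ℕ} {φ ψ : MP} (hφ : Free v φ) (hψ : Only v ψ) (f : ℕ →₀ ℕ) :
    coeff f (φ * ψ) = coeff (f.erase v) φ * coeff (Finsupp.single v (f v)) ψ := by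
  classical
  rw [coeff_mul, Finset.sum_eq_single (f.erase v, Finsupp.single v (f v))]
  · rintro ⟨x, y⟩ hx hne
    rw [Finset.HasAntidiagonal.mem_antidiagonal] at hx
    simp only at hx
    by_contra hxy
    have h1 := hφ x (left_ne_zero_of_mul hxy)
    have h2 := hψ y (right_ne_zero_of_mul hxy)
    apply hne
    rw [← hx]
    ext i
    · by_cases hi : i = v
      · subst hi; simp [h1]
      · simp [hi, h2 i hi]
    · by_cases hi : i = v
      · subst hi; simp [h1]
      · simp [hi, h2 i hi, Finsupp.single_apply, Ne.symm hi]
  · intro h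
    exfalso; apply h
    rw [Finset.HasAntidiagonal.mem_antidiagonal]
    exact Finsupp.erase_add_single v f

lemma coeff_sep' {v : ℕ} {φ ψ : MP} (hφ : Free v φ) (hψ : Only v ψ) {a b : ℕ →₀ ℕ}
    (ha : a v = 0) (hb : ∀ h, h ≠ v → b h = 0) :
    coeff (a + b) (φ * ψ) = coeff a φ * coeff b ψ := by
  rw [coeff_sep hφ hψ]
  congr 2
  · ext i
    by_cases hi : i = v
    · subst hi; simp [ha]
    · simp [hi, hb i hi]
  · ext i
    by_cases hi : i = v
    · subst hi; simp [ha]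
    · simp [Finsupp.single_apply, Ne.symm hi, hb i hi]

lemma D_sep {v : ℕ} {φ ψ : MP} (hφ : Free v φ) (hψ : Only v ψ) {I J : ℕ →₀ ℕ}
    (hI : I v = 0) (hJ : ∀ h, h ≠ v → J h = 0) :
    D (I + J) (φ * ψ) = D I φ * D J ψ := by
  classical
  ext f
  rw [coeff_sep (hφ.D I) (hψ.D J), coeff_D, coeff_D, coeff_D]
  have e1 : f + (I + J) = (f.erase v + I) + (Finsupp.single v (f v) + J) := by
    rw [← add_add_add_comm, Finsupp.erase_add_single]
  have e2 : coeff (f + (I + J)) (φ * ψ)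
      = coeff (f.erase v + I) φ * coeff (Finsupp.single v (f v) + J) ψ := by
    rw [e1]
    apply coeff_sep' hφ hψ
    · simp [hI]
    · intro h hh; simp [hJ h hh, Finsupp.single_apply, Ne.symm hh]
  have e3 : bin (f + (I + J)) (I + J)
      = bin (f.erase v + I) I * bin (Finsupp.single v (f v) + J) J := by
    have hs1 : I.support ⊆ I.support ∪ J.support := Finset.subset_union_left
    have hs2 : J.support ⊆ I.support ∪ J.support := Finset.subset_union_right
    rw [bin_eq _ I hs1, bin_eq _ J hs2, bin_eq _ (I + J) Finsupp.support_add,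
      ← Finset.prod_mul_distrib]
    apply Finset.prod_congr rfl
    intro i _
    by_cases hi : i = v
    · subst hi; simp [hI]
    · simp [hi, hJ i hi]
  rw [e2, e3]; push_cast; ring

lemma onevar {v : ℕ} {V : MP} (hV : Only v V) (hV0 : V ≠ 0) (hZ : V ∈ ZP) (b : ℚ) (β : ℕ → ℝ)
    (hβ : β v = b) :
    ∃ s : ℕ, coeff (Finsupp.single v s) (tr β V) ≠ 0 ∧ (b.den : ℝ) ^ s ≤ L1 V := by
  classical
  obtain ⟨V0, rfl⟩ := hZ
  set p : Polynomial ℤ := ∑ e ∈ V0.support, Polynomial.monomial (e v) (coeff e V0) with hp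
  set pR : Polynomial ℝ := p.map (Int.castRingHom ℝ) with hpR
  have hsupp : ∀ e ∈ V0.support, e = Finsupp.single v (e v) := by
    intro e he
    have : coeff e (map (Int.castRingHom ℝ) V0) ≠ 0 := by
      rw [coeff_map]; simpa using he
    ext i
    by_cases hi : i = v
    · subst hi; simp
    · simp [hV e this i hi, Finsupp.single_apply, Ne.symm hi]
  have hVp : map (Int.castRingHom ℝ) V0 = Polynomial.aeval (X v : MP) pR := by
    conv_lhs => rw [V0.as_sum]
    rw [hpR, hp, Polynomial.map_sum, map_sum, map_sum]
    apply Finset.sum_congr rfl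
    intro e he
    rw [map_monomial, Polynomial.map_monomial, Polynomial.aeval_monomial]
    conv_lhs => rw [hsupp e he]
    rw [MvPolynomial.algebraMap_eq, C_mul_X_pow_eq_monomial, ← hsupp e he]
  have hp0 : p ≠ 0 := by
    intro h
    apply hV0
    rw [hVp, hpR, h]; simp
  have hpR0 : pR ≠ 0 := by
    rw [hpR]; exact (Polynomial.map_ne_zero_iff (RingHom.injective_int _)).mpr hp0
  refine ⟨pR.rootMultiplicity (b : ℝ), ?_, ?_⟩
  · obtain ⟨g, hg, hg'⟩ := Polynomial.exists_eq_pow_rootMultiplicity_mul_and_not_dvd pR hpR0 (b : ℝ)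
    set s := pR.rootMultiplicity (b : ℝ)
    have h1 : tr β (map (Int.castRingHom ℝ) V0)
        = X v ^ s * Polynomial.aeval (X v + C (b : ℝ) : MP) g := by
      rw [hVp, ← Polynomial.aeval_algHom_apply, hg]
      simp [tr, hβ, MvPolynomial.algebraMap_eq]
    rw [h1, X_pow_eq_monomial]
    have h2 := coeff_monomial_mul (0 : ℕ →₀ ℕ) (Finsupp.single v s) (1 : ℝ)
      (Polynomial.aeval (X v + C (b : ℝ) : MP) g)
    rw [add_zero, one_mul] at h2
    rw [h2]
    have h3 : coeff 0 (Polynomial.aeval (X v + C (b : ℝ) : MP) g) = g.eval (b : ℝ) := by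
      have : coeff 0 (Polynomial.aeval (X v + C (b : ℝ) : MP) g)
        = constantCoeff (Polynomial.aeval (X v + C (b : ℝ) : MP) g) := rfl
      rw [this, Polynomial.aeval_def, Polynomial.hom_eval₂]
      simp [Polynomial.eval₂_eq_eval_map]
    rw [h3]
    rwa [Polynomial.dvd_iff_isRoot] at hg'
  · set s := pR.rootMultiplicity (b : ℝ) with hs
    have hsQ : s = (p.map (Int.castRingHom ℚ)).rootMultiplicity b := by
      have h1 := Polynomial.eq_rootMultiplicity_map (p := p.map (Int.castRingHom ℚ))
        (f := Rat.castHom ℝ) (Rat.castHom ℝ).injective b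
      rw [h1, hs, hpR, Polynomial.map_map]
      congr 1
    have hdvdQ : (Polynomial.X - Polynomial.C b) ^ s ∣ p.map (Int.castRingHom ℚ) := by
      rw [hsQ]; exact Polynomial.pow_rootMultiplicity_dvd _ _
    set t : Polynomial ℤ := Polynomial.C (b.den : ℤ) * Polynomial.X - Polynomial.C b.num with ht
    have htprim : t.IsPrimitive := by
      intro r hr
      rw [Polynomial.C_dvd_iff_dvd_coeff] at hr
      have h0 := hr 0
      have h1 := hr 1
      rw [ht, Polynomial.coeff_sub, Polynomial.coeff_C_mul, Polynomial.coeff_C] at h0 h1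
      simp at h0 h1
      have hcop : IsCoprime b.num (b.den : ℤ) := by
        rw [Int.isCoprime_iff_gcd_eq_one]; exact b.reduced
      exact hcop.isUnit_of_dvd' h0 h1
    have htmap : t.map (Int.castRingHom ℚ) = Polynomial.C (b.den : ℚ) * (Polynomial.X - Polynomial.C b) := by
      simp [ht, mul_sub]
      rw [← Polynomial.C_eq_natCast, ← Polynomial.C_eq_intCast, ← Polynomial.C_mul]
      congr 2
      rw [mul_comm]; exact (Rat.mul_den_eq_num b).symm
    have hden : (b.den : ℚ) ≠ 0 := by exact_mod_cast b.den_nz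
    have htpow : ∀ n : ℕ, (t ^ n).IsPrimitive := by
      intro n
      induction n with
      | zero => rw [pow_zero]; exact Polynomial.isPrimitive_one
      | succ n ih => rw [pow_succ]; exact Polynomial.IsPrimitive.mul ih htprim
    have hts : (t ^ s).IsPrimitive := htpow s
    have hdvd : t ^ s ∣ p := by
      rw [Polynomial.IsPrimitive.Int.dvd_iff_map_cast_dvd_map_cast _ _ hts]
      rw [Polynomial.map_pow, htmap, mul_pow, ← Polynomial.C_pow]
      rw [(Polynomial.isUnit_C.mpr (IsUnit.mk0 _ (pow_ne_zero s hden))).mul_left_dvd]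
      exact hdvdQ
    obtain ⟨g, hg⟩ := hdvd
    have hlc : p.leadingCoeff = (b.den : ℤ) ^ s * g.leadingCoeff := by
      have ht1 : t.leadingCoeff = (b.den : ℤ) := by
        rw [ht, sub_eq_add_neg, ← Polynomial.C_neg]
        exact Polynomial.leadingCoeff_linear (by exact_mod_cast b.den_nz)
      rw [hg, Polynomial.leadingCoeff_mul, Polynomial.leadingCoeff_pow, ht1]
    have hle : ((b.den : ℤ) ^ s) ≤ |p.leadingCoeff| := by
      apply Int.le_of_dvd (abs_pos.mpr (Polynomial.leadingCoeff_ne_zero.mpr hp0))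
      rw [dvd_abs, hlc]; exact Dvd.intro _ rfl
    have hL : (|p.leadingCoeff| : ℝ) ≤ L1 (map (Int.castRingHom ℝ) V0) := by
      rw [Polynomial.leadingCoeff, hp, Polynomial.finsetSum_coeff]
      rw [L1_eq (s := V0.support) (by
        intro e he
        rw [mem_support_iff, coeff_map] at he
        rw [mem_support_iff]; intro h; apply he; rw [h]; simp)]
      push_cast
      refine (Finset.abs_sum_le_sum_abs _ _).trans (Finset.sum_le_sum ?_)
      intro e _
      rw [Polynomial.coeff_monomial, coeff_map]
      split_ifs
      · simp
      · simp
    refine le_trans ?_ hL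
    exact_mod_cast hle

end SecRoth

set_option linter.unusedSimpArgs false
namespace SecRoth
open MvPolynomial

lemma slice_bound {Q W : MP} (c : ℕ →₀ ℕ) (h : ∀ a, coeff a Q ≠ 0 → coeff a Q = coeff (a + c) W)
    (hW : W ∈ ZP) : Q ∈ ZP ∧ L1 Q ≤ L1 W := by
  classical
  constructor
  · rw [mem_ZP_iff] at hW ⊢
    intro e
    by_cases he : coeff e Q = 0
    · exact ⟨0, by simp [he]⟩
    · rw [h e he]; exact hW _
  · unfold L1
    have h1 : ∑ e ∈ Q.support, |coeff e Q| = ∑ e ∈ Q.support, |coeff (e + c) W| := by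
      apply Finset.sum_congr rfl
      intro e he
      rw [h e (mem_support_iff.mp he)]
    rw [h1, ← Finset.sum_image (s := Q.support) (g := fun e => e + c) (f := fun e => |coeff e W|)
      (fun x _ y _ hxy => add_right_cancel hxy)]
    apply Finset.sum_le_sum_of_subset_of_nonneg
    · intro e he
      obtain ⟨a, ha, rfl⟩ := Finset.mem_image.mp he
      rw [mem_support_iff, ← h a (mem_support_iff.mp ha)]
      exact mem_support_iff.mp ha
    · intros; exact abs_nonneg _

lemma tr_ne_zero {P : MP} (hP : P ≠ 0) (β : ℕ → ℝ) : tr β P ≠ 0 := by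
  intro h
  apply hP
  have h1 : (tr (-β)).comp (tr β) = AlgHom.id ℝ MP := by
    apply MvPolynomial.algHom_ext
    intro i
    simp [tr, MvPolynomial.algebraMap_eq]
  have h2 := DFunLike.congr_fun h1 P
  simp only [AlgHom.comp_apply, h, map_zero, AlgHom.id_apply] at h2
  exact h2.symm

noncomputable def slice (v l : ℕ) (P : MP) : MP :=
  ∑ e ∈ P.support.filter (fun e => e v = l), monomial (e.erase v) (coeff e P)

lemma coeff_slice (v l : ℕ) (P : MP) (a : ℕ →₀ ℕ) :
    coeff a (slice v l P) = if a v = 0 then coeff (a + Finsupp.single v l) P else 0 := by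
  classical
  unfold slice
  rw [coeff_sum]
  simp only [coeff_monomial]
  split_ifs with ha
  · rw [Finset.sum_eq_single (a + Finsupp.single v l)]
    · rw [if_pos]
      ext i; by_cases hi : i = v
      · subst hi; simp [ha]
      · simp [hi, Finsupp.single_apply, Ne.symm hi]
    · intro b hb hne
      rw [if_neg]
      rintro rfl
      apply hne
      rw [← (Finset.mem_filter.mp hb).2, Finsupp.erase_add_single]
    · intro hb
      rw [if_pos]
      · by_contra hc
        apply hb
        rw [Finset.mem_filter, mem_support_iff]
        exact ⟨hc, by simp [ha]⟩
      · ext i; by_cases hi : i = v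
        · subst hi; simp [ha]
        · simp [hi, Finsupp.single_apply, Ne.symm hi]
  · apply Finset.sum_eq_zero
    intro b _
    rw [if_neg]
    rintro rfl
    simp at ha

lemma decomp (P : MP) (hP : P ≠ 0) (v N : ℕ) (hN : ∀ e, coeff e P ≠ 0 → e v ≤ N) :
    ∃ (ι : Type) (_ : Fintype ι) (φ ψ : ι → MP), LinearIndependent ℝ φ ∧ LinearIndependent ℝ ψ ∧
      (∀ i, Free v (φ i)) ∧ (∀ i, Only v (ψ i)) ∧ P = ∑ i, φ i * ψ i ∧
      Fintype.card ι ≤ N + 1 ∧ 1 ≤ Fintype.card ι ∧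
      ∀ i e, coeff e (φ i) ≠ 0 → ∃ l, coeff (e + Finsupp.single v l) P ≠ 0 := by
  classical
  obtain ⟨κ, a, hinj, hspan, hli⟩ := exists_linearIndependent' ℝ (fun l : Fin (N + 1) => slice v l P)
  haveI : Finite κ := Finite.of_injective a hinj
  letI : Fintype κ := Fintype.ofFinite κ
  set φ : κ → MP := (fun l : Fin (N + 1) => slice v l P) ∘ a with hφ
  have hc : ∀ l : Fin (N + 1), ∃ c : κ → ℝ, ∑ j, c j • φ j = slice v l P := by
    intro l
    apply (Submodule.mem_span_range_iff_exists_fun ℝ).mp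
    rw [hspan]
    exact Submodule.subset_span ⟨l, rfl⟩
  choose c hc using hc
  set ψ : κ → MP := fun j => ∑ l : Fin (N + 1), monomial (Finsupp.single v (l : ℕ)) (c l j) with hψ
  have hcδ : ∀ j j', c (a j') j = if j = j' then 1 else 0 := by
    intro j j'
    have h1 : ∑ j, (c (a j') j - if j = j' then 1 else 0) • φ j = 0 := by
      simp only [sub_smul, Finset.sum_sub_distrib, hc, ite_smul, one_smul, zero_smul]
      simp [hφ]
    have := Fintype.linearIndependent_iff.mp hli _ h1 j
    linarith
  have hcoψ : ∀ j (l : Fin (N + 1)), coeff (Finsupp.single v (l : ℕ)) (ψ j) = c l j := by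
    intro j l
    rw [hψ, coeff_sum, Finset.sum_eq_single l]
    · simp
    · intro b _ hb
      rw [coeff_monomial, if_neg]
      intro h
      apply hb
      have := DFunLike.congr_fun h v
      simp at this
      exact Fin.ext this
    · simp
  have hsum : P = ∑ i, φ i * ψ i := by
    have h1 : P = ∑ l : Fin (N + 1), slice v l P * monomial (Finsupp.single v (l : ℕ)) 1 := by
      ext e
      rw [coeff_sum]
      by_cases he : e v ≤ N
      · rw [Finset.sum_eq_single (⟨e v, by omega⟩ : Fin (N + 1))]
        · have hle : Finsupp.single v (e v) ≤ e := by
            intro i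
            by_cases hi : i = v
            · subst hi; simp
            · simp [Finsupp.single_apply, Ne.symm hi]
          show coeff e P = coeff e (slice v (e v) P * monomial (Finsupp.single v (e v)) 1)
          rw [coeff_mul_monomial', if_pos hle, coeff_slice, if_pos (by simp),
            tsub_add_cancel_of_le hle, mul_one]
        · intro l _ hl
          rw [coeff_mul_monomial']
          split_ifs with hle
          · rw [coeff_slice, if_neg, zero_mul]
            simp
            have h2 : (l : ℕ) ≠ e v := fun h => hl (Fin.ext h)
            have h3 := hle v
            simp at h3
            omega
          · rfl
        · simp
      · rw [not_not.mp (mt (hN e) he)]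
        symm
        apply Finset.sum_eq_zero
        intro l _
        rw [coeff_mul_monomial']
        split_ifs with hle
        · rw [coeff_slice, if_neg, zero_mul]
          simp; omega
        · rfl
    conv_lhs => rw [h1]
    simp only [← hc, Finset.sum_mul, hψ, Finset.mul_sum]
    rw [Finset.sum_comm]
    apply Finset.sum_congr rfl
    intro j _
    apply Finset.sum_congr rfl
    intro l _
    rw [smul_mul_assoc, ← mul_smul_comm, smul_monomial, smul_eq_mul, mul_one]
  refine ⟨κ, inferInstance, φ, ψ, hli, ?_, ?_, ?_, hsum, ?_, ?_, ?_⟩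
  · rw [Fintype.linearIndependent_iff]
    intro g hg j'
    have := congrArg (coeff (Finsupp.single v (a j' : ℕ))) hg
    rw [coeff_sum, coeff_zero] at this
    simp only [coeff_smul, hcoψ, hcδ] at this
    simpa using this
  · intro j e he
    rw [hφ, Function.comp, coeff_slice] at he
    by_contra h
    rw [if_neg h] at he
    exact he rfl
  · intro j e he h hh
    rw [hψ, coeff_sum] at he
    obtain ⟨l, _, hl⟩ := Finset.exists_ne_zero_of_sum_ne_zero he
    rw [coeff_monomial] at hl
    have : Finsupp.single v (l : ℕ) = e := by
      by_contra hne; rw [if_neg hne] at hl; exact hl rfl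
    rw [← this]; simp [Finsupp.single_apply, Ne.symm hh]
  · have := Fintype.card_le_of_injective a hinj
    simpa using this
  · by_contra h
    have h0 : Fintype.card κ = 0 := by omega
    rw [Fintype.card_eq_zero_iff] at h0
    apply hP
    rw [hsum]; simp
  · intro j e he
    rw [hφ, Function.comp, coeff_slice] at he
    refine ⟨a j, ?_⟩
    by_contra h
    rw [h] at he
    simp at he

lemma count_lemma {ι : Type*} [Fintype ι] (l : ι → ℕ) (hl : Function.Injective l)
    (hlk : ∀ i, l i < Fintype.card ι) (R : ℕ) (hR : 0 < R) (hkR : Fintype.card ι ≤ R + 1)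
    (ε : ℝ) (h0 : 0 < ε) (h1 : ε ≤ 1) :
    (Fintype.card ι : ℝ) * (ε ^ 2 / 8) ≤ ∑ i, max 0 (ε - l i / R) := by
  classical
  set k := Fintype.card ι with hk
  have himg : Finset.univ.image l = Finset.range k := by
    apply Finset.eq_of_subset_of_card_le
    · intro x hx
      obtain ⟨i, _, rfl⟩ := Finset.mem_image.mp hx
      exact Finset.mem_range.mpr (hlk i)
    · rw [Finset.card_image_of_injective _ hl]; simp [hk]
  have hsum : ∑ i, max 0 (ε - l i / R) = ∑ x ∈ Finset.range k, max 0 (ε - (x : ℝ) / R) := by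
    rw [← himg, Finset.sum_image (fun x _ y _ h => hl h)]
  rw [hsum]
  set m := min k (⌊ε * R / 2⌋₊ + 1) with hm
  have hR' : (0 : ℝ) < R := by exact_mod_cast hR
  have hx0 : 0 ≤ ε * R / 2 := by positivity
  have hkR' : (k : ℝ) ≤ 2 * R := by
    have : k ≤ 2 * R := by omega
    exact_mod_cast this
  have hmk : (k : ℝ) * ε / 4 ≤ m := by
    rw [hm, Nat.cast_min]
    apply le_min
    · have : (0 : ℝ) ≤ k := Nat.cast_nonneg _
      nlinarith
    · have := Nat.lt_floor_add_one (ε * R / 2)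
      push_cast
      nlinarith
  calc (k : ℝ) * (ε ^ 2 / 8) = (k * ε / 4) * (ε / 2) := by ring
    _ ≤ m * (ε / 2) := by gcongr
    _ = ∑ x ∈ Finset.range m, ε / 2 := by simp
    _ ≤ ∑ x ∈ Finset.range m, max 0 (ε - (x : ℝ) / R) := by
        apply Finset.sum_le_sum
        intro x hx
        refine le_trans ?_ (le_max_right _ _)
        have hx1 : x < ⌊ε * R / 2⌋₊ + 1 := lt_of_lt_of_le (Finset.mem_range.mp hx) (min_le_right _ _)
        have hx2 : (x : ℝ) ≤ ε * R / 2 := by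
          refine le_trans ?_ (Nat.floor_le hx0)
          exact_mod_cast Nat.lt_succ_iff.mp hx1
        have : (x : ℝ) / R ≤ ε / 2 := by
          rw [div_le_iff₀ hR']; linarith
        linarith
    _ ≤ ∑ x ∈ Finset.range k, max 0 (ε - (x : ℝ) / R) := by
        apply Finset.sum_le_sum_of_subset_of_nonneg
        · intro x hx
          exact Finset.mem_range.mpr (lt_of_lt_of_le (Finset.mem_range.mp hx) (min_le_left _ _))
        · intros; exact le_max_left _ _

lemma L1_D_le {P : MP} (n : ℕ) (r : ℕ → ℕ) (hdeg : ∀ e, coeff e P ≠ 0 → ∀ h < n, e h ≤ r h)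
    (hdeg0 : ∀ e, coeff e P ≠ 0 → ∀ h, n ≤ h → e h = 0) (I : ℕ →₀ ℕ) :
    L1 (D I P) ≤ 2 ^ (∑ h ∈ Finset.range n, r h) * L1 P := by
  classical
  have hb : ∀ e, coeff e P ≠ 0 → bin e I ≤ 2 ^ (∑ h ∈ Finset.range n, r h) := by
    intro e he
    rw [bin_eq e I (s := I.support ∪ Finset.range n) Finset.subset_union_left]
    by_cases hI : ∀ h, n ≤ h → I h = 0
    · rw [← Finset.prod_pow_eq_pow_sum]
      have : ∏ h ∈ Finset.range n, 2 ^ r h = ∏ h ∈ I.support ∪ Finset.range n, if h < n then 2 ^ r h else 1 := by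
        rw [← Finset.prod_subset (Finset.subset_union_right (s₁ := I.support))]
        · apply Finset.prod_congr rfl
          intro h hh; rw [if_pos (Finset.mem_range.mp hh)]
        · intro h _ hh
          rw [if_neg (by simpa using hh)]
      rw [this]
      apply Finset.prod_le_prod'
      intro h _
      split_ifs with hh
      · exact (Nat.choose_le_two_pow _ _).trans (Nat.pow_le_pow_right (by norm_num) (hdeg e he h hh))
      · rw [hI h (not_lt.mp hh)]; simp
    · push Not at hI
      obtain ⟨h, hh, hne⟩ := hI
      rw [Finset.prod_eq_zero (i := h)]
      · simp
      · simp [hne]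
      · apply Nat.choose_eq_zero_of_lt
        rw [hdeg0 e he h hh]; omega
  unfold L1
  calc ∑ e ∈ (D I P).support, |coeff e (D I P)|
      ≤ ∑ e ∈ (D I P).support, 2 ^ (∑ h ∈ Finset.range n, r h) * |coeff (e + I) P| := by
        apply Finset.sum_le_sum
        intro e he
        rw [coeff_D, abs_mul]
        apply mul_le_mul_of_nonneg_right _ (abs_nonneg _)
        rw [abs_of_nonneg (Nat.cast_nonneg _)]
        exact_mod_cast hb _ (coeff_D_ne (mem_support_iff.mp he))
    _ = 2 ^ (∑ h ∈ Finset.range n, r h) * ∑ e ∈ (D I P).support.image (fun e => e + I), |coeff e P| := by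
        rw [Finset.sum_image (fun x _ y _ hxy => add_right_cancel hxy), Finset.mul_sum]
    _ ≤ _ := by
        apply mul_le_mul_of_nonneg_left _ (by positivity)
        apply Finset.sum_le_sum_of_subset_of_nonneg
        · intro e he
          obtain ⟨a, ha, rfl⟩ := Finset.mem_image.mp he
          exact mem_support_iff.mpr (coeff_D_ne (mem_support_iff.mp ha))
        · intros; exact abs_nonneg _

end SecRoth

set_option linter.unusedSimpArgs false
namespace SecRoth
open MvPolynomial

lemma wr_step (n : ℕ) (r : ℕ → ℕ) (P : MP) (hP : P ≠ 0)
    (hdeg : ∀ e, coeff e P ≠ 0 → ∀ h < n + 1, e h ≤ r h)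
    (hdeg0 : ∀ e, coeff e P ≠ 0 → ∀ h, n + 1 ≤ h → e h = 0) :
    ∃ (ι : Type) (_ : Fintype ι) (_ : DecidableEq ι) (I L : ι → ℕ →₀ ℕ) (U V : MP),
      1 ≤ Fintype.card ι ∧ Fintype.card ι ≤ r n + 1 ∧ Free n U ∧ Only n V ∧ U ≠ 0 ∧ V ≠ 0 ∧
      U * V = (Matrix.of fun i l => D (I i + L l) P).det ∧
      (∀ i, I i n = 0) ∧ (∀ i, (I i).degree ≤ Fintype.card ι - 1) ∧
      (∀ i h, h ≠ n → L i h = 0) ∧ (Function.Injective fun i => L i n) ∧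
      (∀ i, L i n < Fintype.card ι) ∧
      (∀ e, coeff e U ≠ 0 → ∀ h < n, e h ≤ Fintype.card ι * r h) ∧
      (∀ e, coeff e U ≠ 0 → ∀ h, n ≤ h → e h = 0) := by
  classical
  obtain ⟨ι, hι, φ, ψ, hφ, hψ, hfree, honly, hsum, hk, hk1, hsupp⟩ :=
    decomp P hP n (r n) (fun e he => hdeg e he n (by omega))
  obtain ⟨I, hI, hU⟩ := exists_wronskian φ hφ
  obtain ⟨L, hL, hV⟩ := exists_wronskian ψ hψ
  have hIn : ∀ i, I i n = 0 := by
    intro i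
    by_contra hne
    apply hU
    apply Matrix.det_eq_zero_of_row_eq_zero i
    intro j
    rw [Matrix.of_apply]
    by_contra h0
    obtain ⟨f, hf⟩ := MvPolynomial.ne_zero_iff.mp h0
    have := hfree j _ (coeff_D_ne hf)
    simp at this; omega
  have hLn : ∀ i h, h ≠ n → L i h = 0 := by
    intro i h hh
    by_contra hne
    apply hV
    apply Matrix.det_eq_zero_of_row_eq_zero i
    intro j
    rw [Matrix.of_apply]
    by_contra h0
    obtain ⟨f, hf⟩ := MvPolynomial.ne_zero_iff.mp h0
    have := honly j _ (coeff_D_ne hf) h hh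
    simp at this; omega
  have hfreeU : Free n (Matrix.of fun i j => D (I i) (φ j)).det :=
    Free.det fun i j => (hfree j).D _
  refine ⟨ι, hι, inferInstance, I, L, _, _, hk1, hk, hfreeU,
    Only.det (M := Matrix.of fun i j => D (L i) (ψ j)) fun i j => (honly j).D _, hU, hV, ?_, hIn, hI, hLn, ?_, ?_, ?_, ?_⟩
  · rw [← Matrix.det_transpose (Matrix.of fun i j => D (L i) (ψ j)), ← Matrix.det_mul]
    congr 1
    ext1 i l
    rw [Matrix.mul_apply, Matrix.of_apply, hsum, D_sum]
    apply Finset.sum_congr rfl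
    intro j _
    rw [Matrix.transpose_apply, Matrix.of_apply, Matrix.of_apply,
      D_sep (hfree j) (honly j) (hIn i) (hLn l)]
  · intro i i' hii
    by_contra hne
    apply hV
    apply Matrix.det_zero_of_row_eq hne
    have : L i = L i' := by
      ext h
      by_cases hh : h = n
      · subst hh; exact hii
      · rw [hLn i h hh, hLn i' h hh]
    funext j
    simp [Matrix.of_apply, this]
  · intro i
    have h1 := hL i
    have h2 : L i n ≤ (L i).degree := Finsupp.le_degree n (L i)
    omega
  · intro e he h hh
    obtain ⟨σ, a, rfl, ha⟩ := coeff_det_ne _ he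
    rw [Finsupp.finsetSum_apply]
    calc ∑ i, a i h ≤ ∑ i : ι, r h := by
          apply Finset.sum_le_sum
          intro i _
          obtain ⟨l, hl⟩ := hsupp _ _ (coeff_D_ne (ha i))
          have := hdeg _ hl h (by omega)
          simp at this; omega
      _ = _ := by simp
  · intro e he h hh
    rcases Nat.eq_or_lt_of_le hh with rfl | hlt
    · exact hfreeU e he
    obtain ⟨σ, a, rfl, ha⟩ := coeff_det_ne _ he
    rw [Finsupp.finsetSum_apply]
    apply Finset.sum_eq_zero
    intro i _
    obtain ⟨l, hl⟩ := hsupp _ _ (coeff_D_ne (ha i))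
    have := hdeg0 _ hl h (by omega)
    simp at this; omega

noncomputable def wt (n : ℕ) (r : ℕ → ℕ) (e : ℕ →₀ ℕ) : ℝ := ∑ v ∈ Finset.range n, (e v : ℝ) / r v

lemma wt_add (n r e f) : wt n r (e + f) = wt n r e + wt n r f := by
  simp [wt, add_div, Finset.sum_add_distrib]

lemma wt_sum {ι : Type*} (s : Finset ι) (n r) (e : ι → ℕ →₀ ℕ) :
    wt n r (∑ i ∈ s, e i) = ∑ i ∈ s, wt n r (e i) := by
  simp only [wt, Finsupp.finsetSum_apply, Nat.cast_sum, Finset.sum_div]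
  rw [Finset.sum_comm]

lemma wt_nonneg (n r e) : 0 ≤ wt n r e := Finset.sum_nonneg fun _ _ => by positivity

lemma wt_succ (n r e) : wt (n + 1) r e = wt n r e + e n / r n := by
  simp [wt, Finset.sum_range_succ]

lemma wt_mul (n : ℕ) (r e) (k : ℕ) : wt n r e = k * wt n (fun v => k * r v) e ∨ k = 0 := by
  by_cases hk : k = 0
  · right; exact hk
  · left
    have : (k : ℝ) ≠ 0 := by exact_mod_cast hk
    simp only [wt, Finset.mul_sum]
    apply Finset.sum_congr rfl
    intro v _
    push_cast
    rw [← mul_div_assoc, mul_div_mul_left _ _ this]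

end SecRoth

set_option linter.unusedSimpArgs false
namespace SecRoth
open MvPolynomial

lemma wt_small (n : ℕ) (r : ℕ → ℕ) (η : ℝ) (hη : 0 ≤ η) (I : ℕ →₀ ℕ) (hIn : I n = 0)
    (hr : ∀ v < n + 1, 0 < r v) (hd : I.degree ≤ r n) (hrr : ∀ i < n, (r n : ℝ) ≤ η * r i) :
    wt (n + 1) r I ≤ η := by
  classical
  have hrn : (0 : ℝ) < r n := by exact_mod_cast hr n (by omega)
  rw [wt_succ, hIn]
  have h1 : wt n r I ≤ ∑ v ∈ Finset.range n, (I v : ℝ) * (η / r n) := by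
    apply Finset.sum_le_sum
    intro v hv
    have hv' := Finset.mem_range.mp hv
    have hrv : (0 : ℝ) < r v := by exact_mod_cast hr v (by omega)
    rw [div_eq_mul_inv]
    apply mul_le_mul_of_nonneg_left _ (by positivity)
    rw [inv_eq_one_div, div_le_div_iff₀ hrv hrn]
    linarith [hrr v hv']
  have h2 : ∑ v ∈ Finset.range n, I v ≤ I.degree := by
    have h6 : I.degree = ∑ v ∈ I.support ∪ Finset.range n, I v := by
      rw [Finsupp.degree_apply]
      apply Finset.sum_subset Finset.subset_union_left
      intro x _ hx
      simpa using hx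
    rw [h6]
    exact Finset.sum_le_sum_of_subset Finset.subset_union_right
  have h3 : (∑ v ∈ Finset.range n, (I v : ℝ)) ≤ r n := by
    exact_mod_cast h2.trans hd
  rw [← Finset.sum_mul] at h1
  have h4 : (∑ v ∈ Finset.range n, (I v : ℝ)) * (η / r n) ≤ r n * (η / r n) := by
    apply mul_le_mul_of_nonneg_right h3; positivity
  have h5 : (r n : ℝ) * (η / r n) = η := by field_simp
  simp
  linarith

lemma lower {ι : Type} [Fintype ι] [DecidableEq ι] (n : ℕ) (r : ℕ → ℕ) (P : MP) (β : ℕ → ℝ) (ε η : ℝ)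
    (hη : 0 ≤ η) (h0 : 0 < ε) (h1 : ε ≤ 1)
    (I L : ι → ℕ →₀ ℕ) (hr : 0 < r n) (hk : Fintype.card ι ≤ r n + 1)
    (hI : ∀ i, wt (n + 1) r (I i) ≤ η) (hL : ∀ i h, h ≠ n → L i h = 0)
    (hLi : Function.Injective fun i => L i n) (hLk : ∀ i, L i n < Fintype.card ι)
    (hall : ∀ e, coeff e (tr β P) ≠ 0 → ε < wt (n + 1) r e) (e : ℕ →₀ ℕ)
    (he : coeff e (tr β (Matrix.of fun i l => D (I i + L l) P).det) ≠ 0) :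
    Fintype.card ι * (ε ^ 2 / 8) - Fintype.card ι * η ≤ wt (n + 1) r e := by
  rw [AlgHom.map_det] at he
  obtain ⟨σ, a, rfl, ha⟩ := coeff_det_ne _ he
  rw [wt_sum]
  have hcount := count_lemma (fun i => L i n) hLi hLk (r n) hr hk ε h0 h1
  have key : ∀ i, max 0 (ε - (L i n : ℝ) / r n) - η ≤ wt (n + 1) r (a i) := by
    intro i
    have h2 := ha i
    simp only [AlgHom.mapMatrix_apply, Matrix.map_apply, Matrix.of_apply] at h2
    rw [coeff_tr_D] at h2
    have h3 := hall _ (right_ne_zero_of_mul h2)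
    rw [wt_add, wt_add] at h3
    have h4 : wt (n + 1) r (L i) = (L i n : ℝ) / r n := by
      rw [wt_succ]
      have : wt n r (L i) = 0 := by
        apply Finset.sum_eq_zero
        intro v hv
        rw [hL i v (by have := Finset.mem_range.mp hv; omega)]; simp
      rw [this, zero_add]
    have h5 := hI (σ i)
    have h6 := wt_nonneg (n + 1) r (a i)
    rw [sub_le_iff_le_add]
    apply max_le
    · linarith
    · linarith
  have h7 := Finset.sum_le_sum (s := Finset.univ) fun i _ => key i
  rw [Finset.sum_sub_distrib] at h7
  simp only [Finset.sum_const, Finset.card_univ, nsmul_eq_mul] at h7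
  linarith

def RothL (n : ℕ) (ε η : ℝ) : Prop :=
  ∀ (r : ℕ → ℕ) (β : ℕ → ℚ) (T : ℝ) (P : MP), (∀ v < n, 0 < r v) →
    (∀ e, coeff e P ≠ 0 → ∀ h < n, e h ≤ r h) →
    (∀ e, coeff e P ≠ 0 → ∀ h, n ≤ h → e h = 0) →
    (∀ i j, i < j → j < n → (r j : ℝ) ≤ η * r i) → (∀ v < n, (r v : ℝ) ≤ η * T) →
    (∀ v < n, T ≤ r v * Real.log (β v).den) → P ≠ 0 → P ∈ ZP → L1 P ≤ Real.exp (η * T) →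
    ∃ e, coeff e (tr (fun v => (β v : ℝ)) P) ≠ 0 ∧ wt n r e ≤ ε

lemma L1_W_le {ι : Type} [Fintype ι] [DecidableEq ι] (n : ℕ) (r : ℕ → ℕ) (P : MP) (x : ℝ)
    (hdeg : ∀ e, coeff e P ≠ 0 → ∀ h < n + 1, e h ≤ r h)
    (hdeg0 : ∀ e, coeff e P ≠ 0 → ∀ h, n + 1 ≤ h → e h = 0)
    (hk : Fintype.card ι ≤ r n + 1) (hr : ∀ v < n + 1, (r v : ℝ) ≤ x) (hL : L1 P ≤ Real.exp x)
    (J : ι → ι → ℕ →₀ ℕ) :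
    L1 (Matrix.of fun i l => D (J i l) P).det ≤ Real.exp (Fintype.card ι * ((n + 3) * x)) := by
  set k := Fintype.card ι with hkdef
  have hM : ∀ i j, L1 ((Matrix.of fun i l => D (J i l) P) i j) ≤ Real.exp ((n + 2) * x) := by
    intro i j
    rw [Matrix.of_apply]
    refine (L1_D_le (n + 1) r hdeg hdeg0 _).trans ?_
    have h2 : (2 : ℝ) ^ (∑ h ∈ Finset.range (n + 1), r h) ≤ Real.exp ((n + 1) * x) := by
      have h3 : (2 : ℝ) ≤ Real.exp 1 := by linarith [Real.add_one_le_exp (1 : ℝ)]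
      calc (2 : ℝ) ^ (∑ h ∈ Finset.range (n + 1), r h) ≤ (Real.exp 1) ^ (∑ h ∈ Finset.range (n + 1), r h) := by
            gcongr
        _ = Real.exp (∑ h ∈ Finset.range (n + 1), (r h : ℝ)) := by
            rw [← Real.exp_nat_mul]; push_cast; rw [mul_one]
        _ ≤ _ := by
            apply Real.exp_le_exp.mpr
            calc ∑ h ∈ Finset.range (n + 1), (r h : ℝ) ≤ ∑ h ∈ Finset.range (n + 1), x :=
                  Finset.sum_le_sum fun v hv => hr v (Finset.mem_range.mp hv)
              _ = _ := by simp
    calc _ ≤ Real.exp ((n + 1) * x) * Real.exp x := by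
          apply mul_le_mul h2 hL (L1_nonneg _) (Real.exp_pos _).le
      _ = _ := by rw [← Real.exp_add]; ring_nf
  refine (L1_det_le _ _ hM).trans ?_
  have hkx : (k : ℝ) ≤ Real.exp x := by
    have h1 : (k : ℝ) ≤ r n + 1 := by exact_mod_cast hk
    have h2 := hr n (by omega)
    linarith [Real.add_one_le_exp x]
  have hfac : ((Nat.factorial k : ℕ) : ℝ) ≤ (Real.exp x) ^ k := by
    calc ((Nat.factorial k : ℕ) : ℝ) ≤ (k : ℝ) ^ k := by exact_mod_cast Nat.factorial_le_pow k
      _ ≤ _ := by gcongr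
  calc _ ≤ (Real.exp x) ^ k * (Real.exp ((n + 2) * x)) ^ k := by gcongr
    _ = _ := by
      rw [← mul_pow, ← Real.exp_add, ← Real.exp_nat_mul]; ring_nf

lemma roth_step (n : ℕ) (ε η' : ℝ) (h0 : 0 < ε) (h1 : ε ≤ 1) (hη' : 0 < η')
    (ih : RothL n (ε ^ 2 / 64) η') : RothL (n + 1) ε (min η' (ε ^ 2 / 64) / (n + 3)) := by
  set η := min η' (ε ^ 2 / 64) / (n + 3) with hηdef
  have hn3 : (0 : ℝ) < n + 3 := by positivity
  have hmin : 0 < min η' (ε ^ 2 / 64) := lt_min hη' (by positivity)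
  have hη : 0 < η := by positivity
  have hη3 : (n + 3) * η = min η' (ε ^ 2 / 64) := by rw [hηdef]; field_simp
  have hηη : η ≤ (n + 3) * η := by
    have : (0 : ℝ) ≤ n := Nat.cast_nonneg n
    nlinarith
  have hηa : (n + 3) * η ≤ η' := hη3 ▸ min_le_left _ _
  have hηb : (n + 3) * η ≤ ε ^ 2 / 64 := hη3 ▸ min_le_right _ _
  intro r β T P hr hdeg hdeg0 hrr hrT hT hP hZ hL1
  by_contra hcon
  push Not at hcon
  obtain ⟨ι, _, _, I, L, U, V, hk1, hk, hUf, hVo, hU0, hV0, hUV, hIn, hId, hLn, hLi, hLk, hUd, hUd0⟩ :=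
    wr_step n r P hP hdeg hdeg0
  set k := Fintype.card ι with hkdef
  have hkpos : (0 : ℝ) < k := by exact_mod_cast hk1
  have hrn : (0 : ℝ) < r n := by exact_mod_cast hr n (by omega)
  have hTpos : 0 < T := by
    have := hrT n (by omega)
    by_contra hc
    nlinarith
  have hWL : L1 (U * V) ≤ Real.exp (k * ((n + 3) * (η * T))) := by
    rw [hUV]
    exact L1_W_le n r P (η * T) hdeg hdeg0 hk hrT hL1 _
  have hWZ : U * V ∈ ZP := by
    rw [hUV]
    exact det_mem_ZP _ fun i j => D_mem_ZP hZ _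
  obtain ⟨b, hb⟩ := MvPolynomial.ne_zero_iff.mp hV0
  obtain ⟨e0, he0⟩ := MvPolynomial.ne_zero_iff.mp hU0
  -- IH on the first factor
  obtain ⟨hUZ, hUL⟩ := slice_bound (Q := C (coeff b V) * U) (W := U * V) b (by
    intro a ha
    rw [coeff_C_mul] at ha ⊢
    have ha' := right_ne_zero_of_mul ha
    rw [coeff_sep' hUf hVo (hUf a ha') (hVo b hb), mul_comm]) hWZ
  obtain ⟨e1, he1, hwt1⟩ := ih (fun v => k * r v) β (k * T) (C (coeff b V) * U)
    (fun v hv => Nat.mul_pos hk1 (hr v (by omega)))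
    (fun e he h hh => by
      rw [coeff_C_mul] at he
      exact hUd e (right_ne_zero_of_mul he) h hh)
    (fun e he h hh => by
      rw [coeff_C_mul] at he
      exact hUd0 e (right_ne_zero_of_mul he) h hh)
    (fun i j hij hj => by
      have h2 := hrr i j hij (by omega)
      have h3 : η * (r i : ℝ) ≤ η' * r i := by
        apply mul_le_mul_of_nonneg_right (by linarith); positivity
      push_cast
      nlinarith)
    (fun v hv => by
      have h2 := hrT v (by omega)
      have h3 : η * T ≤ η' * T := by
        apply mul_le_mul_of_nonneg_right (by linarith); positivity
      push_cast
      nlinarith)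
    (fun v hv => by
      have h2 := hT v (by omega)
      push_cast
      nlinarith)
    (by
      apply mul_ne_zero _ hU0
      simpa using hb)
    hUZ (by
      refine hUL.trans (hWL.trans (Real.exp_le_exp.mpr ?_))
      have : (n + 3) * (η * T) ≤ η' * T := by
        rw [← mul_assoc]; apply mul_le_mul_of_nonneg_right hηa hTpos.le
      nlinarith)
  have he1U : coeff e1 (tr (fun v => (β v : ℝ)) U) ≠ 0 := by
    rw [map_mul, show tr (fun v => (β v : ℝ)) (C (coeff b V)) = C (coeff b V) from
      AlgHom.commutes _ _, coeff_C_mul] at he1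
    exact right_ne_zero_of_mul he1
  -- one variable
  obtain ⟨hVZ, hVL⟩ := slice_bound (Q := C (coeff e0 U) * V) (W := U * V) e0 (by
    intro a ha
    rw [coeff_C_mul] at ha ⊢
    have ha' := right_ne_zero_of_mul ha
    rw [add_comm a e0, coeff_sep' hUf hVo (hUf e0 he0) (hVo a ha')]) hWZ
  obtain ⟨s, hs, hsL⟩ := onevar (v := n) (V := C (coeff e0 U) * V)
    (fun e he h hh => by
      rw [coeff_C_mul] at he
      exact hVo e (right_ne_zero_of_mul he) h hh)
    (by
      apply mul_ne_zero _ hV0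
      simpa using he0) hVZ (β n) (fun v => (β v : ℝ)) rfl
  have hsV : coeff (Finsupp.single n s) (tr (fun v => (β v : ℝ)) V) ≠ 0 := by
    rw [map_mul, show tr (fun v => (β v : ℝ)) (C (coeff e0 U)) = C (coeff e0 U) from
      AlgHom.commutes _ _, coeff_C_mul] at hs
    exact right_ne_zero_of_mul hs
  have hslog : (s : ℝ) * Real.log (β n).den ≤ k * ((n + 3) * (η * T)) := by
    have h2 := hsL.trans (hVL.trans hWL)
    have hd : (0 : ℝ) < (β n).den := by exact_mod_cast (β n).den_pos
    rw [← Real.log_pow]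
    exact (Real.log_le_iff_le_exp (by positivity)).mpr h2
  have hTn := hT n (by omega)
  have hlog : 0 < Real.log (β n).den := by
    by_contra hc
    nlinarith
  have hs2 : (s : ℝ) / r n ≤ k * (ε ^ 2 / 64) := by
    rw [div_le_iff₀ hrn]
    have h2 : (n + 3) * (η * T) ≤ (ε ^ 2 / 64) * (r n * Real.log (β n).den) := by
      rw [← mul_assoc]
      apply mul_le_mul hηb hTn hTpos.le (by positivity)
    have h3 : (s : ℝ) * Real.log (β n).den ≤ (k * (ε ^ 2 / 64) * r n) * Real.log (β n).den := by
      nlinarith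
    exact le_of_mul_le_mul_right h3 hlog
  have he1n : e1 n = 0 := hUf.tr _ e1 he1U
  have hfin := lower n r P (fun v => (β v : ℝ)) ε η hη.le h0 h1 I L (hr n (by omega)) hk
    (fun i => wt_small n r η hη.le (I i) (hIn i) hr (by have := hId i; omega)
      (fun j hj => hrr j n hj (by omega))) hLn hLi hLk hcon (e1 + Finsupp.single n s) (by
      rw [← hUV, map_mul, coeff_sep' (hUf.tr _) (hVo.tr _) he1n
        (fun h hh => by simp [Finsupp.single_apply, Ne.symm hh])]
      exact mul_ne_zero he1U hsV)
  have hw : wt (n + 1) r (e1 + Finsupp.single n s) = wt n r e1 + s / r n := by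
    rw [wt_succ, wt_add]
    have : wt n r (Finsupp.single n s) = 0 := by
      apply Finset.sum_eq_zero
      intro v hv
      have := Finset.mem_range.mp hv
      simp [Finsupp.single_apply, show n ≠ v by omega]
    rw [this]; simp [he1n]
  rw [hw] at hfin
  have hw1 : wt n r e1 ≤ k * (ε ^ 2 / 64) := by
    rcases wt_mul n r e1 k with h | h
    · rw [h]; gcongr
    · omega
  have hε2 : 0 < k * ε ^ 2 := by positivity
  have : k * η ≤ k * (ε ^ 2 / 64) := by
    apply mul_le_mul_of_nonneg_left _ hkpos.le; linarith
  linarith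

theorem roth_lemma (n : ℕ) : ∀ ε : ℝ, 0 < ε → ∃ η : ℝ, 0 < η ∧ RothL n ε η := by
  induction n with
  | zero =>
    intro ε hε
    refine ⟨1, one_pos, ?_⟩
    intro r β T P _ _ _ _ _ _ hP _ _
    obtain ⟨e, he⟩ := MvPolynomial.ne_zero_iff.mp (tr_ne_zero hP fun v => (β v : ℝ))
    exact ⟨e, he, by simp [wt, hε.le]⟩
  | succ n ih =>
    intro ε hε
    have hm : 0 < min ε 1 := lt_min hε one_pos
    obtain ⟨η', hη', h⟩ := ih ((min ε 1) ^ 2 / 64) (by positivity)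
    refine ⟨min η' ((min ε 1) ^ 2 / 64) / (n + 3), ?_, fun r β T P a1 a2 a3 a4 a5 a6 a7 a8 a9 => ?_⟩
    swap
    · obtain ⟨e, he, hw⟩ := roth_step n (min ε 1) η' hm (min_le_right _ _) hη' h r β T P a1 a2 a3 a4 a5 a6 a7 a8 a9
      exact ⟨e, he, hw.trans (min_le_left _ _)⟩
    · have : 0 < min η' ((min ε 1) ^ 2 / 64) := lt_min hη' (by positivity)
      positivity

end SecRoth

set_option linter.unusedSimpArgs false
namespace SecRoth
open MvPolynomial

noncomputable def box (m : ℕ) (r : ℕ → ℕ) : Finset (ℕ →₀ ℕ) :=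
  Finset.finsupp (Finset.range m) (fun h => Finset.range (r h + 1))

lemma mem_box {m : ℕ} {r : ℕ → ℕ} {e : ℕ →₀ ℕ} :
    e ∈ box m r ↔ (∀ h < m, e h ≤ r h) ∧ ∀ h, m ≤ h → e h = 0 := by
  classical
  unfold box
  rw [Finset.mem_finsupp_iff]
  constructor
  · rintro ⟨h1, h2⟩
    refine ⟨fun h hh => ?_, fun h hh => ?_⟩
    · have := h2 h (Finset.mem_range.mpr hh)
      simp at this; omega
    · by_contra hc
      have := h1 (Finsupp.mem_support_iff.mpr hc)
      simp at this; omega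
  · rintro ⟨h1, h2⟩
    refine ⟨fun h hh => ?_, fun h hh => ?_⟩
    · by_contra hc
      exact (Finsupp.mem_support_iff.mp hh) (h2 h (by simpa using hc))
    · have := h1 h (Finset.mem_range.mp hh)
      simp; omega

lemma card_box (m : ℕ) (r : ℕ → ℕ) : (box m r).card = ∏ h ∈ Finset.range m, (r h + 1) := by
  unfold box
  rw [Finset.card_finsupp]; simp

lemma sum_box (m : ℕ) (r : ℕ → ℕ) (f : ℕ → ℕ → ℝ) :
    ∑ e ∈ box m r, ∏ h ∈ Finset.range m, f h (e h) =
      ∏ h ∈ Finset.range m, ∑ j ∈ Finset.range (r h + 1), f h j := by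
  classical
  rw [Finset.prod_sum]
  unfold box Finset.finsupp
  rw [Finset.sum_map]
  refine Finset.sum_congr (by congr!) ?_
  intro p hp
  rw [← Finset.prod_attach (Finset.range m)]
  apply Finset.prod_congr rfl
  intro x _
  simp only [Function.Embedding.coeFn_mk]
  rw [Finsupp.indicator_of_mem x.2]

lemma exp_sum_le (r : ℕ) (hr : 0 < r) (l : ℝ) :
    ∑ j ∈ Finset.range (r + 1), Real.exp (l * (1 / 2 - (j : ℝ) / r)) ≤ (r + 1) * Real.exp (l ^ 2 / 8) := by
  have hr' : (0 : ℝ) < r := by exact_mod_cast hr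
  have h1 : ∑ j ∈ Finset.range (r + 1), Real.exp (l * (1 / 2 - (j : ℝ) / r)) =
      ∑ j ∈ Finset.range (r + 1), Real.exp (-(l * (1 / 2 - (j : ℝ) / r))) := by
    rw [← Finset.sum_range_reflect]
    apply Finset.sum_congr rfl
    intro j hj
    have hj' : j ≤ r := by have := Finset.mem_range.mp hj; omega
    have : r + 1 - 1 - j = r - j := by omega
    rw [this, Nat.cast_sub hj']
    congr 1
    field_simp
    ring
  have h2 : ∀ j ∈ Finset.range (r + 1), Real.exp (l * (1 / 2 - (j : ℝ) / r)) +
      Real.exp (-(l * (1 / 2 - (j : ℝ) / r))) ≤ 2 * Real.exp (l ^ 2 / 8) := by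
    intro j hj
    have hj' : j ≤ r := by have := Finset.mem_range.mp hj; omega
    have hj2 : (j : ℝ) / r ≤ 1 := by
      rw [div_le_one hr']; exact_mod_cast hj'
    have hj0 : 0 ≤ (j : ℝ) / r := by positivity
    have h3 := Real.cosh_le_exp_half_sq (l * (1 / 2 - (j : ℝ) / r))
    have h4 := Real.cosh_eq (l * (1 / 2 - (j : ℝ) / r))
    have h5 : Real.exp ((l * (1 / 2 - (j : ℝ) / r)) ^ 2 / 2) ≤ Real.exp (l ^ 2 / 8) := by
      apply Real.exp_le_exp.mpr
      have : (1 / 2 - (j : ℝ) / r) ^ 2 ≤ 1 / 4 := by nlinarith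
      nlinarith [sq_nonneg l]
    linarith
  have h3 := Finset.sum_le_sum h2
  rw [Finset.sum_add_distrib, ← h1] at h3
  simp only [Finset.sum_const, Finset.card_range, nsmul_eq_mul] at h3
  push_cast at h3
  linarith

lemma count_small (d : ℕ) : ∃ m : ℕ, 0 < m ∧ ∀ r : ℕ → ℕ, (∀ h < m, 0 < r h) →
    2 * (d * ((box m r).filter (fun e => wt m r e < 12 / 25 * m)).card) ≤ (box m r).card := by
  classical
  obtain ⟨m, hm⟩ : ∃ m, m = 4000 * (d + 1) := ⟨_, rfl⟩
  refine ⟨m, by omega, ?_⟩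
  intro r hr
  set S := (box m r).filter (fun e => wt m r e < 12 / 25 * m) with hS
  have h1 : (S.card : ℝ) ≤ ((box m r).card : ℝ) * Real.exp (-(3 / 4000) * m) := by
    calc (S.card : ℝ) = ∑ e ∈ S, (1 : ℝ) := by simp
      _ ≤ ∑ e ∈ S, Real.exp (1 / 10 * (12 / 25 * m - wt m r e)) := by
          apply Finset.sum_le_sum
          intro e he
          have := (Finset.mem_filter.mp he).2
          apply Real.one_le_exp
          linarith
      _ ≤ ∑ e ∈ box m r, Real.exp (1 / 10 * (12 / 25 * m - wt m r e)) := by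
          apply Finset.sum_le_sum_of_subset_of_nonneg (Finset.filter_subset _ _)
          intros; positivity
      _ = Real.exp (-(1 / 500) * m) * ∑ e ∈ box m r, ∏ h ∈ Finset.range m,
            Real.exp (1 / 10 * (1 / 2 - (e h : ℝ) / r h)) := by
          rw [Finset.mul_sum]
          apply Finset.sum_congr rfl
          intro e _
          rw [← Real.exp_sum, ← Real.exp_add, ← Finset.mul_sum, Finset.sum_sub_distrib]
          congr 1
          simp only [Finset.sum_const, Finset.card_range, nsmul_eq_mul, wt]
          ring
      _ = Real.exp (-(1 / 500) * m) * ∏ h ∈ Finset.range m, ∑ j ∈ Finset.range (r h + 1),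
            Real.exp (1 / 10 * (1 / 2 - (j : ℝ) / r h)) := by
          rw [sum_box m r (fun h j => Real.exp (1 / 10 * (1 / 2 - (j : ℝ) / r h)))]
      _ ≤ Real.exp (-(1 / 500) * m) * ∏ h ∈ Finset.range m, ((r h + 1) * Real.exp ((1 / 10) ^ 2 / 8)) := by
          apply mul_le_mul_of_nonneg_left _ (Real.exp_pos _).le
          apply Finset.prod_le_prod
          · intros; positivity
          · intro h hh
            exact exp_sum_le (r h) (hr h (Finset.mem_range.mp hh)) _
      _ = _ := by
          rw [Finset.prod_mul_distrib, card_box, Finset.prod_const, Finset.card_range,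
            ← Real.exp_nat_mul]
          push_cast
          rw [mul_comm, mul_assoc, ← Real.exp_add]
          congr 2
          ring
  have h2 : (2 * d : ℝ) * Real.exp (-(3 / 4000) * m) ≤ 1 := by
    have h3 : (2 * d : ℝ) ≤ Real.exp (3 / 4000 * m) := by
      have := Real.add_one_le_exp (3 / 4000 * (m : ℝ))
      have hd : (0 : ℝ) ≤ d := Nat.cast_nonneg d
      have : (m : ℝ) = 4000 * (d + 1) := by rw [hm]; push_cast; ring
      linarith
    calc (2 * d : ℝ) * Real.exp (-(3 / 4000) * m) ≤ Real.exp (3 / 4000 * m) * Real.exp (-(3 / 4000) * m) := by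
          gcongr
      _ = 1 := by rw [← Real.exp_add]; simp
  have h4 : (2 * (d * S.card) : ℝ) ≤ (box m r).card := by
    calc (2 * (d * S.card) : ℝ) = (2 * d) * S.card := by ring
      _ ≤ (2 * d) * (((box m r).card : ℝ) * Real.exp (-(3 / 4000) * m)) := by gcongr
      _ = ((2 * d : ℝ) * Real.exp (-(3 / 4000) * m)) * (box m r).card := by ring
      _ ≤ 1 * (box m r).card := by gcongr
      _ = _ := one_mul _
  exact_mod_cast h4

end SecRoth

set_option linter.unusedSimpArgs false
namespace SecRoth
open MvPolynomial

lemma pow_repr (α : ℝ) (hα : IsIntegral ℤ α) : ∃ (d A : ℕ), 0 < d ∧ 1 ≤ A ∧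
    ∀ n : ℕ, ∃ a : Fin d → ℤ, α ^ n = ∑ s, (a s : ℝ) * α ^ (s : ℕ) ∧ ∀ s, |a s| ≤ (A : ℤ) ^ n := by
  classical
  obtain ⟨p, hp, hroot⟩ := hα
  rw [← Polynomial.aeval_def] at hroot
  set d := p.natDegree with hd
  have hd0 : 0 < d := by
    rw [Nat.pos_iff_ne_zero]
    intro h0
    have := Polynomial.eq_one_of_monic_natDegree_zero hp h0
    rw [this] at hroot
    simp at hroot
  have hrep : ∀ n : ℕ, ∃ a : Fin d → ℤ, α ^ n = ∑ s, (a s : ℝ) * α ^ (s : ℕ) := by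
    intro n
    have h1 : (Polynomial.aeval α) (Polynomial.X ^ n %ₘ p) = α ^ n := by
      rw [Polynomial.aeval_modByMonic_eq_self_of_root hroot]; simp
    refine ⟨fun s => (Polynomial.X ^ n %ₘ p).coeff s, ?_⟩
    rw [← h1, Polynomial.aeval_eq_sum_range' (n := d), ← Fin.sum_univ_eq_sum_range (fun i => (Polynomial.X ^ n %ₘ p).coeff i • α ^ i)]
    · simp
    · exact Polynomial.natDegree_modByMonic_lt _ hp (by rintro rfl; simp at hd; omega)
  choose c hc using fun s : Fin d => hrep (s + 1)
  set A : ℕ := 1 + ∑ s, ∑ t, (c s t).natAbs with hA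
  refine ⟨d, A, hd0, by omega, ?_⟩
  intro n
  induction n with
  | zero =>
    refine ⟨fun s => if s = ⟨0, hd0⟩ then 1 else 0, ?_, ?_⟩
    · simp
    · intro s; dsimp only; split_ifs <;> simp
  | succ n ih =>
    obtain ⟨a, ha, hb⟩ := ih
    refine ⟨fun t => ∑ s, a s * c s t, ?_, ?_⟩
    · rw [pow_succ, ha, Finset.sum_mul]
      have : ∀ s : Fin d, (a s : ℝ) * α ^ (s : ℕ) * α = ∑ t, (a s : ℝ) * (c s t * α ^ (t : ℕ)) := by
        intro s
        rw [mul_assoc, ← pow_succ, hc s, Finset.mul_sum]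
      rw [Finset.sum_congr rfl fun s _ => this s, Finset.sum_comm]
      apply Finset.sum_congr rfl
      intro t _
      push_cast
      rw [Finset.sum_mul]
      apply Finset.sum_congr rfl
      intro s _; ring
    · intro t
      calc |∑ s, a s * c s t| ≤ ∑ s, |a s * c s t| := Finset.abs_sum_le_sum_abs _ _
        _ ≤ ∑ s, (A : ℤ) ^ n * |c s t| := by
            apply Finset.sum_le_sum
            intro s _
            rw [abs_mul]
            exact mul_le_mul_of_nonneg_right (hb s) (abs_nonneg _)
        _ = (A : ℤ) ^ n * ∑ s, |c s t| := by rw [Finset.mul_sum]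
        _ ≤ (A : ℤ) ^ n * A := by
            apply mul_le_mul_of_nonneg_left _ (by positivity)
            rw [hA]
            push_cast
            have : ∑ s, |c s t| ≤ ∑ s, ∑ t, |c s t| := by
              apply Finset.sum_le_sum
              intro s _
              exact Finset.single_le_sum (f := fun t => |c s t|) (fun _ _ => abs_nonneg _) (Finset.mem_univ t)
            linarith
        _ = _ := (pow_succ _ _).symm

lemma bin_zero {e I : ℕ →₀ ℕ} (h : ¬ I ≤ e) : bin e I = 0 := by
  classical
  rw [Finsupp.le_def] at h
  push Not at h
  obtain ⟨i, hi⟩ := h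
  rw [bin_eq e I (s := I.support) subset_rfl]
  apply Finset.prod_eq_zero (i := i)
  · rw [Finsupp.mem_support_iff]; omega
  · exact Nat.choose_eq_zero_of_lt hi

lemma D_monomial (I e : ℕ →₀ ℕ) (c : ℝ) : D I (monomial e c) = monomial (e - I) (bin e I * c) := by
  classical
  ext f
  rw [coeff_D, coeff_monomial, coeff_monomial]
  by_cases h : I ≤ e
  · by_cases h2 : e = f + I
    · rw [if_pos h2, if_pos (by rw [h2]; simp), h2]
    · rw [if_neg h2, if_neg, mul_zero]
      rintro rfl
      exact h2 (tsub_add_cancel_of_le h).symm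
  · rw [bin_zero h, if_neg]
    · simp
    · rintro rfl; exact h (le_add_self)

lemma bin_le {m : ℕ} {r : ℕ → ℕ} {e : ℕ →₀ ℕ} (he : e ∈ box m r) (I : ℕ →₀ ℕ) :
    (bin e I : ℝ) ≤ 2 ^ (∑ h ∈ Finset.range m, r h) := by
  classical
  have h0 : ∀ f, coeff f (monomial e (1 : ℝ)) ≠ 0 → f = e := by
    intro f hf
    rw [coeff_monomial] at hf
    by_contra hc
    rw [if_neg (Ne.symm hc)] at hf
    exact hf rfl
  have h1 := L1_D_le (P := monomial e (1 : ℝ)) m r (fun f hf => by rw [h0 f hf]; exact (mem_box.mp he).1)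
    (fun f hf => by rw [h0 f hf]; exact (mem_box.mp he).2) I
  have h2 := coeff_le_L1 (D I (monomial e (1 : ℝ))) (e - I)
  rw [D_monomial, coeff_monomial, if_pos rfl] at h2
  rw [D_monomial] at h1
  rw [L1_monomial e (1 : ℝ)] at h1
  simp at h1 h2
  linarith

lemma degree_le {m : ℕ} {r : ℕ → ℕ} {e : ℕ →₀ ℕ} (he : e ∈ box m r) (I : ℕ →₀ ℕ) :
    (e - I).degree ≤ ∑ h ∈ Finset.range m, r h := by
  rw [mem_box] at he
  rw [Finsupp.degree_apply]
  have : (e - I).support ⊆ Finset.range m := by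
    intro h hh
    by_contra hc
    rw [Finsupp.mem_support_iff] at hh
    apply hh
    have := he.2 h (by simpa using hc)
    simp [this]
  refine (Finset.sum_le_sum_of_subset this).trans ?_
  apply Finset.sum_le_sum
  intro h hh
  have := he.1 h (Finset.mem_range.mp hh)
  simp; omega

lemma eval_D_monomial (α : ℝ) (I e : ℕ →₀ ℕ) (c : ℝ) :
    eval (fun _ => α) (D I (monomial e c)) = bin e I * c * α ^ (e - I).degree := by
  rw [D_monomial, eval_monomial, Finsupp.degree_apply, Finsupp.prod, Finset.prod_pow_eq_pow_sum]

end SecRoth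

set_option linter.unusedSimpArgs false
namespace SecRoth
open MvPolynomial

lemma siegel (α : ℝ) (d A : ℕ) (hd : 0 < d) (hA : 1 ≤ A)
    (hpow : ∀ n : ℕ, ∃ a : Fin d → ℤ, α ^ n = ∑ s, (a s : ℝ) * α ^ (s : ℕ) ∧ ∀ s, |a s| ≤ (A : ℤ) ^ n)
    (m : ℕ) (hm : 0 < m) (r : ℕ → ℕ)
    (hcount : 2 * (d * ((box m r).filter (fun e => wt m r e < 12 / 25 * m)).card) ≤ (box m r).card) :
    ∃ P : MP, P ∈ ZP ∧ P ≠ 0 ∧ (∀ e, coeff e P ≠ 0 → e ∈ box m r) ∧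
      L1 P ≤ (8 * A : ℝ) ^ (∑ h ∈ Finset.range m, r h) ∧
      ∀ f, wt m r f < 12 / 25 * m → coeff f (tr (fun _ => α) P) = 0 := by
  classical
  choose a ha hab using hpow
  set S := (box m r).filter (fun e => wt m r e < 12 / 25 * m) with hS
  set R := ∑ h ∈ Finset.range m, r h with hR
  set M : Matrix (S × Fin d) (box m r) ℤ :=
    Matrix.of fun x e => (bin e.1 x.1.1 : ℤ) * a (e.1 - x.1.1).degree x.2 with hM
  have h0S : (0 : ℕ →₀ ℕ) ∈ S := by
    rw [hS, Finset.mem_filter, mem_box]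
    refine ⟨⟨by simp, by simp⟩, ?_⟩
    simp [wt]; positivity
  have hScard : 0 < S.card := Finset.card_pos.mpr ⟨0, h0S⟩
  have hrows : Fintype.card (S × Fin d) = d * S.card := by simp [mul_comm]
  have hcols : Fintype.card (box m r) = (box m r).card := by simp
  have hpos : 0 < d * S.card := Nat.mul_pos hd hScard
  obtain ⟨t, ht0, hMt, htn⟩ := Int.Matrix.exists_ne_zero_int_vec_norm_le M
    (by rw [hrows, hcols]; omega) (by rw [hrows]; exact hpos)
  have hA' : (1 : ℝ) ≤ A := by exact_mod_cast hA
  have hboxcard : ((box m r).card : ℝ) ≤ 2 ^ R := by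
    rw [card_box, hR, ← Finset.prod_pow_eq_pow_sum]
    push_cast
    apply Finset.prod_le_prod
    · intros; positivity
    · intro h _
      have : r h + 1 ≤ 2 ^ r h := Nat.lt_two_pow_self
      exact_mod_cast this
  have hMnorm : @norm _ (Matrix.seminormedAddCommGroup (m := S × Fin d) (n := box m r) (α := ℤ)).toNorm M ≤ (2 * A : ℝ) ^ R := by
    rw [Matrix.norm_le_iff (by positivity)]
    intro x e
    rw [hM, Matrix.of_apply, norm_mul, mul_pow]
    apply mul_le_mul _ _ (norm_nonneg _) (by positivity)
    · have := bin_le e.2 x.1.1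
      simpa [Int.norm_eq_abs] using this
    · rw [Int.norm_eq_abs]
      have h1 := hab (e.1 - x.1.1).degree x.2
      have h2 : (A : ℝ) ^ (e.1 - x.1.1).degree ≤ (A : ℝ) ^ R :=
        pow_le_pow_right₀ hA' (degree_le e.2 _)
      refine le_trans ?_ h2
      exact_mod_cast h1
  have htn' : ‖t‖ ≤ (4 * A : ℝ) ^ R := by
    refine htn.trans ?_
    set x : ℝ := (Fintype.card (box m r) : ℝ) * max 1 (@norm _ (Matrix.seminormedAddCommGroup (m := S × Fin d) (n := box m r) (α := ℤ)).toNorm M) with hx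
    have hx1 : 1 ≤ x := by
      rw [hx]
      have : (1 : ℝ) ≤ Fintype.card (box m r) := by
        rw [hcols]; exact_mod_cast (by omega : 1 ≤ (box m r).card)
      have h2 := le_max_left (1 : ℝ) (@norm _ (Matrix.seminormedAddCommGroup (m := S × Fin d) (n := box m r) (α := ℤ)).toNorm M)
      nlinarith
    have hx2 : x ≤ (4 * A : ℝ) ^ R := by
      have h4 : (4 * A : ℝ) ^ R = 2 ^ R * (2 * A) ^ R := by rw [← mul_pow]; ring_nf
      rw [h4, hx, hcols]
      apply mul_le_mul hboxcard _ (by positivity) (by positivity)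
      apply max_le _ hMnorm
      apply one_le_pow₀; linarith
    have hexp : (Fintype.card (S × Fin d) : ℝ) / (Fintype.card (box m r) - Fintype.card (S × Fin d)) ≤ 1 := by
      have h5 : (2 * (d * S.card : ℕ) : ℝ) ≤ (box m r).card := by exact_mod_cast hcount
      have h6 : (0 : ℝ) < (d * S.card : ℕ) := by exact_mod_cast hpos
      rw [hrows, hcols, div_le_one (by linarith)]
      linarith
    calc x ^ ((Fintype.card (S × Fin d) : ℝ) / (Fintype.card (box m r) - Fintype.card (S × Fin d)))
        ≤ x ^ (1 : ℝ) := Real.rpow_le_rpow_of_exponent_le hx1 hexp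
      _ = x := Real.rpow_one x
      _ ≤ _ := hx2
  set P : MP := ∑ e : box m r, monomial e.1 (t e : ℝ) with hP
  have hcoeff : ∀ e : box m r, coeff e.1 P = t e := by
    intro e
    rw [hP, coeff_sum, Finset.sum_eq_single e]
    · simp
    · intro b _ hb
      rw [coeff_monomial, if_neg (fun h => hb (Subtype.ext h))]
    · simp
  have hcoeff0 : ∀ e, coeff e P ≠ 0 → e ∈ box m r := by
    intro e he
    rw [hP, coeff_sum] at he
    obtain ⟨b, _, hb⟩ := Finset.exists_ne_zero_of_sum_ne_zero he
    rw [coeff_monomial] at hb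
    by_contra hc
    rw [if_neg (fun h : b.1 = e => hc (h ▸ b.2))] at hb
    exact hb rfl
  refine ⟨P, ?_, ?_, hcoeff0, ?_, ?_⟩
  · rw [mem_ZP_iff]
    intro e
    by_cases he : e ∈ box m r
    · exact ⟨t ⟨e, he⟩, hcoeff ⟨e, he⟩⟩
    · exact ⟨0, by rw [not_not.mp (mt (hcoeff0 e) he)]; simp⟩
  · intro h
    apply ht0
    funext e
    have := hcoeff e
    rw [h, coeff_zero] at this
    exact_mod_cast this.symm
  · rw [hP]
    refine (L1_sum_le _ _).trans ?_
    calc ∑ e : box m r, L1 (monomial e.1 (t e : ℝ)) ≤ ∑ e : box m r, (4 * A : ℝ) ^ R := by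
          apply Finset.sum_le_sum
          intro e _
          rw [L1_monomial]
          refine le_trans ?_ htn'
          have := norm_le_pi_norm t e
          simpa [Int.norm_eq_abs] using this
      _ = (box m r).card * (4 * A : ℝ) ^ R := by simp
      _ ≤ 2 ^ R * (4 * A : ℝ) ^ R := by gcongr
      _ = _ := by rw [← mul_pow]; ring_nf
  · intro f hf
    by_cases hfb : f ∈ box m r
    · have hfS : f ∈ S := Finset.mem_filter.mpr ⟨hfb, hf⟩
      rw [coeff_tr, hP, D_sum, map_sum]
      have h1 : ∀ e : box m r, eval (fun _ => α) (D f (monomial e.1 (t e : ℝ))) =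
          ∑ s : Fin d, ((M (⟨f, hfS⟩, s) e * t e : ℤ) : ℝ) * α ^ (s : ℕ) := by
        intro e
        rw [eval_D_monomial, ha, Finset.mul_sum]
        apply Finset.sum_congr rfl
        intro s _
        rw [hM, Matrix.of_apply]
        push_cast
        ring
      rw [Finset.sum_congr rfl fun e _ => h1 e, Finset.sum_comm]
      apply Finset.sum_eq_zero
      intro s _
      rw [← Finset.sum_mul]
      have h2 := congrFun hMt (⟨f, hfS⟩, s)
      rw [Matrix.mulVec, dotProduct] at h2
      have h3 : (∑ e : box m r, ((M (⟨f, hfS⟩, s) e * t e : ℤ) : ℝ)) = 0 := by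
        exact_mod_cast h2
      rw [h3, zero_mul]
    · by_contra hc
      obtain ⟨g, hg⟩ := coeff_tr_ne hc
      apply hfb
      have := mem_box.mp (hcoeff0 _ hg)
      rw [mem_box]
      refine ⟨fun h hh => ?_, fun h hh => ?_⟩
      · have := this.1 h hh; simp at this; omega
      · have := this.2 h hh; simp at this; omega

end SecRoth

set_option linter.unusedSimpArgs false
namespace SecRoth
open MvPolynomial

lemma L1_pow_le (P : MP) (n : ℕ) : L1 (P ^ n) ≤ L1 P ^ n := by
  have := L1_prod_le (Finset.range n) (fun _ => P)
  simpa using this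

lemma prod_box_eq {m : ℕ} {r : ℕ → ℕ} {e : ℕ →₀ ℕ} (he : e ∈ box m r) {M : Type*} [CommMonoid M]
    (f : ℕ → M) : (e.prod fun h k => f h ^ k) = ∏ h ∈ Finset.range m, f h ^ e h := by
  apply Finsupp.prod_of_support_subset
  · intro h hh
    by_contra hc
    exact (Finsupp.mem_support_iff.mp hh) ((mem_box.mp he).2 h (by simpa using hc))
  · intros; simp

lemma L1_tr_le {m : ℕ} {r : ℕ → ℕ} {P : MP} (hP : ∀ e, coeff e P ≠ 0 → e ∈ box m r) (α : ℝ) :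
    L1 (tr (fun _ => α) P) ≤ (1 + |α|) ^ (∑ h ∈ Finset.range m, r h) * L1 P := by
  classical
  have h1 : tr (fun _ => α) P = ∑ e ∈ P.support, tr (fun _ => α) (monomial e (coeff e P)) := by
    conv_lhs => rw [P.as_sum, map_sum]
  have hlin : ∀ h, L1 ((X h : MP) + C α) ≤ 1 + |α| := by
    intro h
    refine (L1_add_le _ _).trans ?_
    have a1 : L1 (X h : MP) ≤ 1 := by
      have := L1_monomial (Finsupp.single h 1) (1 : ℝ)
      rw [X]
      simpa using this.le
    have a2 : L1 (C α : MP) ≤ |α| := by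
      have := L1_monomial (0 : ℕ →₀ ℕ) α
      exact this.le
    linarith
  rw [h1]
  refine (L1_sum_le _ _).trans ?_
  unfold L1
  rw [Finset.mul_sum]
  apply Finset.sum_le_sum
  intro e he
  have heb := hP e (mem_support_iff.mp he)
  show L1 _ ≤ _
  have h2 : tr (fun _ => α) (monomial e (coeff e P)) =
      C (coeff e P) * ∏ h ∈ Finset.range m, ((X h : MP) + C α) ^ e h := by
    rw [tr, aeval_monomial, prod_box_eq heb]; rfl
  rw [h2, mul_comm]
  rw [mul_comm]
  refine (L1_C_mul _ _).trans ?_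
  rw [mul_comm]
  apply mul_le_mul_of_nonneg_right _ (abs_nonneg _)
  refine (L1_prod_le _ _).trans ?_
  rw [← Finset.prod_pow_eq_pow_sum]
  apply Finset.prod_le_prod
  · intros; exact L1_nonneg _
  · intro h hh
    have ha : 0 ≤ |α| := abs_nonneg α
    calc _ ≤ L1 ((X h : MP) + C α) ^ e h := L1_pow_le _ _
      _ ≤ (1 + |α|) ^ e h := pow_le_pow_left₀ (L1_nonneg _) (hlin h) _
      _ ≤ _ := pow_le_pow_right₀ (by linarith) ((mem_box.mp heb).1 h (Finset.mem_range.mp hh))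

lemma eval_tr (γ α : ℕ → ℝ) (Q : MP) : eval γ (tr α Q) = eval (fun h => γ h + α h) Q := by
  have : ((eval γ).comp (tr α).toRingHom) = eval (fun h => γ h + α h) := by
    apply MvPolynomial.ringHom_ext
    · intro r; simp [tr, MvPolynomial.algebraMap_eq]
    · intro i; simp [tr, MvPolynomial.algebraMap_eq]
  exact DFunLike.congr_fun this Q

lemma eval_lower {m : ℕ} {r : ℕ → ℕ} {Q : MP} (hQ : ∀ e, coeff e Q ≠ 0 → e ∈ box m r) (hZ : Q ∈ ZP)
    (β : ℕ → ℚ) (hne : eval (fun v => (β v : ℝ)) Q ≠ 0) :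
    1 ≤ |eval (fun v => (β v : ℝ)) Q| * ∏ v ∈ Finset.range m, ((β v).den : ℝ) ^ r v := by
  classical
  set q : ℝ := ∏ v ∈ Finset.range m, ((β v).den : ℝ) ^ r v with hq
  have hqpos : 0 < q := by
    apply Finset.prod_pos
    intro v _
    have : (0 : ℝ) < (β v).den := by exact_mod_cast (β v).den_pos
    positivity
  have hIntegral : ∃ z : ℤ, eval (fun v => (β v : ℝ)) Q * q = z := by
    rw [mem_ZP_iff] at hZ
    choose z hz using hZ
    refine ⟨∑ e ∈ Q.support, z e * ∏ v ∈ Finset.range m, ((β v).num ^ e v * ((β v).den : ℤ) ^ (r v - e v)), ?_⟩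
    rw [eval_eq, Finset.sum_mul]
    push_cast
    apply Finset.sum_congr rfl
    intro e he
    have heb := hQ e (mem_support_iff.mp he)
    have h1 : ∏ i ∈ e.support, (β i : ℝ) ^ e i = ∏ h ∈ Finset.range m, (β h : ℝ) ^ e h :=
      prod_box_eq heb (fun h => (β h : ℝ))
    rw [h1, hz, mul_assoc, hq, ← Finset.prod_mul_distrib]
    congr 1
    apply Finset.prod_congr rfl
    intro v hv
    have hle := (mem_box.mp heb).1 v (Finset.mem_range.mp hv)
    have hd : ((β v).den : ℝ) ≠ 0 := by exact_mod_cast (β v).den_pos.ne'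
    have h2 : (β v : ℝ) = (β v).num / (β v).den := Rat.cast_def _
    have h3 : ((β v).den : ℝ) ^ r v = ((β v).den : ℝ) ^ e v * ((β v).den : ℝ) ^ (r v - e v) := by
      rw [← pow_add]; congr 1; omega
    rw [h3, h2, div_pow]
    field_simp
  obtain ⟨z, hz⟩ := hIntegral
  have hz0 : z ≠ 0 := by
    rintro rfl
    rw [Int.cast_zero] at hz
    exact (mul_ne_zero hne hqpos.ne') hz
  have : (1 : ℝ) ≤ |(z : ℝ)| := by exact_mod_cast Int.one_le_abs hz0
  rw [← hz, abs_mul, abs_of_pos hqpos] at this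
  exact this

lemma eval_upper (γ : ℕ → ℝ) (W : MP) (B : ℝ) (hB : 0 ≤ B)
    (h : ∀ f, coeff f W ≠ 0 → |∏ i ∈ f.support, γ i ^ f i| ≤ B) : |eval γ W| ≤ L1 W * B := by
  rw [eval_eq]
  refine (Finset.abs_sum_le_sum_abs _ _).trans ?_
  unfold L1
  rw [Finset.sum_mul]
  apply Finset.sum_le_sum
  intro f hf
  rw [abs_mul]
  exact mul_le_mul_of_nonneg_left (h f (mem_support_iff.mp hf)) (abs_nonneg _)

end SecRoth

set_option linter.unusedSimpArgs false
namespace SecRoth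
open MvPolynomial

def bad (α : ℝ) : Set ℚ := {β | |(β : ℝ) - α| ≤ Real.exp (-(9 / 4) * Real.log β.den)}

lemma bad_unbounded (α : ℝ) (h : (bad α).Infinite) (K : ℝ) : ∃ β ∈ bad α, K ≤ Real.log (β.den : ℝ) := by
  by_contra! hc
  apply h
  obtain ⟨N, hN⟩ := exists_nat_gt (Real.exp K)
  obtain ⟨Z, hZ⟩ := exists_nat_gt ((|α| + 1) * N)
  have hsub : bad α ⊆ (fun β : ℚ => (β.num, β.den)) ⁻¹' ((Finset.Icc (-(Z : ℤ)) Z ×ˢ Finset.range (N + 1) : Finset (ℤ × ℕ)) : Set (ℤ × ℕ)) := by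
    intro β hβ
    have hd : (0 : ℝ) < β.den := by exact_mod_cast β.den_pos
    have h1 : (β.den : ℝ) < Real.exp K := by
      have := hc β hβ
      rwa [Real.log_lt_iff_lt_exp hd] at this
    have h2 : (β.den : ℝ) ≤ N := (h1.trans hN).le
    have hlog : 0 ≤ Real.log (β.den : ℝ) := Real.log_natCast_nonneg _
    have h3 : |(β : ℝ) - α| ≤ 1 := by
      refine (show |(β : ℝ) - α| ≤ _ from hβ).trans ?_
      rw [← Real.exp_zero]
      apply Real.exp_le_exp.mpr
      nlinarith
    have h4 : |(β : ℝ)| ≤ |α| + 1 := by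
      have := abs_sub_abs_le_abs_sub (β : ℝ) α
      linarith
    have h5 : |(β.num : ℝ)| ≤ Z := by
      have h6 : (β.num : ℝ) = β * β.den := by
        rw [Rat.cast_def]; field_simp
      rw [h6, abs_mul, abs_of_pos hd]
      refine le_trans ?_ hZ.le
      apply mul_le_mul h4 h2 hd.le (by positivity)
    have h7 : |β.num| ≤ (Z : ℤ) := by exact_mod_cast h5
    rw [abs_le] at h7
    have h8 : β.den ≤ N := by exact_mod_cast h2
    simp only [Set.mem_preimage, Finset.coe_product, Set.mem_prod, Finset.coe_Icc, Set.mem_Icc,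
      Finset.coe_range, Set.mem_Iio]
    exact ⟨h7, by omega⟩
  refine Set.Finite.subset (Set.Finite.preimage ?_ (Finset.finite_toSet _)) hsub
  intro a _ b _ hab
  simp only [Prod.mk.injEq] at hab
  exact Rat.ext hab.1 hab.2

lemma exists_seq (α : ℝ) (h : (bad α).Infinite) (K c : ℝ) (hK : 0 ≤ K) (hc : 1 ≤ c) :
    ∃ β : ℕ → ℚ, (∀ n, β n ∈ bad α) ∧ (∀ n, K ≤ Real.log ((β n).den : ℝ)) ∧
      ∀ i j, i < j → c * Real.log ((β i).den : ℝ) ≤ Real.log ((β j).den : ℝ) := by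
  choose f hf1 hf2 using bad_unbounded α h
  set β : ℕ → ℚ := fun n => Nat.rec (f K) (fun _ b => f (c * Real.log (b.den : ℝ) + K)) n with hβ
  have hs : ∀ n, β (n + 1) = f (c * Real.log ((β n).den : ℝ) + K) := fun n => rfl
  have hpos : ∀ b : ℚ, 0 ≤ Real.log (b.den : ℝ) := fun b => Real.log_natCast_nonneg _
  have hstep : ∀ n, c * Real.log ((β n).den : ℝ) + K ≤ Real.log ((β (n + 1)).den : ℝ) := by
    intro n; rw [hs]; exact hf2 _
  refine ⟨β, ?_, ?_, ?_⟩
  · intro n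
    cases n with
    | zero => exact hf1 _
    | succ n => exact hf1 _
  · intro n
    cases n with
    | zero => exact hf2 _
    | succ n =>
      have := hstep n
      have := hpos (β n)
      nlinarith
  · intro i j hij
    induction j with
    | zero => omega
    | succ j ih =>
      have h1 := hstep j
      have h2 := hpos (β j)
      rcases Nat.lt_succ_iff_lt_or_eq.mp hij with h | h
      · have := ih h
        nlinarith
      · subst h; linarith

theorem roth_finite (α : ℝ) (hα : IsIntegral ℤ α) : (bad α).Finite := by
  by_contra hinf
  have hinf : (bad α).Infinite := hinf
  obtain ⟨d, A, hd, hA, hpow⟩ := pow_repr α hα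
  obtain ⟨m, hm, hcount⟩ := count_small d
  have hm' : (0 : ℝ) < m := by exact_mod_cast hm
  obtain ⟨η, hη, hroth⟩ := roth_lemma m (m / 100) (by positivity)
  have hA' : (1 : ℝ) ≤ A := by exact_mod_cast hA
  set CC : ℝ := (1 + |α|) * (2 * (8 * A)) with hCC
  have hα0 : 0 ≤ |α| := abs_nonneg α
  have hC8 : 8 * (A : ℝ) ≤ CC := by rw [hCC]; nlinarith
  have hC1 : 1 < CC := by linarith
  set lC := Real.log CC with hlC
  have hlC0 : 0 < lC := Real.log_pos hC1
  obtain ⟨η1, hη1, hη1a, hη1b, hη1c⟩ : ∃ η1 : ℝ, 0 < η1 ∧ η1 ≤ η ∧ m * η1 * lC ≤ η ∧ η1 * lC ≤ 1 / 100 := by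
    refine ⟨min η (min (η / (m * lC)) (1 / (100 * lC))), ?_, min_le_left _ _, ?_, ?_⟩
    · apply lt_min hη (lt_min _ _) <;> positivity
    · have h1 : min η (min (η / (m * lC)) (1 / (100 * lC))) ≤ η / (m * lC) :=
        (min_le_right _ _).trans (min_le_left _ _)
      rw [le_div_iff₀ (by positivity)] at h1
      linarith
    · have h1 : min η (min (η / (m * lC)) (1 / (100 * lC))) ≤ 1 / (100 * lC) :=
        (min_le_right _ _).trans (min_le_right _ _)
      rw [le_div_iff₀ (by positivity)] at h1
      linarith
  obtain ⟨β, hbad, hK, hgap⟩ := exists_seq α hinf (2 / η1) (max 1 (2 / η)) (by positivity) (le_max_left _ _)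
  set l : ℕ → ℝ := fun v => Real.log ((β v).den : ℝ) with hl
  have hK' : ∀ v, 2 / η1 ≤ l v := hK
  have hlpos : ∀ v, 0 < l v := fun v => lt_of_lt_of_le (by positivity) (hK' v)
  set T : ℝ := 100 * ∑ v ∈ Finset.range m, l v with hT
  have hTl : ∀ v < m, 100 * l v ≤ T := by
    intro v hv
    rw [hT]
    apply mul_le_mul_of_nonneg_left _ (by norm_num)
    exact Finset.single_le_sum (f := l) (fun i _ => (hlpos i).le) (Finset.mem_range.mpr hv)
  have hTpos : 0 < T := by have := hTl 0 hm; have := hlpos 0; linarith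
  set r : ℕ → ℕ := fun v => ⌈T / l v⌉₊ with hr
  have hr1 : ∀ v, T ≤ r v * l v := by
    intro v
    have := Nat.le_ceil (T / l v)
    rwa [div_le_iff₀ (hlpos v)] at this
  have hr2 : ∀ v < m, r v * l v ≤ 101 / 100 * T := by
    intro v hv
    have h1 := (Nat.ceil_lt_add_one (a := T / l v) (by have := hlpos v; positivity)).le
    have h2 : (r v : ℝ) * l v ≤ (T / l v + 1) * l v := mul_le_mul_of_nonneg_right h1 (hlpos v).le
    have h3 : (T / l v + 1) * l v = T + l v := by have := (hlpos v).ne'; field_simp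
    have := hTl v hv
    linarith
  have hrpos : ∀ v, 0 < r v := by
    intro v
    rw [hr]; apply Nat.ceil_pos.mpr
    have := hlpos v; positivity
  have hrη1 : ∀ v < m, (r v : ℝ) ≤ η1 * T := by
    intro v hv
    have h1 := hr2 v hv
    have h2 := hK' v
    rw [div_le_iff₀ hη1] at h2
    have h3 : (0 : ℝ) < r v := by exact_mod_cast hrpos v
    have h4 : (r v : ℝ) * 2 ≤ r v * (l v * η1) := by gcongr
    have h5 : (r v * l v) * η1 ≤ (101 / 100 * T) * η1 := by gcongr
    have h6 : 0 < η1 * T := by positivity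
    nlinarith
  have hrr : ∀ i j, i < j → j < m → (r j : ℝ) ≤ η * r i := by
    intro i j hij hj
    have h1 := hr2 j hj
    have h2 := hr1 i
    have h3 : 2 / η * l i ≤ l j := by
      refine le_trans ?_ (hgap i j hij)
      apply mul_le_mul_of_nonneg_right (le_max_right _ _) (hlpos i).le
    have h4 : (0 : ℝ) < r j := by exact_mod_cast hrpos j
    have h5 : 2 * l i ≤ η * l j := by
      rw [div_mul_eq_mul_div, div_le_iff₀ hη] at h3; linarith
    have h6 : (r j : ℝ) * (2 * l i) ≤ r j * (η * l j) := by gcongr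
    have h7 : η * (r j * l j) ≤ η * (101 / 100 * T) := by gcongr
    have h8 : η * T ≤ η * (r i * l i) := by gcongr
    have h9 : 0 < η * T := by positivity
    have h10 : (r j : ℝ) * l i ≤ (η * r i) * l i := by nlinarith
    exact le_of_mul_le_mul_right h10 (hlpos i)
  obtain ⟨P, hPZ, hP0, hPbox, hPL, hPvan⟩ := siegel α d A hd hA hpow m hm r (hcount r fun h _ => hrpos h)
  set R := ∑ h ∈ Finset.range m, r h with hR
  have hRle : (R : ℝ) ≤ m * (η1 * T) := by
    rw [hR]; push_cast
    calc ∑ h ∈ Finset.range m, (r h : ℝ) ≤ ∑ h ∈ Finset.range m, η1 * T :=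
          Finset.sum_le_sum fun v hv => hrη1 v (Finset.mem_range.mp hv)
      _ = _ := by simp
  have hCexp : CC ^ R = Real.exp (R * lC) := by
    rw [Real.exp_nat_mul, hlC, Real.exp_log (by linarith)]
  have hPL' : L1 P ≤ Real.exp (η * T) := by
    calc L1 P ≤ (8 * A : ℝ) ^ R := hPL
      _ ≤ CC ^ R := pow_le_pow_left₀ (by positivity) hC8 _
      _ = Real.exp (R * lC) := hCexp
      _ ≤ _ := by
        apply Real.exp_le_exp.mpr
        calc (R : ℝ) * lC ≤ m * (η1 * T) * lC := by gcongr
          _ = (m * η1 * lC) * T := by ring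
          _ ≤ _ := by gcongr
  obtain ⟨e, he, hew⟩ := hroth r β T P (fun v _ => hrpos v) (fun e he => (mem_box.mp (hPbox e he)).1)
    (fun e he => (mem_box.mp (hPbox e he)).2) hrr
    (fun v hv => (hrη1 v hv).trans (by gcongr)) (fun v _ => hr1 v) hP0 hPZ hPL'
  rw [coeff_tr] at he
  set Q := D e P with hQ
  have hQbox : ∀ f, coeff f Q ≠ 0 → f ∈ box m r := by
    intro f hf
    have := mem_box.mp (hPbox _ (coeff_D_ne hf))
    rw [mem_box]
    refine ⟨fun h hh => ?_, fun h hh => ?_⟩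
    · have := this.1 h hh; simp at this; omega
    · have := this.2 h hh; simp at this; omega
  have hlow := eval_lower hQbox (D_mem_ZP hPZ e) β he
  have hden : ∏ v ∈ Finset.range m, ((β v).den : ℝ) ^ r v ≤ Real.exp (m * (101 / 100 * T)) := by
    calc ∏ v ∈ Finset.range m, ((β v).den : ℝ) ^ r v = ∏ v ∈ Finset.range m, Real.exp (r v * l v) := by
          apply Finset.prod_congr rfl
          intro v _
          rw [Real.exp_nat_mul, hl, Real.exp_log]
          exact_mod_cast (β v).den_pos
      _ = Real.exp (∑ v ∈ Finset.range m, r v * l v) := (Real.exp_sum _ _).symm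
      _ ≤ _ := by
          apply Real.exp_le_exp.mpr
          calc ∑ v ∈ Finset.range m, (r v * l v : ℝ) ≤ ∑ v ∈ Finset.range m, 101 / 100 * T :=
                Finset.sum_le_sum fun v hv => hr2 v (Finset.mem_range.mp hv)
            _ = _ := by simp
  have hev : eval (fun v => (β v : ℝ)) Q = eval (fun v => (β v : ℝ) - α) (tr (fun _ => α) Q) := by
    rw [eval_tr]; simp
  have htrL : L1 (tr (fun _ => α) Q) ≤ Real.exp (m * (1 / 100 * T)) := by
    calc L1 (tr (fun _ => α) Q) ≤ (1 + |α|) ^ R * L1 Q := L1_tr_le hQbox α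
      _ ≤ (1 + |α|) ^ R * (2 ^ R * (8 * A : ℝ) ^ R) := by
          apply mul_le_mul_of_nonneg_left _ (by positivity)
          refine (L1_D_le m r (fun e he => (mem_box.mp (hPbox e he)).1)
            (fun e he => (mem_box.mp (hPbox e he)).2) e).trans ?_
          apply mul_le_mul_of_nonneg_left hPL (by positivity)
      _ = CC ^ R := by rw [← mul_pow, ← mul_pow]
      _ = Real.exp (R * lC) := hCexp
      _ ≤ _ := by
        apply Real.exp_le_exp.mpr
        calc (R : ℝ) * lC ≤ m * (η1 * T) * lC := by gcongr
          _ = m * ((η1 * lC) * T) := by ring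
          _ ≤ _ := by gcongr
  have hup := eval_upper (fun v => (β v : ℝ) - α) (tr (fun _ => α) Q)
    (Real.exp (-(9 / 4) * (47 / 100 * m * T))) (Real.exp_pos _).le (by
      intro f hf
      have hfbox : f ∈ box m r := by
        obtain ⟨g, hg⟩ := coeff_tr_ne hf
        have := mem_box.mp (hQbox _ hg)
        rw [mem_box]
        refine ⟨fun h hh => ?_, fun h hh => ?_⟩
        · have := this.1 h hh; simp at this; omega
        · have := this.2 h hh; simp at this; omega
      rw [hQ, coeff_tr_D] at hf
      have hw : 12 / 25 * (m : ℝ) ≤ wt m r (f + e) := by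
        by_contra hcon
        exact (right_ne_zero_of_mul hf) (hPvan _ (not_le.mp hcon))
      rw [wt_add] at hw
      have hwf : 47 / 100 * (m : ℝ) ≤ wt m r f := by linarith
      have h1 : ∏ i ∈ f.support, ((β i : ℝ) - α) ^ f i = ∏ h ∈ Finset.range m, ((β h : ℝ) - α) ^ f h :=
        prod_box_eq hfbox (fun h => (β h : ℝ) - α)
      rw [h1, Finset.abs_prod]
      calc ∏ h ∈ Finset.range m, |((β h : ℝ) - α) ^ f h|
          ≤ ∏ h ∈ Finset.range m, Real.exp (-(9 / 4) * (f h / r h * T)) := by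
            apply Finset.prod_le_prod
            · intros; positivity
            · intro h hh
              rw [abs_pow]
              have h2 : |(β h : ℝ) - α| ≤ Real.exp (-(9 / 4) * l h) := hbad h
              calc |(β h : ℝ) - α| ^ f h ≤ Real.exp (-(9 / 4) * l h) ^ f h :=
                    pow_le_pow_left₀ (abs_nonneg _) h2 _
                _ = Real.exp (f h * (-(9 / 4) * l h)) := by rw [Real.exp_nat_mul]
                _ ≤ _ := by
                    apply Real.exp_le_exp.mpr
                    have h3 : T / r h ≤ l h := by
                      rw [div_le_iff₀ (by exact_mod_cast hrpos h)]
                      linarith [hr1 h]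
                    have h4 : (f h : ℝ) * (T / r h) ≤ f h * l h := by gcongr
                    have h5 : (f h : ℝ) / r h * T = f h * (T / r h) := by ring
                    rw [h5]; linarith
        _ = Real.exp (-(9 / 4) * (wt m r f * T)) := by
            rw [← Real.exp_sum, ← Finset.mul_sum, wt, Finset.sum_mul]
        _ ≤ _ := by
            apply Real.exp_le_exp.mpr
            have : 47 / 100 * (m : ℝ) * T ≤ wt m r f * T := by gcongr
            linarith)
  rw [← hev] at hup
  have hfinal : (1 : ℝ) ≤ Real.exp (m * (1 / 100 * T)) * Real.exp (-(9 / 4) * (47 / 100 * m * T)) *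
      Real.exp (m * (101 / 100 * T)) := by
    refine hlow.trans ?_
    apply mul_le_mul _ hden (by positivity) (by positivity)
    refine hup.trans ?_
    gcongr
  rw [← Real.exp_add, ← Real.exp_add] at hfinal
  have h0 : (0 : ℝ) < m * T := by positivity
  have : Real.exp (m * (1 / 100 * T) + -(9 / 4) * (47 / 100 * m * T) + m * (101 / 100 * T)) < 1 := by
    rw [Real.exp_lt_one_iff]
    nlinarith
  linarith

end SecRoth

set_option linter.unusedSimpArgs false
namespace SecRoth

lemma block_sq (s : Finset ℕ) (y : ℕ → ℝ) (δ : ℝ) (hδ : 0 < δ) (hy : ∀ n ∈ s, δ ≤ |y n|)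
    (hsep : ∀ n ∈ s, ∀ n' ∈ s, n ≠ n' → δ ≤ |y n - y n'|) :
    ∑ n ∈ s, 1 / (y n) ^ 2 ≤ 4 * (∑' i : ℤ, 1 / (i : ℝ) ^ 2) / δ ^ 2 := by
  classical
  set g : ℕ → ℤ := fun n => ⌊y n / δ⌋ with hg
  have hinj : Set.InjOn g s := by
    intro n hn n' hn' h
    by_contra hne
    have h1 := hsep n hn n' hn' hne
    have h2 : |y n / δ - y n' / δ| < 1 := Int.abs_sub_lt_one_of_floor_eq_floor h
    rw [← sub_div, abs_div, abs_of_pos hδ, div_lt_one hδ] at h2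
    linarith
  have hterm : ∀ n ∈ s, 1 / (y n) ^ 2 ≤ 4 / δ ^ 2 * (1 / (g n : ℝ) ^ 2) := by
    intro n hn
    have h1 := hy n hn
    have hf1 := Int.floor_le (y n / δ)
    have hf2 := Int.lt_floor_add_one (y n / δ)
    have hyd : y n = δ * (y n / δ) := by field_simp
    set x := y n / δ with hx
    have hx1 : 1 ≤ |x| := by
      rw [hx, abs_div, abs_of_pos hδ, le_div_iff₀ hδ]; linarith
    have key : (g n : ℝ) ^ 2 ≤ 4 * x ^ 2 ∧ (g n : ℝ) ≠ 0 := by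
      have hgd : g n = ⌊x⌋ := rfl
      rw [hgd]
      rcases le_abs.mp hx1 with h | h
      · have h3 : (1 : ℤ) ≤ ⌊x⌋ := Int.le_floor.mpr (by exact_mod_cast h)
        have h3' : (1 : ℝ) ≤ ⌊x⌋ := by exact_mod_cast h3
        constructor
        · nlinarith
        · linarith
      · have h3' : (⌊x⌋ : ℝ) ≤ -1 := by linarith
        constructor
        · nlinarith
        · linarith
    have hg2 : 0 < (g n : ℝ) ^ 2 := by have := key.2; positivity
    have hx2 : 0 < x ^ 2 := by nlinarith [key.1]
    rw [hyd, div_mul_div_comm, mul_one, mul_pow]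
    rw [div_le_div_iff₀ (by positivity) (by positivity)]
    nlinarith [key.1, sq_nonneg δ]
  calc ∑ n ∈ s, 1 / (y n) ^ 2 ≤ ∑ n ∈ s, 4 / δ ^ 2 * (1 / (g n : ℝ) ^ 2) := Finset.sum_le_sum hterm
    _ = 4 / δ ^ 2 * ∑ n ∈ s, 1 / (g n : ℝ) ^ 2 := by rw [Finset.mul_sum]
    _ = 4 / δ ^ 2 * ∑ i ∈ s.image g, 1 / (i : ℝ) ^ 2 := by rw [Finset.sum_image hinj]
    _ ≤ 4 / δ ^ 2 * ∑' i : ℤ, 1 / (i : ℝ) ^ 2 := by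
        apply mul_le_mul_of_nonneg_left _ (by positivity)
        apply Summable.sum_le_tsum
        · intros; positivity
        · exact Real.summable_one_div_int_pow.mpr (by norm_num)
    _ = _ := by ring

lemma summ_sq (y : ℕ → ℝ) (c : ℝ) (hc : 0 < c)
    (hy : ∀ N : ℕ, 1 ≤ N → ∀ n ∈ Finset.Ico N (2 * N), c * (N : ℝ) ^ (-(5 / 4) : ℝ) ≤ |y n|)
    (hsep : ∀ N : ℕ, 1 ≤ N → ∀ n ∈ Finset.Ico N (2 * N), ∀ n' ∈ Finset.Ico N (2 * N), n ≠ n' →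
      c * (N : ℝ) ^ (-(5 / 4) : ℝ) ≤ |y n - y n'|) :
    Summable fun n : ℕ => (n : ℝ) ^ (-(11 / 4) : ℝ) * (1 / (y n) ^ 2) := by
  set g : ℕ → ℝ := fun n : ℕ => (n : ℝ) ^ (-(11 / 4) : ℝ) * (1 / (y n) ^ 2) with hg
  have hg0 : ∀ n, 0 ≤ g n := fun n => by rw [hg]; positivity
  set C : ℝ := 4 * (∑' i : ℤ, 1 / (i : ℝ) ^ 2) / c ^ 2 with hC
  have hC0 : 0 ≤ C := by
    have : 0 ≤ ∑' i : ℤ, 1 / (i : ℝ) ^ 2 := tsum_nonneg fun i => by positivity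
    positivity
  set ρ : ℝ := (2 : ℝ) ^ (-(1 / 4) : ℝ) with hρ
  have hρ0 : 0 < ρ := by positivity
  have hρ1 : ρ < 1 := Real.rpow_lt_one_of_one_lt_of_neg (by norm_num) (by norm_num)
  have hblock : ∀ N : ℕ, 1 ≤ N → ∑ n ∈ Finset.Ico N (2 * N), g n ≤ C * (N : ℝ) ^ (-(1 / 4) : ℝ) := by
    intro N hN
    have hN' : (0 : ℝ) < N := by exact_mod_cast hN
    have h1 := block_sq (Finset.Ico N (2 * N)) y (c * (N : ℝ) ^ (-(5 / 4) : ℝ)) (by positivity) (hy N hN) (hsep N hN)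
    calc ∑ n ∈ Finset.Ico N (2 * N), g n ≤ ∑ n ∈ Finset.Ico N (2 * N), (N : ℝ) ^ (-(11 / 4) : ℝ) * (1 / (y n) ^ 2) := by
          apply Finset.sum_le_sum
          intro n hn
          apply mul_le_mul_of_nonneg_right _ (by positivity)
          apply Real.rpow_le_rpow_of_nonpos hN' _ (by norm_num)
          exact_mod_cast (Finset.mem_Ico.mp hn).1
      _ = (N : ℝ) ^ (-(11 / 4) : ℝ) * ∑ n ∈ Finset.Ico N (2 * N), (1 / (y n) ^ 2) := by rw [Finset.mul_sum]
      _ ≤ (N : ℝ) ^ (-(11 / 4) : ℝ) * _ := mul_le_mul_of_nonneg_left h1 (by positivity)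
      _ = C * ((N : ℝ) ^ (-(11 / 4) : ℝ) / ((N : ℝ) ^ (-(5 / 4) : ℝ)) ^ 2) := by
          rw [hC, mul_pow]; field_simp
      _ = _ := by
          congr 1
          rw [← Real.rpow_natCast, ← Real.rpow_mul hN'.le, ← Real.rpow_sub hN']
          norm_num
  have hdy : ∀ K : ℕ, ∑ n ∈ Finset.range (2 ^ K), g n ≤ g 0 + ∑ j ∈ Finset.range K, C * ρ ^ j := by
    intro K
    induction K with
    | zero => simp
    | succ K ih =>
      rw [Finset.sum_range_succ, ← Finset.sum_range_add_sum_Ico g (show 2 ^ K ≤ 2 ^ (K + 1) by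
        apply Nat.pow_le_pow_right <;> omega)]
      have h2 := hblock (2 ^ K) Nat.one_le_two_pow
      have h3 : ((2 ^ K : ℕ) : ℝ) ^ (-(1 / 4) : ℝ) = ρ ^ K := by
        rw [hρ]
        push_cast
        rw [← Real.rpow_natCast, ← Real.rpow_mul (by norm_num), ← Real.rpow_natCast, ← Real.rpow_mul (by norm_num)]
        ring_nf
      rw [h3, show 2 * 2 ^ K = 2 ^ (K + 1) by ring] at h2
      linarith
  apply summable_of_sum_range_le (c := g 0 + C * (1 - ρ)⁻¹) hg0
  intro n
  calc ∑ i ∈ Finset.range n, g i ≤ ∑ i ∈ Finset.range (2 ^ n), g i := by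
        apply Finset.sum_le_sum_of_subset_of_nonneg
        · intro x hx
          have := Finset.mem_range.mp hx
          have h2 : n < 2 ^ n := Nat.lt_two_pow_self
          exact Finset.mem_range.mpr (by omega)
        · intros; exact hg0 _
    _ ≤ g 0 + ∑ j ∈ Finset.range n, C * ρ ^ j := hdy n
    _ ≤ _ := by
        rw [← Finset.mul_sum]
        gcongr
        rw [← tsum_geometric_of_lt_one hρ0.le hρ1]
        apply Summable.sum_le_tsum _ _ (summable_geometric_of_lt_one hρ0.le hρ1)
        intros; positivity

end SecRoth

set_option linter.unusedSimpArgs false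
namespace SecRoth

lemma dioph (z : ℝ) (hirr : Irrational z) (halg : IsAlgebraic ℚ z) :
    ∃ c : ℝ, 0 < c ∧ ∀ q : ℕ, 0 < q → ∀ p : ℤ, c * (q : ℝ) ^ (-(5 / 4) : ℝ) ≤ |q * z - p| := by
  have halgZ : IsAlgebraic ℤ z := (IsFractionRing.isAlgebraic_iff ℤ ℚ ℝ).mpr halg
  obtain ⟨a, ha, hIntegral⟩ := halgZ.exists_integral_multiple
  rw [zsmul_eq_mul] at hIntegral
  set α : ℝ := a * z with hα
  have hαirr : Irrational α := hirr.intCast_mul ha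
  have hfin := roth_finite α hIntegral
  have hδ : ∃ δ : ℝ, 0 < δ ∧ ∀ β ∈ bad α, δ ≤ |(β : ℝ) - α| := by
    rcases (bad α).eq_empty_or_nonempty with h | h
    · exact ⟨1, one_pos, by simp [h]⟩
    · obtain ⟨b, hb, hmin⟩ := Set.exists_min_image (bad α) (fun β => |(β : ℝ) - α|) hfin h
      refine ⟨|(b : ℝ) - α|, ?_, hmin⟩
      rw [abs_pos, sub_ne_zero]
      intro h
      exact hαirr ⟨b, h⟩
  obtain ⟨δ, hδ0, hδ⟩ := hδ
  have ha' : (0 : ℝ) < |(a : ℝ)| := by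
    rw [abs_pos]; exact_mod_cast ha
  refine ⟨min 1 δ / |(a : ℝ)|, by have := lt_min one_pos hδ0; positivity, ?_⟩
  intro q hq p
  have hq' : (0 : ℝ) < q := by exact_mod_cast hq
  have hq1 : (1 : ℝ) ≤ q := by exact_mod_cast hq
  set β : ℚ := (a * p : ℤ) / (q : ℕ) with hβ
  have hβr : (β : ℝ) = a * p / q := by rw [hβ]; push_cast; rfl
  have hmain : min 1 δ * (q : ℝ) ^ (-(9 / 4) : ℝ) ≤ |(β : ℝ) - α| := by
    have hle1 : (q : ℝ) ^ (-(9 / 4) : ℝ) ≤ 1 := Real.rpow_le_one_of_one_le_of_nonpos hq1 (by norm_num)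
    have hpos : (0 : ℝ) < (q : ℝ) ^ (-(9 / 4) : ℝ) := by positivity
    by_cases hb : β ∈ bad α
    · have h1 := hδ β hb
      have h2 := min_le_right (1 : ℝ) δ
      have h3 : 0 < min 1 δ := lt_min one_pos hδ0
      nlinarith
    · have h1 : Real.exp (-(9 / 4) * Real.log β.den) < |(β : ℝ) - α| := not_le.mp hb
      have hden : β.den ≤ q := by
        have : (β.den : ℤ) ∣ (q : ℤ) := by
          have := Rat.den_dvd (a * p) (q : ℤ)
          rw [hβ]
          exact_mod_cast this
        exact Nat.le_of_dvd hq (by exact_mod_cast this)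
      have hdp : (0 : ℝ) < β.den := by exact_mod_cast β.den_pos
      have h2 : (q : ℝ) ^ (-(9 / 4) : ℝ) ≤ Real.exp (-(9 / 4) * Real.log β.den) := by
        rw [Real.rpow_def_of_pos hq']
        apply Real.exp_le_exp.mpr
        have : Real.log β.den ≤ Real.log q := Real.log_le_log hdp (by exact_mod_cast hden)
        linarith
      have h3 := min_le_left (1 : ℝ) δ
      nlinarith
  have hexp : (q : ℝ) ^ (-(5 / 4) : ℝ) = q * (q : ℝ) ^ (-(9 / 4) : ℝ) := by
    rw [← Real.rpow_one_add' hq'.le (by norm_num)]; norm_num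
  have heq : |q * z - p| = q * |(β : ℝ) - α| / |(a : ℝ)| := by
    rw [eq_div_iff ha'.ne', ← abs_of_pos hq', ← abs_mul, ← abs_mul, abs_of_pos hq', hβr, hα, ← abs_neg]
    congr 1
    field_simp
    ring
  rw [heq, hexp, div_mul_eq_mul_div]
  apply div_le_div_of_nonneg_right _ ha'.le
  have := mul_le_mul_of_nonneg_left hmain hq'.le
  linarith

lemma summ_main (z : ℝ) (hirr : Irrational z) (halg : IsAlgebraic ℚ z) :
    Summable (fun n : ℕ => |1 / Real.cos (Real.pi * (n : ℝ) * z)| / (n : ℝ) ^ 2) := by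
  obtain ⟨c, hc, hd⟩ := dioph z hirr halg
  set k : ℕ → ℤ := fun n => round ((n : ℝ) * z - 1 / 2) with hk
  set y : ℕ → ℝ := fun n => (n : ℝ) * z - 1 / 2 - k n with hy
  have hcos : ∀ n, 2 * |y n| ≤ |Real.cos (Real.pi * (n : ℝ) * z)| := by
    intro n
    have h1 : Real.pi * (n : ℝ) * z = (Real.pi * y n + Real.pi / 2) + (k n : ℤ) * Real.pi := by
      rw [hy]; ring
    rw [h1, Real.cos_add_int_mul_pi, Real.cos_add_pi_div_two, abs_mul, abs_neg]
    have h2 : |((-1 : ℝ)) ^ (k n)| = 1 := by rw [abs_zpow]; simp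
    rw [h2, one_mul]
    have hpi := Real.pi_pos
    have h3 : |y n| ≤ 1 / 2 := abs_sub_round _
    have h4 : |Real.pi * y n| = Real.pi * |y n| := by rw [abs_mul, abs_of_pos hpi]
    have h5 := Real.mul_abs_le_abs_sin (x := Real.pi * y n) (by rw [h4]; nlinarith)
    rw [h4] at h5
    have h6 : 2 / Real.pi * (Real.pi * |y n|) = 2 * |y n| := by field_simp
    linarith
  set c' : ℝ := c / 2 * (4 : ℝ) ^ (-(5 / 4) : ℝ) with hc'
  have h4le : (4 : ℝ) ^ (-(5 / 4) : ℝ) ≤ 1 := Real.rpow_le_one_of_one_le_of_nonpos (by norm_num) (by norm_num)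
  have hc'0 : 0 < c' := by positivity
  have hc'c : c' ≤ c := by rw [hc']; nlinarith
  have hlow : ∀ N : ℕ, 1 ≤ N → ∀ n ∈ Finset.Ico N (2 * N), c' * (N : ℝ) ^ (-(5 / 4) : ℝ) ≤ |y n| := by
    intro N hN n hn
    rw [Finset.mem_Ico] at hn
    have h1 := hd (2 * n) (by omega) (1 + 2 * k n)
    have h2 : ((2 * n : ℕ) : ℝ) * z - ((1 + 2 * k n : ℤ) : ℝ) = 2 * y n := by
      rw [hy]; push_cast; ring
    rw [h2, abs_mul, abs_two] at h1
    have h3 : (4 * N : ℝ) ^ (-(5 / 4) : ℝ) ≤ ((2 * n : ℕ) : ℝ) ^ (-(5 / 4) : ℝ) := by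
      apply Real.rpow_le_rpow_of_nonpos _ _ (by norm_num)
      · exact_mod_cast (by omega : 0 < 2 * n)
      · exact_mod_cast (by omega : 2 * n ≤ 4 * N)
    rw [Real.mul_rpow (by norm_num) (by positivity)] at h3
    have h4 := mul_le_mul_of_nonneg_left h3 hc.le
    rw [hc']
    linarith
  have hsep : ∀ N : ℕ, 1 ≤ N → ∀ n ∈ Finset.Ico N (2 * N), ∀ n' ∈ Finset.Ico N (2 * N), n ≠ n' →
      c' * (N : ℝ) ^ (-(5 / 4) : ℝ) ≤ |y n - y n'| := by
    intro N hN
    have key : ∀ n ∈ Finset.Ico N (2 * N), ∀ n' ∈ Finset.Ico N (2 * N), n' < n →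
        c' * (N : ℝ) ^ (-(5 / 4) : ℝ) ≤ |y n - y n'| := by
      intro n hn n' hn' hlt
      rw [Finset.mem_Ico] at hn hn'
      have h1 := hd (n - n') (by omega) (k n - k n')
      have h2 : ((n - n' : ℕ) : ℝ) * z - ((k n - k n' : ℤ) : ℝ) = y n - y n' := by
        rw [hy, Nat.cast_sub hlt.le]; push_cast; ring
      rw [h2] at h1
      refine le_trans ?_ h1
      apply mul_le_mul hc'c _ (by positivity) hc.le
      apply Real.rpow_le_rpow_of_nonpos _ _ (by norm_num)
      · exact_mod_cast (by omega : 0 < n - n')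
      · exact_mod_cast (by omega : n - n' ≤ N)
    intro n hn n' hn' hne
    rcases Nat.lt_or_gt_of_ne hne with h | h
    · rw [abs_sub_comm]; exact key n' hn' n hn h
    · exact key n hn n' hn' h
  have hS := summ_sq y c' hc'0 hlow hsep
  have hS2 : Summable fun n : ℕ => (n : ℝ) ^ (-(5 / 4) : ℝ) := Real.summable_nat_rpow.mpr (by norm_num)
  refine Summable.of_nonneg_of_le (fun n => by positivity) ?_ (hS2.add hS)
  intro n
  rcases Nat.eq_zero_or_pos n with h0 | hn
  · subst h0
    norm_num
  have hn' : (0 : ℝ) < n := by exact_mod_cast hn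
  have hypos : 0 < |y n| := by
    refine lt_of_lt_of_le ?_ (hlow n hn n (Finset.mem_Ico.mpr ⟨le_refl _, by omega⟩))
    positivity
  have hcp := hcos n
  rw [abs_div, abs_one]
  have h1 : 1 / |Real.cos (Real.pi * (n : ℝ) * z)| ≤ 1 / |y n| := by
    apply one_div_le_one_div_of_le hypos; linarith
  set u : ℝ := (n : ℝ) ^ (-(5 / 8) : ℝ) with hu
  set w : ℝ := (n : ℝ) ^ (-(11 / 8) : ℝ) with hw
  have hu2 : (n : ℝ) ^ (-(5 / 4) : ℝ) = u ^ 2 := by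
    rw [hu, ← Real.rpow_natCast, ← Real.rpow_mul hn'.le]; norm_num
  have hw2 : (n : ℝ) ^ (-(11 / 4) : ℝ) = w ^ 2 := by
    rw [hw, ← Real.rpow_natCast, ← Real.rpow_mul hn'.le]; norm_num
  have huw : u * w = 1 / (n : ℝ) ^ 2 := by
    rw [hu, hw, ← Real.rpow_add hn', one_div, ← Real.rpow_natCast, ← Real.rpow_neg hn'.le]; norm_num
  rw [hu2, hw2]
  have h2 : (y n) ^ 2 = |y n| ^ 2 := (sq_abs _).symm
  rw [h2]
  calc 1 / |Real.cos (Real.pi * (n : ℝ) * z)| / (n : ℝ) ^ 2 ≤ 1 / |y n| / (n : ℝ) ^ 2 := by gcongr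
    _ = u * (w * (1 / |y n|)) := by
        rw [← mul_assoc, huw]; ring
    _ ≤ u ^ 2 + (w * (1 / |y n|)) ^ 2 := by nlinarith [sq_nonneg (u - w * (1 / |y n|)), sq_nonneg u, sq_nonneg (w * (1 / |y n|))]
    _ = _ := by rw [mul_pow, div_pow, one_pow]

end SecRoth

open Real

theorem secant_zeta_abs_convergence_s_two (z : ℝ) (hirr : Irrational z)
    (halg : IsAlgebraic ℚ z) :
    Summable (fun n : ℕ => |1 / Real.cos (π * ((n : ℝ) + 1) * z)| / ((n : ℝ) + 1) ^ 2) := by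
  have h := (summable_nat_add_iff 1).mpr (SecRoth.summ_main z hirr halg)
  refine h.congr ?_
  intro n
  push_cast
  rfl
end

section
/- For appropriate real x and irrational algebraic z, π csc(πzx) sec(πx) = 1/(zx) + 8x ∑_{n=1}^∞ χ₋₄(n) csc(πnz/2)/(n² − 4x²) − 2zx ∑_{n=1}^∞ sec(πn(1 + 1/z))/(n² − z²x²), where χ₋₄ is the nontrivial character mod 4. -/
open Real

/-- The nontrivial Dirichlet character modulo 4 (Legendre symbol mod 4), as a
real-valued function. -/
def chiFour (n : ℕ) : ℝ := if n % 4 = 1 then 1 else if n % 4 = 3 then -1 else 0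

open Filter Topology Metric in
theorem residue_sum {ι : Type*} [DecidableEq ι] (R : ℝ) (hR : 0 < R) (p r : ι → ℂ) (s : Finset ι) :
    ∀ (F : ℂ → ℂ), Set.InjOn p s → (∀ i ∈ s, p i ∈ ball (0:ℂ) R) →
    (∀ w ∈ closedBall (0:ℂ) R, (∀ i ∈ s, w ≠ p i) → DifferentiableAt ℂ F w) →
    (∀ i ∈ s, Tendsto (fun w => (w - p i) * F w) (𝓝[≠] (p i)) (𝓝 (r i))) →
    (∮ w in C(0, R), F w) = 2 * π * Complex.I * ∑ i ∈ s, r i := by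
  induction s using Finset.induction_on with
  | empty =>
    intro F _ _ hd _
    simp only [Finset.sum_empty, mul_zero]
    apply Complex.circleIntegral_eq_zero_of_differentiable_on_off_countable hR.le
      Set.countable_empty
    · intro w hw
      exact (hd w hw (by simp)).continuousAt.continuousWithinAt
    · intro w hw
      exact hd w (ball_subset_closedBall hw.1) (by simp)
  | insert a s ha ih =>
    intro F hinj hball hd ht
    set P := p a with hP
    have hpne : ∀ i ∈ s, p i ≠ P := by
      intro i hi h
      have := hinj (by simp [hi]) (by simp) h
      exact ha (this ▸ hi)
    set T : ℂ → ℂ := Function.update (fun w => (w - P) * F w) P (r a) with hT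
    have hTe : ∀ w, w ≠ P → T =ᶠ[𝓝 w] (fun w => (w - P) * F w) := by
      intro w hw
      filter_upwards [isOpen_ne.mem_nhds hw] with v hv
      exact Function.update_of_ne hv _ _
    have hTd : ∀ w ∈ closedBall (0:ℂ) R, w ≠ P → (∀ i ∈ s, w ≠ p i) → DifferentiableAt ℂ T w := by
      intro w hw hne hs
      refine DifferentiableAt.congr_of_eventuallyEq ?_ (hTe w hne)
      refine DifferentiableAt.mul (by fun_prop) (hd w hw ?_)
      intro i hi
      rcases Finset.mem_insert.1 hi with rfl | hi
      · exact hne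
      · exact hs i hi
    have hev : ∀ᶠ w in 𝓝 P, w ∈ ball (0:ℂ) R ∧ ∀ i ∈ s, w ≠ p i := by
      refine Filter.Eventually.and (isOpen_ball.mem_nhds (hball a (by simp))) ?_
      rw [Filter.eventually_all_finset]
      intro i hi
      exact isOpen_ne.mem_nhds (hpne i hi).symm
    have hTa : AnalyticAt ℂ T P := by
      apply Complex.analyticAt_of_differentiable_on_punctured_nhds_of_continuousAt
      · rw [eventually_nhdsWithin_iff]
        filter_upwards [hev] with w hw hne
        exact hTd w (ball_subset_closedBall hw.1) hne hw.2
      · exact continuousAt_update_same.2 (ht a (by simp))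
    have hTP : T P = r a := by simp [hT]
    set G := dslope T P with hG
    have hGe : ∀ w, w ≠ P → G w = F w - r a * (w - P)⁻¹ := by
      intro w hw
      have : w - P ≠ 0 := sub_ne_zero.2 hw
      rw [hG, dslope_of_ne _ hw, slope_def_field, hTP, hT, Function.update_of_ne hw]
      field_simp
    have hGev : ∀ w, w ≠ P → G =ᶠ[𝓝 w] (fun w => F w - r a * (w - P)⁻¹) := by
      intro w hw
      filter_upwards [isOpen_ne.mem_nhds hw] with v hv
      exact hGe v hv
    have hint := ih G (hinj.mono (by simp)) (fun i hi => hball i (by simp [hi])) ?_ ?_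
    · have h1 : (∮ w in C(0, R), G w) = ∮ w in C(0, R), (F w - r a * (w - P)⁻¹) := by
        apply circleIntegral.integral_congr hR.le
        intro w hw
        apply hGe
        rintro rfl
        have := hball a (by simp)
        simp only [mem_ball, mem_sphere] at this hw
        linarith
      have hne : ∀ i ∈ insert a s, ∀ w ∈ sphere (0:ℂ) R, w ≠ p i := by
        rintro i hi w hw rfl
        have := hball i hi
        simp only [mem_ball, mem_sphere] at this hw
        linarith
      rw [circleIntegral.integral_sub, circleIntegral.integral_const_mul,
        circleIntegral.integral_sub_inv_of_mem_ball (hball a (by simp)), hint] at h1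
      · rw [Finset.sum_insert ha, mul_add, h1]; ring
      · apply ContinuousOn.circleIntegrable hR.le
        intro w hw
        exact (hd w (sphere_subset_closedBall hw)
          (fun i hi => hne i hi w hw)).continuousAt.continuousWithinAt
      · apply ContinuousOn.circleIntegrable hR.le
        intro w hw
        have := sub_ne_zero.2 (hne a (by simp) w hw)
        apply ContinuousAt.continuousWithinAt
        fun_prop (disch := assumption)
    · intro w hw hs
      by_cases hwP : w = P
      · subst hwP
        obtain ⟨t, ht1, ht2⟩ := hTa.exists_mem_nhds_analyticOnNhd
        exact ((Complex.differentiableOn_dslope ht1).2 ht2.differentiableOn).differentiableAt ht1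
      · refine DifferentiableAt.congr_of_eventuallyEq ?_ (hGev w hwP)
        have := sub_ne_zero.2 hwP
        refine DifferentiableAt.sub (hd w hw ?_) ?_
        · intro i hi
          rcases Finset.mem_insert.1 hi with rfl | hi
          · exact hwP
          · exact hs i hi
        · fun_prop (disch := assumption)
    · intro i hi
      have h1 := ht i (by simp [hi])
      have h2 : Tendsto (fun w => (w - p i) * (r a * (w - P)⁻¹)) (𝓝[≠] (p i)) (𝓝 0) := by
        have hne := sub_ne_zero.2 (hpne i hi)
        have : ContinuousAt (fun w => (w - p i) * (r a * (w - P)⁻¹)) (p i) := by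
          fun_prop (disch := assumption)
        have := this.tendsto
        simp only [sub_self, zero_mul] at this
        exact this.mono_left nhdsWithin_le_nhds
      have h3 := h1.sub h2
      rw [sub_zero] at h3
      refine h3.congr' ?_
      filter_upwards [(hGev (p i) (hpne i hi)).filter_mono nhdsWithin_le_nhds] with w hw
      rw [hw]; ring

open Filter Topology in
theorem simple_pole {G s : ℂ → ℂ} {p s' : ℂ} (hG : ContinuousAt G p) (hs : HasDerivAt s s' p)
    (h0 : s p = 0) (h' : s' ≠ 0) :
    Tendsto (fun w => (w - p) * (G w / s w)) (𝓝[≠] p) (𝓝 (G p / s')) := by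
  have h1 := (hs.tendsto_slope).inv₀ h'
  have h2 := (hG.tendsto.mono_left (nhdsWithin_le_nhds (s := {p}ᶜ))).mul h1
  rw [← div_eq_mul_inv] at h2
  refine h2.congr ?_
  intro w
  rw [slope_def_field, h0, inv_div, sub_zero]
  ring

theorem norm_sin_ge (w : ℂ) : 2 * ‖w - (round w.re : ℂ)‖ ≤ ‖Complex.sin (π * w)‖ := by
  have hpi := Real.pi_gt_three
  set k := round w.re
  set a := w.re - k with ha
  have hab : |a| ≤ 1/2 := abs_sub_round w.re
  have h1 : ‖Complex.sin (π * w)‖^2 = Real.sin (π * w.re)^2 + Real.sinh (π * w.im)^2 := by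
    rw [Complex.sin_eq, ← Complex.normSq_eq_norm_sq]
    simp only [Complex.mul_re, Complex.mul_im, Complex.ofReal_re, Complex.ofReal_im, zero_mul,
      sub_zero, add_zero]
    rw [← Complex.ofReal_sin, ← Complex.ofReal_cos, ← Complex.ofReal_sinh, ← Complex.ofReal_cosh,
      ← Complex.ofReal_mul, ← Complex.ofReal_mul, Complex.normSq_add_mul_I]
    have e1 := Real.cosh_sq (π * w.im)
    have e2 := Real.sin_sq_add_cos_sq (π * w.re)
    rw [mul_pow, mul_pow, e1]
    linear_combination (Real.sinh (π * w.im))^2 * e2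
  have h2 : (2 * a)^2 ≤ Real.sin (π * w.re)^2 := by
    have : Real.sin (π * w.re)^2 = Real.sin (π * |a|)^2 := by
      have e : π * w.re = π * a + k * π := by rw [ha]; ring
      rw [e, Real.sin_add_int_mul_pi, mul_pow, ← zpow_natCast, ← zpow_mul, mul_comm k, zpow_mul]
      rcases abs_cases a with ⟨h, _⟩ | ⟨h, _⟩ <;> rw [h] <;> simp
    rw [this, ← sq_abs (2*a), abs_mul]
    apply pow_le_pow_left₀ (by positivity)
    have := Real.mul_le_sin (x := π * |a|) (by positivity) (by nlinarith)
    calc |2| * |a| = 2 / π * (π * |a|) := by field_simp; simp [mul_comm]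
      _ ≤ _ := this
  have h3 : (2 * w.im)^2 ≤ Real.sinh (π * w.im)^2 := by
    have : Real.sinh (π * w.im)^2 = Real.sinh (π * |w.im|)^2 := by
      rcases abs_cases w.im with ⟨h, _⟩ | ⟨h, _⟩ <;> rw [h] <;> simp
    rw [this, ← sq_abs (2*w.im), abs_mul]
    apply pow_le_pow_left₀ (by positivity)
    have := Real.self_le_sinh_iff.2 (show 0 ≤ π * |w.im| by positivity)
    have h4 := abs_nonneg w.im
    rw [abs_two]
    nlinarith
  apply le_of_sq_le_sq _ (norm_nonneg _) 
  rw [h1, mul_pow, ← Complex.normSq_eq_norm_sq, Complex.normSq_apply]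
  simp
  nlinarith

/-- choice of radius -/
theorem good_radius (a : ℝ) (ha : 0 < a) : ∃ δ : ℝ, 0 < δ ∧ δ ≤ 1/8 ∧ ∀ N : ℕ, ∃ R : ℝ,
    (N:ℝ) + 1 ≤ R ∧ R ≤ N + 1 + 1/4 ∧ ∀ k : ℤ, δ ≤ |R - k * a| := by
  refine ⟨min (a/4) (1/8), by positivity, min_le_right _ _, fun N => ?_⟩
  set δ := min (a/4) (1/8)
  have h1 : δ ≤ a/4 := min_le_left _ _
  have h2 : δ ≤ 1/8 := min_le_right _ _
  have h0 : 0 < δ := by positivity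
  by_cases h : ∀ k : ℤ, δ ≤ |((N:ℝ)+1) - k * a|
  · exact ⟨N+1, le_rfl, by linarith, h⟩
  · push Not at h
    obtain ⟨k, hk⟩ := h
    refine ⟨N+1+2*δ, by linarith, by linarith, fun j => ?_⟩
    rw [abs_lt] at hk
    rcases le_or_gt j k with hj | hj
    · have : (j:ℝ) * a ≤ k * a := by gcongr
      rw [abs_of_nonneg] <;> linarith
    · have : ((k:ℝ)+1) * a ≤ j * a := by
        gcongr; exact_mod_cast hj
      rw [abs_of_nonpos] <;> linarith

theorem sum_Icc_even (g : ℤ → ℝ) (hg : ∀ k, g (-k) = g k) (K : ℕ) :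
    ∑ k ∈ Finset.Icc (-(K:ℤ)) K, g k = g 0 + 2 * ∑ k ∈ Finset.range K, g (k+1) := by
  induction K with
  | zero => simp
  | succ K ih =>
    have : Finset.Icc (-((K+1:ℕ):ℤ)) ((K+1:ℕ):ℤ) =
        insert (-((K:ℤ)+1)) (insert ((K:ℤ)+1) (Finset.Icc (-(K:ℤ)) K)) := by
      ext i; simp; omega
    rw [this, Finset.sum_insert, Finset.sum_insert, ih, Finset.sum_range_succ, hg]
    · ring
    · simp
    · simp; omega

theorem chiFour_sin (n : ℕ) : (if n % 4 = 1 then (1:ℝ) else if n % 4 = 3 then -1 else 0)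
    = Real.sin (π * n / 2) := by
  obtain ⟨q, hq⟩ : ∃ q, q = n / 4 := ⟨_, rfl⟩
  have h : n = 4 * q + n % 4 := by omega
  have e : π * n / 2 = π * ((n % 4 : ℕ):ℝ) / 2 + q * (2 * π) := by
    conv_lhs => rw [h]
    push_cast; ring
  rw [e, Real.sin_add_nat_mul_two_pi]
  have : n % 4 < 4 := Nat.mod_lt _ (by norm_num)
  interval_cases n % 4
  · simp
  · simp
  · simp
  · simp
    rw [show π * 3 / 2 = π / 2 + π by ring, Real.sin_add_pi]; simp

set_option maxHeartbeats 2000000 in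
open Filter Topology Metric in
theorem key (z x : ℝ) (hirr : Irrational z)
    (hzx : z * x ≠ 0)
    (hsin : Real.sin (π * z * x) ≠ 0)
    (hcos : Real.cos (π * x) ≠ 0)
    (hden1 : ∀ n : ℕ, ((n : ℝ) + 1) ^ 2 - 4 * x ^ 2 ≠ 0) :
    ∃ C : ℝ, ∀ N : ℕ, 2 * |x| ≤ N → ∃ K : ℕ, N * |z| ≤ K + 1 ∧
    |2 * (π / (Real.sin (π * z * x) * Real.cos (π * x)))
      + ∑ k ∈ Finset.Icc (-(K:ℤ)) K,
        2 * x * z / (Real.cos (π * k * (1 + 1 / z)) * (k ^ 2 - z ^ 2 * x ^ 2))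
      + ∑ n ∈ (Finset.Icc (-((2 * N + 1 : ℕ):ℤ)) (2 * N + 1 : ℕ)).erase 0,
        -(8 * x * Real.sin (π * n / 2) / (Real.sin (π * n * z / 2) * (n ^ 2 - 4 * x ^ 2)))|
      ≤ C / (N + 1) := by
  have hz : z ≠ 0 := left_ne_zero_of_mul hzx
  have hx : x ≠ 0 := right_ne_zero_of_mul hzx
  have hz' : 0 < |z| := abs_pos.2 hz
  have hpi : π ≠ 0 := Real.pi_ne_zero
  obtain ⟨δ, hδ, hδ8, hrad⟩ := good_radius (1 / |z|) (by positivity)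
  set f : ℝ := π / (Real.sin (π * z * x) * Real.cos (π * x)) with hf
  set rk : ℤ → ℝ := fun k =>
    2 * x * z / (Real.cos (π * k * (1 + 1 / z)) * (k ^ 2 - z ^ 2 * x ^ 2)) with hrk
  set rn : ℤ → ℝ := fun n =>
    -(8 * x * Real.sin (π * n / 2) / (Real.sin (π * n * z / 2) * (n ^ 2 - 4 * x ^ 2))) with hrn
  set F : ℂ → ℂ := fun w =>
    π * (2 * x) / (Complex.sin (π * z * w) * Complex.cos (π * w) * (w - x) * (w + x)) with hF
  set p : Bool ⊕ (ℤ ⊕ ℤ) → ℝ := Sum.elim (fun b => if b then x else -x)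
    (Sum.elim (fun k => k / z) (fun n => n / 2)) with hp
  set r : Bool ⊕ (ℤ ⊕ ℤ) → ℝ := Sum.elim (fun _ => f) (Sum.elim rk rn) with hr
  -- separation facts
  have hk1 : ∀ k : ℤ, (k / z : ℝ) ≠ x := by
    intro k h
    apply hsin
    rw [← h, show π * z * (k / z) = k * π by field_simp]
    exact Real.sin_int_mul_pi k
  have hk2 : ∀ k : ℤ, (k / z : ℝ) ≠ -x := by
    intro k h
    apply hk1 (-k)
    push_cast; rw [neg_div, h, neg_neg]
  have hn0 : ∀ n : ℤ, n ≠ 0 → ((n:ℝ)^2 - 4 * x^2 ≠ 0) := by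
    intro n hn
    have h := hden1 (n.natAbs - 1)
    have e : ((n.natAbs - 1 : ℕ) : ℝ) + 1 = |(n:ℝ)| := by
      have : 1 ≤ n.natAbs := by omega
      rw [Nat.cast_sub this]
      simp
    rwa [e, sq_abs] at h
  have hn1 : ∀ n : ℤ, n ≠ 0 → (n / 2 : ℝ) ≠ x := by
    intro n hn h
    apply hn0 n hn; rw [← h]; ring
  have hn2 : ∀ n : ℤ, n ≠ 0 → (n / 2 : ℝ) ≠ -x := by
    intro n hn h
    apply hn0 n hn; rw [← neg_eq_iff_eq_neg.2 h]; ring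
  have hkn : ∀ k n : ℤ, n ≠ 0 → (k / z : ℝ) ≠ n / 2 := by
    intro k n hn h
    have hn' : (n:ℝ) ≠ 0 := by exact_mod_cast hn
    apply hirr
    refine ⟨2 * k / n, ?_⟩
    push_cast
    field_simp at h ⊢
    linarith
  have hsn : ∀ n : ℤ, n ≠ 0 → Real.sin (π * z * (n / 2)) ≠ 0 := by
    intro n hn h
    rw [Real.sin_eq_zero_iff] at h
    obtain ⟨k, hk⟩ := h
    apply hkn k n hn
    field_simp at hk ⊢
    linarith
  have hck : ∀ k : ℤ, Real.cos (π * (k / z)) ≠ 0 := by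
    intro k h
    rw [Real.cos_eq_zero_iff] at h
    obtain ⟨j, hj⟩ := h
    apply hkn k (2 * j + 1) (by omega)
    push_cast
    field_simp at hj ⊢
    linarith
  have hcc : ∀ k : ℤ, Real.cos (k * π) ≠ 0 := by
    intro k h
    have := Real.sin_sq_add_cos_sq (k * π)
    rw [h, Real.sin_int_mul_pi] at this
    norm_num at this
  have hxx : x ≠ -x := by
    intro h; apply hx; linarith
  -- limits
  have lim_x : ∀ b : Bool, Tendsto (fun w => (w - ((p (Sum.inl b) : ℝ) : ℂ)) * F w)
      (𝓝[≠] ((p (Sum.inl b) : ℝ) : ℂ)) (𝓝 ((f : ℝ) : ℂ)) := by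
    have hs' : Complex.sin (π * z * x) ≠ 0 := by exact_mod_cast hsin
    have hc' : Complex.cos (π * x) ≠ 0 := by exact_mod_cast hcos
    have hx' : (x:ℂ) ≠ 0 := by exact_mod_cast hx
    intro b
    cases b with
    | true =>
      have h2 : (x:ℂ) + x ≠ 0 := by
        rw [← two_mul]; exact mul_ne_zero two_ne_zero hx'
      have := simple_pole (G := fun w : ℂ => π * (2 * x) /
        (Complex.sin (π * z * w) * Complex.cos (π * w) * (w + x))) (s := fun w => w - (x:ℂ))
        (p := (x:ℂ)) (s' := 1)
        (by
          have := mul_ne_zero (mul_ne_zero hs' hc') h2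
          fun_prop (disch := assumption)) ((hasDerivAt_id _).sub_const _) (by simp) one_ne_zero
      have h3 : (p (Sum.inl true) : ℝ) = x := by simp [hp]
      rw [h3]
      convert this.congr _ using 2
      · rw [hf]; push_cast; field_simp; ring
      · intro w; simp only [hF, div_eq_mul_inv, mul_inv]; ring
    | false =>
      have h2 : (-x:ℂ) - x ≠ 0 := by
        intro h; apply hx'; linear_combination (-1/2) * h
      have e1 : Complex.sin (π * z * -x) = - Complex.sin (π * z * x) := by
        rw [mul_neg, Complex.sin_neg]
      have e2 : Complex.cos (π * -x) = Complex.cos (π * x) := by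
        rw [mul_neg, Complex.cos_neg]
      have := simple_pole (G := fun w : ℂ => π * (2 * x) /
        (Complex.sin (π * z * w) * Complex.cos (π * w) * (w - x))) (s := fun w => w + (x:ℂ))
        (p := (-x:ℂ)) (s' := 1)
        (by
          have : Complex.sin (π * z * -x) * Complex.cos (π * -x) * (-x - x) ≠ 0 := by
            rw [e1, e2]
            exact mul_ne_zero (mul_ne_zero (neg_ne_zero.2 hs') hc') h2
          fun_prop (disch := assumption)) ((hasDerivAt_id _).add_const _) (by simp) one_ne_zero
      have h3 : ((p (Sum.inl false) : ℝ) : ℂ) = -x := by simp [hp]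
      rw [h3]
      convert this.congr _ using 2
      · rw [hf, e1, e2]; push_cast
        rw [show (-x:ℂ) - x = -(2 * x) by ring]
        field_simp
      · intro w; simp only [hF, div_eq_mul_inv, mul_inv]; ring
  have lim_k : ∀ k : ℤ, Tendsto (fun w => (w - (((k / z : ℝ)) : ℂ)) * F w)
      (𝓝[≠] (((k / z : ℝ)) : ℂ)) (𝓝 ((rk k : ℝ) : ℂ)) := by
    intro k
    set q : ℝ := k / z with hq
    have hqz : z * q = k := by rw [hq]; field_simp
    have hc' : Complex.cos (π * q) ≠ 0 := by exact_mod_cast hck k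
    have h1 : (q:ℂ) - x ≠ 0 := sub_ne_zero.2 (by exact_mod_cast hk1 k)
    have h2 : (q:ℂ) + x ≠ 0 := by
      intro h; apply hk2 k; exact_mod_cast eq_neg_of_add_eq_zero_left h
    have e0 : (π * z * q : ℝ) = k * π := by rw [mul_assoc, hqz]; ring
    have e0' : (π * z * q : ℂ) = ((k * π : ℝ) : ℂ) := by
      rw [← e0]; push_cast; rfl
    have := simple_pole (G := fun w : ℂ => π * (2 * x) /
        (Complex.cos (π * w) * (w - x) * (w + x))) (s := fun w => Complex.sin (π * z * w))
        (p := (q:ℂ)) (s' := Complex.cos (π * z * q) * (π * z))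
        (by
          have := mul_ne_zero (mul_ne_zero hc' h1) h2
          fun_prop (disch := assumption))
        (by
          have := ((hasDerivAt_id (q:ℂ)).const_mul (π * z : ℂ)).csin
          simpa using this)
        (by
          show Complex.sin (π * z * q) = 0
          rw [e0', ← Complex.ofReal_sin, Real.sin_int_mul_pi]; simp)
        (by
          rw [e0', ← Complex.ofReal_cos]
          have := mul_ne_zero (hcc k) (mul_ne_zero hpi hz)
          exact_mod_cast this)
    convert this.congr _ using 2
    · rw [e0']
      have h1 : q - x ≠ 0 := by exact_mod_cast h1
      have h2 : q + x ≠ 0 := by exact_mod_cast h2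
      have e3 : Real.cos (π * k * (1 + 1/z)) = Real.cos (k * π) * Real.cos (π * q) := by
        rw [show π * k * (1 + 1/z) = k * π + π * q by rw [hq]; field_simp, Real.cos_add,
          Real.sin_int_mul_pi]
        ring
      have e4 : (k:ℝ)^2 - z^2 * x^2 = z^2 * ((q - x) * (q + x)) := by rw [← hqz]; ring
      have : rk k = π * (2 * x) / (Real.cos (π * q) * (q - x) * (q + x)) /
          (Real.cos (k * π) * (π * z)) := by
        simp only [hrk]
        rw [e3, e4]
        have := hcc k
        have := hck k
        field_simp
      rw [this]
      push_cast
      rfl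
    · intro w; simp only [hF, div_eq_mul_inv, mul_inv]; ring
  have lim_n : ∀ n : ℤ, n ≠ 0 → Tendsto (fun w => (w - (((n / 2 : ℝ)) : ℂ)) * F w)
      (𝓝[≠] (((n / 2 : ℝ)) : ℂ)) (𝓝 ((rn n : ℝ) : ℂ)) := by
    intro n hn
    set q : ℝ := n / 2 with hq
    have hs : Real.sin (π * z * q) ≠ 0 := hsn n hn
    have hq1 : q ≠ x := hn1 n hn
    have hq2 : q ≠ -x := hn2 n hn
    have hs' : Complex.sin (π * z * q) ≠ 0 := by exact_mod_cast hs
    have h1 : (q:ℂ) - x ≠ 0 := sub_ne_zero.2 (by exact_mod_cast hq1)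
    have h2 : (q:ℂ) + x ≠ 0 := by
      intro h; apply hq2; exact_mod_cast eq_neg_of_add_eq_zero_left h
    have h1' : q - x ≠ 0 := by exact_mod_cast h1
    have h2' : q + x ≠ 0 := by exact_mod_cast h2
    have e4 : (n:ℝ)^2 - 4 * x^2 = 4 * ((q - x) * (q + x)) := by rw [hq]; ring
    have e5 : π * n * z / 2 = π * z * q := by rw [hq]; ring
    have e6 : π * n / 2 = π * q := by rw [hq]; ring
    by_cases hc : Real.cos (π * q) = 0
    · have hsq : Real.sin (π * q) ^ 2 = 1 := by
        have := Real.sin_sq_add_cos_sq (π * q)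
        rw [hc] at this; linarith
      have hsq0 : Real.sin (π * q) ≠ 0 := by
        intro h; rw [h] at hsq; norm_num at hsq
      have := simple_pole (G := fun w : ℂ => π * (2 * x) /
        (Complex.sin (π * z * w) * (w - x) * (w + x))) (s := fun w => Complex.cos (π * w))
        (p := (q:ℂ)) (s' := -Complex.sin (π * q) * π)
        (by
          have := mul_ne_zero (mul_ne_zero hs' h1) h2
          fun_prop (disch := assumption))
        (by
          have := ((hasDerivAt_id (q:ℂ)).const_mul (π : ℂ)).ccos
          simpa using this)
        (by
          show Complex.cos (π * q) = 0
          exact_mod_cast hc)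
        (by
          have := mul_ne_zero (neg_ne_zero.2 hsq0) hpi
          exact_mod_cast this)
      convert this.congr _ using 2
      · have : rn n = π * (2 * x) / (Real.sin (π * z * q) * (q - x) * (q + x)) /
          (-Real.sin (π * q) * π) := by
          simp only [hrn]
          rw [e4, e5, e6]
          field_simp
          rw [hsq]; ring
        rw [this]
        push_cast
        rfl
      · intro w; simp only [hF, div_eq_mul_inv, mul_inv]; ring
    · have hc' : Complex.cos (π * q) ≠ 0 := by exact_mod_cast hc
      have hr0 : rn n = 0 := by
        have : Real.sin (π * q) = 0 := by
          have h3 : Real.sin (2 * (π * q)) = 0 := by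
            rw [show 2 * (π * q) = n * π by rw [hq]; ring, Real.sin_int_mul_pi]
          rw [Real.sin_two_mul] at h3
          simpa [hc] using h3
        simp only [hrn]
        rw [e6, this]; simp
      rw [hr0]
      have hFc : ContinuousAt (fun w => (w - (q:ℂ)) * F w) q := by
        simp only [hF]
        have := mul_ne_zero (mul_ne_zero (mul_ne_zero hs' hc') h1) h2
        fun_prop (disch := assumption)
      have := hFc.tendsto
      simp only [sub_self, zero_mul] at this
      simpa using this.mono_left nhdsWithin_le_nhds
  -- main
  refine ⟨16 * π * |x| / (|z| * δ), fun N hN => ?_⟩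
  obtain ⟨R, hR1, hR2, hR3⟩ := hrad N
  have hN0 : (0:ℝ) ≤ N := Nat.cast_nonneg N
  have hR0 : 0 < R := by linarith
  set K := ⌊R * |z|⌋₊ with hK
  have hKle : (K:ℝ) ≤ R * |z| := Nat.floor_le (by positivity)
  have hKlt : R * |z| < K + 1 := Nat.lt_floor_add_one _
  refine ⟨K, by nlinarith, ?_⟩
  set s : Finset (Bool ⊕ (ℤ ⊕ ℤ)) := Finset.disjSum Finset.univ
    (Finset.disjSum (Finset.Icc (-(K:ℤ)) K)
      ((Finset.Icc (-((2 * N + 1 : ℕ):ℤ)) (2 * N + 1 : ℕ)).erase 0)) with hs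
  have hres := residue_sum R hR0 (fun i => ((p i : ℝ) : ℂ)) (fun i => ((r i : ℝ) : ℂ)) s F
    ?_ ?_ ?_ ?_
  · have hsum : ∑ i ∈ s, ((r i : ℝ) : ℂ) = ((2 * f + ∑ k ∈ Finset.Icc (-(K:ℤ)) K, rk k +
        ∑ n ∈ (Finset.Icc (-((2 * N + 1 : ℕ):ℤ)) (2 * N + 1 : ℕ)).erase 0, rn n : ℝ) : ℂ) := by
      rw [← Complex.ofReal_sum, hs, Finset.sum_disjSum, Finset.sum_disjSum]
      congr 1
      simp only [hr, Sum.elim_inl, Sum.elim_inr]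
      simp
      ring
    rw [hsum] at hres
    set S := 2 * f + ∑ k ∈ Finset.Icc (-(K:ℤ)) K, rk k +
        ∑ n ∈ (Finset.Icc (-((2 * N + 1 : ℕ):ℤ)) (2 * N + 1 : ℕ)).erase 0, rn n with hS
    have hbound : ∀ w ∈ sphere (0:ℂ) R, ‖F w‖ ≤ 8 * π * |x| / (|z| * δ) / R^2 * 2 := by
      intro w hw
      have hw : ‖w‖ = R := by simpa using hw
      have b1 : 2 * (|z| * δ) ≤ ‖Complex.sin (π * z * w)‖ := by
        have h1 := norm_sin_ge (z * w)
        rw [← mul_assoc] at h1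
        refine le_trans ?_ h1
        set k := round ((z:ℂ) * w).re
        have h2 := norm_sub_norm_le ((z:ℂ) * w) k
        have h3 := norm_sub_norm_le (k:ℂ) ((z:ℂ) * w)
        rw [norm_sub_rev (k:ℂ)] at h3
        have h4 : ‖(z:ℂ) * w‖ = |z| * R := by rw [norm_mul, hw]; simp
        have h5 : ‖(k:ℂ)‖ = ((|k| : ℤ) : ℝ) := by simp
        rw [h4, h5] at h2 h3
        have h6 := hR3 |k|
        have h7 : |z| * δ ≤ |(|z| * R - ((|k| : ℤ) : ℝ))| := by
          have : |z| * R - ((|k| : ℤ) : ℝ) = |z| * (R - ((|k| : ℤ) : ℝ) * (1 / |z|)) := by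
            field_simp
          rw [this, abs_mul, abs_abs]
          gcongr
        have h8 := abs_le.2 ⟨by linarith, h2⟩
        linarith
      have b2 : 1 / 2 ≤ ‖Complex.cos (π * w)‖ := by
        have h1 := norm_sin_ge (w + 1/2)
        rw [show (π:ℂ) * (w + 1/2) = π * w + π / 2 by ring, Complex.sin_add_pi_div_two] at h1
        refine le_trans ?_ h1
        set k := round (w + 1/2).re
        have h2 := norm_sub_norm_le w (k - 1/2)
        have h3 := norm_sub_norm_le ((k:ℂ) - 1/2) w
        rw [norm_sub_rev ((k:ℂ) - 1/2) w] at h3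
        rw [show w + 1/2 - (k:ℂ) = w - (k - 1/2) by ring]
        have h5 : ‖(k:ℂ) - 1/2‖ = |(k:ℝ) - 1/2| := by
          rw [← Real.norm_eq_abs, ← Complex.norm_real]; push_cast; rfl
        rw [hw, h5] at h2 h3
        have h6 : |(k:ℝ) - 1/2| ≤ N + 1/2 ∨ N + 1 + 1/2 ≤ |(k:ℝ) - 1/2| := by
          rcases le_or_gt k 0 with hk | hk
          · have hk' : (k:ℝ) ≤ 0 := by exact_mod_cast hk
            rw [abs_of_nonpos (by linarith)]
            rcases le_or_gt (-k) N with h | h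
            · left
              have : (-k:ℝ) ≤ N := by exact_mod_cast h
              linarith
            · right
              have : (N:ℝ) + 1 ≤ -k := by exact_mod_cast h
              linarith
          · have hk' : (1:ℝ) ≤ k := by exact_mod_cast hk
            rw [abs_of_nonneg (by linarith)]
            rcases le_or_gt k (N+1) with h | h
            · left
              have : (k:ℝ) ≤ N + 1 := by exact_mod_cast h
              linarith
            · right
              have : (N:ℝ) + 1 + 1 ≤ k := by exact_mod_cast h
              linarith
        rcases h6 with h6 | h6 <;> linarith
      have hRx : R / 2 ≤ R - |x| := by linarith
      have b3 : R / 2 ≤ ‖w - x‖ := by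
        have h2 := norm_sub_norm_le w x
        rw [hw, Complex.norm_real, Real.norm_eq_abs] at h2
        linarith
      have b4 : R / 2 ≤ ‖w + x‖ := by
        have h2 := norm_sub_norm_le w (-x)
        rw [hw, norm_neg, Complex.norm_real, Real.norm_eq_abs, sub_neg_eq_add] at h2
        linarith
      have hpos := Real.pi_pos
      simp only [hF]
      rw [norm_div, norm_mul, norm_mul, norm_mul, norm_mul, norm_mul]
      have : ‖(π:ℂ)‖ * (‖(2:ℂ)‖ * ‖(x:ℂ)‖) = π * (2 * |x|) := by
        rw [Complex.norm_real, Complex.norm_real, Real.norm_eq_abs, Real.norm_eq_abs,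
          abs_of_pos hpos]; simp
      rw [this]
      calc _ ≤ π * (2 * |x|) / (2 * (|z| * δ) * (1/2) * (R/2) * (R/2)) := by gcongr
        _ ≤ _ := by
          apply le_of_eq_of_le (b := 8 * π * |x| / (|z| * δ) / R^2)
          · field_simp; norm_num
          · have : 0 ≤ 8 * π * |x| / (|z| * δ) / R^2 := by positivity
            linarith
    have h1 := circleIntegral.norm_integral_le_of_norm_le_const hR0.le hbound
    rw [hres, norm_mul, Complex.norm_real, Real.norm_eq_abs] at h1
    have h2 : ‖2 * (π:ℂ) * Complex.I‖ = 2 * π := by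
      simp [abs_of_pos Real.pi_pos]
    rw [h2, mul_assoc (2 * π) R] at h1
    have h3 := le_of_mul_le_mul_left h1 (by positivity)
    refine h3.trans ?_
    calc _ = 16 * π * |x| / (|z| * δ) / R := by field_simp; norm_num
      _ ≤ _ := by
        gcongr
  · -- injectivity
    intro i hi j hj hij
    have hij : p i = p j := Complex.ofReal_injective hij
    simp only [hs, Finset.mem_coe, Finset.mem_disjSum] at hi hj
    rcases i with b | k | n <;> rcases j with b' | k' | n' <;>
      simp only [hp, Sum.elim_inl, Sum.elim_inr] at hij <;> simp at hi hj
    · cases b <;> cases b' <;> simp at hij ⊢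
      · exact hxx hij.symm
      · exact hxx hij
    · cases b <;> simp at hij
      · exact (hk2 _ hij.symm).elim
      · exact (hk1 _ hij.symm).elim
    · cases b <;> simp at hij
      · exact (hn2 _ hj.1 hij.symm).elim
      · exact (hn1 _ hj.1 hij.symm).elim
    · cases b' <;> simp at hij
      · exact (hk2 _ hij).elim
      · exact (hk1 _ hij).elim
    · have : (k:ℝ) = k' := by field_simp at hij; exact hij
      rw [show k = k' by exact_mod_cast this]
    · exact (hkn _ _ hj.1 hij).elim
    · cases b' <;> simp at hij
      · exact (hn2 _ hi.1 hij).elim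
      · exact (hn1 _ hi.1 hij).elim
    · exact (hkn _ _ hi.1 hij.symm).elim
    · have : (n:ℝ) = n' := by linarith
      rw [show n = n' by exact_mod_cast this]
  · -- inside
    intro i hi
    rw [mem_ball_zero_iff, Complex.norm_real, Real.norm_eq_abs]
    simp only [hs, Finset.mem_disjSum] at hi
    rcases i with b | k | n <;> simp only [hp, Sum.elim_inl, Sum.elim_inr] <;> simp at hi
    · have := abs_nonneg x
      cases b <;> simp <;> linarith
    · have h1 : |(k:ℝ)| ≤ K := by
        rw [abs_le]
        exact ⟨by exact_mod_cast hi.1, by exact_mod_cast hi.2⟩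
      have h2 := hR3 |k|
      have h3 : |(k / z : ℝ)| = ((|k| : ℤ):ℝ) * (1 / |z|) := by
        rw [abs_div]; push_cast; ring
      have h4 : |(k / z : ℝ)| ≤ R := by
        rw [abs_div, div_le_iff₀ hz']; linarith
      refine lt_of_le_of_ne h4 ?_
      intro h
      rw [← h3, h, sub_self, abs_zero] at h2
      linarith
    · have h1 : |(n:ℝ)| ≤ 2 * N + 1 := by
        rw [abs_le]
        have a1 : (-1 + -(2 * (N:ℤ))) ≤ n := by omega
        have a2 : n ≤ 2 * (N:ℤ) + 1 := by omega
        have a1' : (-1 + -(2 * (N:ℝ))) ≤ n := by exact_mod_cast a1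
        exact ⟨by linarith, by exact_mod_cast a2⟩
      rw [abs_div, abs_two]
      linarith
  · -- differentiability
    intro w hw hne
    have hw : ‖w‖ ≤ R := by simpa using hw
    have n1 : w - x ≠ 0 := by
      have := hne (Sum.inl true) (by simp [hs])
      simp [hp] at this
      exact sub_ne_zero.2 this
    have n2 : w + x ≠ 0 := by
      have := hne (Sum.inl false) (by simp [hs])
      simp [hp] at this
      intro h
      exact this (eq_neg_of_add_eq_zero_left h)
    have hzc : (z:ℂ) ≠ 0 := by exact_mod_cast hz
    have hpc : (π:ℂ) ≠ 0 := by exact_mod_cast hpi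
    have n3 : Complex.sin (π * z * w) ≠ 0 := by
      intro h
      rw [Complex.sin_eq_zero_iff] at h
      obtain ⟨k, hk⟩ := h
      have hwk : w = ((k / z : ℝ) : ℂ) := by
        push_cast
        field_simp
        apply mul_left_cancel₀ hpc
        linear_combination hk
      refine hne (Sum.inr (Sum.inl k)) ?_ hwk
      rw [hwk, Complex.norm_real, Real.norm_eq_abs, abs_div, div_le_iff₀ hz'] at hw
      have : k.natAbs ≤ K := by
        apply Nat.le_floor
        simpa using hw
      simp [hs]
      omega
    have n4 : Complex.cos (π * w) ≠ 0 := by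
      intro h
      rw [Complex.cos_eq_zero_iff] at h
      obtain ⟨j, hj⟩ := h
      have hwk : w = (((2 * j + 1 : ℤ) / 2 : ℝ) : ℂ) := by
        push_cast
        apply mul_left_cancel₀ hpc
        linear_combination hj
      refine hne (Sum.inr (Sum.inr (2 * j + 1))) ?_ hwk
      rw [hwk, Complex.norm_real, Real.norm_eq_abs, abs_div, abs_two, div_le_iff₀ two_pos, abs_le'] at hw
      push_cast at hw
      have a1 : (j:ℝ) < N + 1 := by linarith
      have a2 : (-j:ℝ) < N + 2 := by linarith
      have a1' : j < N + 1 := by exact_mod_cast a1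
      have a2' : -j < N + 2 := by exact_mod_cast a2
      simp [hs]
      omega
    have := mul_ne_zero (mul_ne_zero (mul_ne_zero n3 n4) n1) n2
    simp only [hF]
    fun_prop (disch := assumption)
  · intro i hi
    simp only [hs, Finset.mem_disjSum] at hi
    rcases i with b | k | n
    · exact lim_x b
    · exact lim_k k
    · simp at hi
      exact lim_n n hi.1

open Filter Topology in
theorem csc_sec_convolution (z x : ℝ) (hirr : Irrational z) (halg : IsAlgebraic ℚ z)
    (hzx : z * x ≠ 0)
    (hsin : Real.sin (π * z * x) ≠ 0)
    (hcos : Real.cos (π * x) ≠ 0)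
    (hden1 : ∀ n : ℕ, ((n : ℝ) + 1) ^ 2 - 4 * x ^ 2 ≠ 0)
    (hden2 : ∀ n : ℕ, ((n : ℝ) + 1) ^ 2 - z ^ 2 * x ^ 2 ≠ 0)
    (hsum1 : Summable (fun n : ℕ =>
      |chiFour (n + 1) * (1 / Real.sin (π * (n + 1) * z / 2)) / (((n : ℝ) + 1) ^ 2 - 4 * x ^ 2)|))
    (hsum2 : Summable (fun n : ℕ =>
      |(1 / Real.cos (π * (n + 1) * (1 + 1 / z))) / (((n : ℝ) + 1) ^ 2 - z ^ 2 * x ^ 2)|)) :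
    π * (1 / Real.sin (π * z * x)) * (1 / Real.cos (π * x)) =
      1 / (z * x) +
        8 * x * (∑' n : ℕ,
          chiFour (n + 1) * (1 / Real.sin (π * (n + 1) * z / 2)) / (((n : ℝ) + 1) ^ 2 - 4 * x ^ 2)) -
        2 * z * x * (∑' n : ℕ,
          (1 / Real.cos (π * (n + 1) * (1 + 1 / z))) / (((n : ℝ) + 1) ^ 2 - z ^ 2 * x ^ 2)) := by
  have hz : z ≠ 0 := left_ne_zero_of_mul hzx
  have hx : x ≠ 0 := right_ne_zero_of_mul hzx
  obtain ⟨C, hC⟩ := key z x hirr hzx hsin hcos hden1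
  choose! K hK1 hK2 using hC
  set a : ℕ → ℝ := fun n : ℕ =>
    chiFour (n + 1) * (1 / Real.sin (π * (n + 1) * z / 2)) / (((n : ℝ) + 1) ^ 2 - 4 * x ^ 2) with ha
  set b : ℕ → ℝ := fun n : ℕ =>
    (1 / Real.cos (π * (n + 1) * (1 + 1 / z))) / (((n : ℝ) + 1) ^ 2 - z ^ 2 * x ^ 2) with hb
  have hA := (summable_abs_iff.1 hsum1).hasSum.tendsto_sum_nat
  have hB := (summable_abs_iff.1 hsum2).hasSum.tendsto_sum_nat
  have hlarge : ∀ᶠ N : ℕ in atTop, 2 * |x| ≤ N :=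
    tendsto_natCast_atTop_atTop.eventually_ge_atTop _
  have hKt : Tendsto K atTop atTop := by
    rw [← tendsto_natCast_atTop_iff (R := ℝ)]
    have h1 : Tendsto (fun N : ℕ => (N:ℝ) * |z| + (-1)) atTop atTop :=
      tendsto_atTop_add_const_right _ _
        (tendsto_natCast_atTop_atTop.atTop_mul_const (abs_pos.2 hz))
    refine tendsto_atTop_mono' _ ?_ h1
    filter_upwards [hlarge] with N hN
    have := hK1 N hN
    linarith
  have hMt : Tendsto (fun N : ℕ => 2 * N + 1) atTop atTop :=
    tendsto_atTop_mono (fun N => by simp only [id]; omega) tendsto_id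
  have hA' := hA.comp hMt
  have hB' := hB.comp hKt
  set f : ℝ := π / (Real.sin (π * z * x) * Real.cos (π * x)) with hf
  have hlim : Tendsto (fun N : ℕ => 2 * f + (-(2 / (z * x)) +
      2 * (2 * x * z * ∑ i ∈ Finset.range (K N), b i)) +
      2 * (-(8 * x) * ∑ i ∈ Finset.range (2 * N + 1), a i)) atTop
      (𝓝 (2 * f + (-(2 / (z * x)) + 2 * (2 * x * z * ∑' n, b n)) +
        2 * (-(8 * x) * ∑' n, a n))) := by
    refine Tendsto.add (Tendsto.add tendsto_const_nhds (Tendsto.add tendsto_const_nhds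
      (Tendsto.const_mul _ (Tendsto.const_mul _ hB')))) (Tendsto.const_mul _ (Tendsto.const_mul _ hA'))
  have hzero : Tendsto (fun N : ℕ => 2 * f + (-(2 / (z * x)) +
      2 * (2 * x * z * ∑ i ∈ Finset.range (K N), b i)) +
      2 * (-(8 * x) * ∑ i ∈ Finset.range (2 * N + 1), a i)) atTop (𝓝 0) := by
    have hC0 : Tendsto (fun N : ℕ => C / ((N:ℝ) + 1)) atTop (𝓝 0) :=
      Tendsto.const_div_atTop
        (tendsto_atTop_add_const_right _ _ tendsto_natCast_atTop_atTop) C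
    refine squeeze_zero_norm' ?_ hC0
    filter_upwards [hlarge] with N hN
    rw [Real.norm_eq_abs]
    have h := hK2 N hN
    rw [sum_Icc_even (fun k : ℤ =>
      2 * x * z / (Real.cos (π * k * (1 + 1 / z)) * (k ^ 2 - z ^ 2 * x ^ 2)))
      (by
        intro k
        push_cast
        rw [show π * -(k:ℝ) * (1 + 1 / z) = -(π * k * (1 + 1 / z)) by ring, Real.cos_neg, neg_sq])
      (K N)] at h
    rw [Finset.sum_erase _ (by simp), sum_Icc_even (fun n : ℤ =>
      -(8 * x * Real.sin (π * n / 2) / (Real.sin (π * n * z / 2) * (n ^ 2 - 4 * x ^ 2))))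
      (by
        intro k
        push_cast
        rw [show π * -(k:ℝ) / 2 = -(π * k / 2) by ring,
          show π * -(k:ℝ) * z / 2 = -(π * k * z / 2) by ring, Real.sin_neg, Real.sin_neg, neg_sq]
        rw [mul_neg, neg_mul, neg_div_neg_eq])
      (2 * N + 1)] at h
    convert h using 2
    congr 1
    · congr 1
      congr 1
      · simp; field_simp
      · congr 1
        rw [Finset.mul_sum]
        refine Finset.sum_congr rfl fun i _ => ?_
        simp only [hb]
        push_cast
        rw [div_div, mul_one_div]
    · simp only [Int.cast_zero, mul_zero, zero_div, Real.sin_zero, neg_zero, zero_add]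
      congr 1
      rw [Finset.mul_sum]
      refine Finset.sum_congr rfl fun i _ => ?_
      simp only [ha, chiFour]
      rw [chiFour_sin]
      push_cast
      rw [mul_one_div, div_div, neg_mul, ← mul_div_assoc]
  have heq := tendsto_nhds_unique hlim hzero
  have hl : π * (1 / Real.sin (π * z * x)) * (1 / Real.cos (π * x)) = f := by
    rw [hf]; field_simp
  have h2 : 2 / (z * x) = 2 * (1 / (z * x)) := by ring
  rw [hl]
  rw [h2] at heq
  linear_combination (1/2) * heq
end

section
/- The partial fraction expansion π(sec(πx) − 1) = 16x² ∑_{n=1}^∞ χ₋₄(n) / (n(n² − 4x²)) holds for all real x that are not half-integers. -/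
open Real

open Filter Topology

lemma spf_cot_tendsto (u : ℝ) (hu : ∀ m : ℤ, u ≠ (m : ℝ)) :
    Tendsto (fun N : ℕ => 1 / u + ∑ n ∈ Finset.range N,
      (1 / (u - ((n : ℝ) + 1)) + 1 / (u + ((n : ℝ) + 1)))) atTop
      (𝓝 (π * (Real.cos (π * u) / Real.sin (π * u)))) := by
  have hz : (u : ℂ) ∈ Complex.integerComplement := by
    rw [Complex.integerComplement]
    rintro ⟨m, hm⟩
    apply hu m
    exact_mod_cast hm.symm
  have h1 := cot_series_rep' hz
  have h2 := (summable_cotTerm hz).hasSum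
  simp only [cotTerm] at h2
  rw [← h1] at h2
  have h3 : HasSum (fun n : ℕ => (1 / (u - ((n : ℝ) + 1)) + 1 / (u + ((n : ℝ) + 1))))
      (π * (Real.cos (π * u) / Real.sin (π * u)) - 1 / u) := by
    rw [← Complex.hasSum_ofReal]
    push_cast
    rw [Complex.cot] at h2
    exact h2
  have h4 := h3.tendsto_sum_nat.const_add (1 / u)
  simpa using h4

lemma spf_summable (x : ℝ) : Summable (fun n : ℕ =>
    chiFour (n + 1) / (((n : ℝ) + 1) * (((n : ℝ) + 1) ^ 2 - 4 * x ^ 2))) := by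
  have hs : Summable (fun n : ℕ => 2 * (1 / ((n : ℝ) + 1) ^ 2)) := by
    apply Summable.mul_left
    have := (summable_nat_add_iff 1).2 (Real.summable_one_div_nat_pow.2 (by norm_num : 1 < 2))
    simpa using this
  refine Summable.of_norm_bounded_eventually_nat hs ?_
  filter_upwards [eventually_ge_atTop (⌈8 * x ^ 2⌉₊)] with n hn
  have hn' : 8 * x ^ 2 ≤ n := Nat.ceil_le.1 hn
  have hn0 : (0 : ℝ) ≤ n := Nat.cast_nonneg n
  have hc : |chiFour (n + 1)| ≤ 1 := by
    unfold chiFour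
    split_ifs <;> simp
  have hd : ((n : ℝ) + 1) ^ 2 / 2 ≤ ((n : ℝ) + 1) * (((n : ℝ) + 1) ^ 2 - 4 * x ^ 2) := by
    have : ((n : ℝ) + 1) ^ 2 / 2 ≤ ((n : ℝ) + 1) ^ 2 - 4 * x ^ 2 := by nlinarith
    have h0 : 0 ≤ ((n : ℝ) + 1) ^ 2 / 2 := by positivity
    nlinarith
  have hp : 0 < ((n : ℝ) + 1) ^ 2 / 2 := by positivity
  rw [Real.norm_eq_abs, abs_div, abs_of_pos (lt_of_lt_of_le hp hd)]
  calc _ ≤ 1 / (((n : ℝ) + 1) ^ 2 / 2) := div_le_div₀ zero_le_one hc hp hd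
    _ = _ := by field_simp

lemma spf_chi (N : ℕ) : chiFour (4 * N + 1) = 1 ∧ chiFour (4 * N + 2) = 0 ∧
    chiFour (4 * N + 3) = -1 ∧ chiFour (4 * N + 4) = 0 := by
  unfold chiFour
  have h1 : (4 * N + 1) % 4 = 1 := by omega
  have h2 : (4 * N + 2) % 4 = 2 := by omega
  have h3 : (4 * N + 3) % 4 = 3 := by omega
  have h4 : (4 * N + 4) % 4 = 0 := by omega
  simp [h1, h2, h3, h4]

lemma spf_term (a x : ℝ) (ha : a ≠ 0) (h1 : a - 2 * x ≠ 0) (h2 : a + 2 * x ≠ 0) :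
    16 * x ^ 2 * (1 / (a * (a ^ 2 - 4 * x ^ 2))) =
      2 / (a - 2 * x) + 2 / (a + 2 * x) - 4 / a := by
  have : a ^ 2 - 4 * x ^ 2 = (a - 2 * x) * (a + 2 * x) := by ring
  rw [this]
  obtain ⟨p, hp⟩ : ∃ p, p = a - 2 * x := ⟨_, rfl⟩
  obtain ⟨q, hq⟩ : ∃ q, q = a + 2 * x := ⟨_, rfl⟩
  rw [← hp] at h1 ⊢
  rw [← hq] at h2 ⊢
  field_simp
  rw [hp, hq]
  ring

/-- Partial sums of the cotangent series. -/
noncomputable def spfC (u : ℝ) (N : ℕ) : ℝ := 1 / u + ∑ n ∈ Finset.range N,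
      (1 / (u - ((n : ℝ) + 1)) + 1 / (u + ((n : ℝ) + 1)))

lemma spf_partial (x : ℝ) (hx : ∀ m : ℤ, x ≠ (m : ℝ) + 1/2) (N : ℕ) :
    16 * x ^ 2 * ∑ n ∈ Finset.range (4 * N + 1),
        chiFour (n + 1) / (((n : ℝ) + 1) * (((n : ℝ) + 1) ^ 2 - 4 * x ^ 2)) =
      (spfC ((1 + 2 * x) / 4) N + spfC ((1 - 2 * x) / 4) N) / 2 - spfC (1 / 4) N := by
  have ne1 : ∀ m : ℤ, (2 * m + 1 : ℝ) - 2 * x ≠ 0 := fun m h => hx m (by linarith)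
  have ne2 : ∀ m : ℤ, (2 * m + 1 : ℝ) + 2 * x ≠ 0 := fun m h =>
    hx (-m - 1) (by push_cast; linarith)
  induction N with
  | zero =>
    have a1 := ne1 0
    have a2 := ne2 0
    have t := spf_term 1 x one_ne_zero (by simpa using a1) (by simpa using a2)
    have c := (spf_chi 0).1
    simp only [mul_zero, zero_add] at c
    simp only [spfC, mul_zero, zero_add, Finset.sum_range_one, Finset.range_zero,
      Finset.sum_empty, c, Nat.cast_zero, add_zero]
    rw [t]
    norm_num at a1 a2
    field_simp
    ring
  | succ N ih =>
    obtain ⟨-, c2, c3, c4⟩ := spf_chi N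
    obtain ⟨c5, -⟩ := spf_chi (N + 1)
    have hN : (0 : ℝ) ≤ N := Nat.cast_nonneg N
    have p1 := ne1 (2 * N + 1)
    have p2 := ne2 (2 * N + 1)
    have q1 := ne1 (2 * N + 2)
    have q2 := ne2 (2 * N + 2)
    push_cast at p1 p2 q1 q2
    have t3 := spf_term (4 * N + 3) x (by positivity) (by convert p1 using 1; ring)
      (by convert p2 using 1; ring)
    have t5 := spf_term (4 * N + 5) x (by positivity) (by convert q1 using 1; ring)
      (by convert q2 using 1; ring)
    have e : 4 * (N + 1) + 1 = 4 * N + 1 + 1 + 1 + 1 + 1 := by ring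
    rw [e, Finset.sum_range_succ, Finset.sum_range_succ, Finset.sum_range_succ,
      Finset.sum_range_succ]
    have c5' : chiFour (4 * N + 1 + 1 + 1 + 1 + 1) = 1 := by rw [← c5]; rfl
    have c4' : chiFour (4 * N + 1 + 1 + 1 + 1) = 0 := by rw [← c4]
    have c3' : chiFour (4 * N + 1 + 1 + 1) = -1 := by rw [← c3]
    have c2' : chiFour (4 * N + 1 + 1) = 0 := by rw [← c2]
    rw [c5', c4', c3', c2']
    have s : ∀ u : ℝ, spfC u (N + 1) = spfC u N +
        (1 / (u - ((N : ℝ) + 1)) + 1 / (u + ((N : ℝ) + 1))) := by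
      intro u
      simp only [spfC, Finset.sum_range_succ]
      ring
    rw [s, s, s]
    push_cast
    have f3 : (4 * (N : ℝ) + 2 + 1) = 4 * N + 3 := by ring
    have f5 : (4 * (N : ℝ) + 4 + 1) = 4 * N + 5 := by ring
    rw [f5, f3, zero_div, zero_div, neg_div]
    have d1 : 1 / ((1 + 2 * x) / 4 - ((N : ℝ) + 1)) = - (4 / (4 * N + 3 - 2 * x)) := by
      rw [← div_neg, show (1 + 2 * x) / 4 - ((N : ℝ) + 1) = -(4 * N + 3 - 2 * x) / 4 by ring,
        one_div_div]
    have d2 : 1 / ((1 + 2 * x) / 4 + ((N : ℝ) + 1)) = 4 / (4 * N + 5 + 2 * x) := by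
      rw [show (1 + 2 * x) / 4 + ((N : ℝ) + 1) = (4 * N + 5 + 2 * x) / 4 by ring, one_div_div]
    have d3 : 1 / ((1 - 2 * x) / 4 - ((N : ℝ) + 1)) = - (4 / (4 * N + 3 + 2 * x)) := by
      rw [← div_neg, show (1 - 2 * x) / 4 - ((N : ℝ) + 1) = -(4 * N + 3 + 2 * x) / 4 by ring,
        one_div_div]
    have d4 : 1 / ((1 - 2 * x) / 4 + ((N : ℝ) + 1)) = 4 / (4 * N + 5 - 2 * x) := by
      rw [show (1 - 2 * x) / 4 + ((N : ℝ) + 1) = (4 * N + 5 - 2 * x) / 4 by ring, one_div_div]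
    have d5 : 1 / (1 / 4 - ((N : ℝ) + 1)) = - (4 / (4 * N + 3)) := by
      rw [← div_neg, show 1 / 4 - ((N : ℝ) + 1) = -(4 * N + 3) / 4 by ring, one_div_div]
    have d6 : 1 / (1 / 4 + ((N : ℝ) + 1)) = 4 / (4 * N + 5) := by
      rw [show 1 / 4 + ((N : ℝ) + 1) = (4 * N + 5) / 4 by ring, one_div_div]
    rw [d1, d2, d3, d4, d5, d6]
    linear_combination ih - t3 + t5

theorem secant_partial_fractions (x : ℝ) (hx : ∀ m : ℤ, x ≠ (m : ℝ) + 1/2) :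
    π * (1 / Real.cos (π * x) - 1) =
      16 * x ^ 2 * ∑' n : ℕ,
        chiFour (n + 1) / (((n : ℝ) + 1) * (((n : ℝ) + 1) ^ 2 - 4 * x ^ 2)) := by
  have hu : ∀ m : ℤ, (1 + 2 * x) / 4 ≠ (m : ℝ) := fun m h =>
    hx (2 * m - 1) (by push_cast; linarith)
  have hv : ∀ m : ℤ, (1 - 2 * x) / 4 ≠ (m : ℝ) := fun m h =>
    hx (-2 * m) (by push_cast; linarith)
  have hw : ∀ m : ℤ, (1 / 4 : ℝ) ≠ (m : ℝ) := fun m h => by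
    have : (1 : ℝ) = 4 * m := by linarith
    have : (1 : ℤ) = 4 * m := by exact_mod_cast this
    omega
  have T := ((((spf_cot_tendsto _ hu).add (spf_cot_tendsto _ hv)).div_const 2).sub
    (spf_cot_tendsto _ hw))
  have L := ((spf_summable x).hasSum.tendsto_sum_nat.comp
    (tendsto_atTop_mono (fun N : ℕ => (by omega : N ≤ 4 * N + 1)) tendsto_id)).const_mul
      (16 * x ^ 2)
  have key := tendsto_nhds_unique L (T.congr fun N => (spf_partial x hx N).symm)
  rw [key]
  have hsin : ∀ u : ℝ, (∀ m : ℤ, u ≠ (m : ℝ)) → Real.sin (π * u) ≠ 0 := by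
    intro u hu h
    obtain ⟨m, hm⟩ := Real.sin_eq_zero_iff.1 h
    exact hu m (mul_left_cancel₀ Real.pi_ne_zero (by linarith))
  have su := hsin _ hu
  have sv := hsin _ hv
  have ev : π * ((1 - 2 * x) / 4) = π / 2 - π * ((1 + 2 * x) / 4) := by ring
  rw [ev, Real.sin_pi_div_two_sub] at sv
  rw [ev, Real.sin_pi_div_two_sub, Real.cos_pi_div_two_sub]
  have ex : Real.cos (π * x) = 2 * Real.sin (π * ((1 + 2 * x) / 4)) *
      Real.cos (π * ((1 + 2 * x) / 4)) := by
    rw [← Real.sin_two_mul, ← Real.sin_add_pi_div_two]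
    congr 1
    ring
  have e4 : π * (1 / 4) = π / 4 := by ring
  rw [ex, e4, Real.cos_pi_div_four, Real.sin_pi_div_four, div_self (by positivity)]
  have h1 := Real.sin_sq_add_cos_sq (π * ((1 + 2 * x) / 4))
  generalize Real.sin (π * ((1 + 2 * x) / 4)) = s at *
  generalize Real.cos (π * ((1 + 2 * x) / 4)) = c at *
  field_simp
  linear_combination -h1
end
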